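/- arXiv:1509.02254 — 5 statements merged into one kernel-verified Lean document; each statement's English description precedes it below -/
import Mathlib

section
/- (Bihan) Let P_1, …, P_k be lattice polytopes in ℝ^d. Then DMV(P_1,…,P_k) ≥ 0. Consequently, the mixed Ehrhart polynomial satisfies ME_{P_1,…,P_k}(n) ≥ 0 for every integer n ≥ 0. -/
open Pointwise MeasureTheory Filter
open scoped Classical

/-- A lattice polytope in `ℝ^d`: the convex hull of finitely many integer points. -/
def IsLatticePolytope {d : ℕ} (P : Set (Fin d → ℝ)) : Prop :=
  ∃ V : Finset (Fin d → ℤ), V.Nonempty ∧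
    P = convexHull ℝ ((fun z : Fin d → ℤ => fun i => (z i : ℝ)) '' ↑V)

/-- The number of lattice points of a subset of `ℝ^d`. -/
noncomputable def latticePointCount {d : ℕ} (P : Set (Fin d → ℝ)) : ℕ :=
  Set.ncard {z : Fin d → ℤ | (fun i => (z i : ℝ)) ∈ P}

/-- The discrete mixed volume `DMV(P_1, …, P_k)`; here `∑ j ∈ J, P j` is a Minkowski
sum of sets, with the empty sum being `{0}`. -/
noncomputable def DMV {d k : ℕ} (P : Fin k → Set (Fin d → ℝ)) : ℤ :=
  ∑ J : Finset (Fin k), (-1) ^ (k - J.card) * (latticePointCount (∑ j ∈ J, P j) : ℤ)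

/-- The dimension of a polytope: the dimension of its affine hull. -/
noncomputable def polytopeDim {d : ℕ} (P : Set (Fin d → ℝ)) : ℕ :=
  Module.finrank ℝ (affineSpan ℝ P).direction

open Polynomial in
/-- Real powers `τ, τ², …` of a transcendental number are separated from each other and from `1` by
`ℚ`-linear functionals. -/
theorem exists_rat_independent_reals :
    ∃ t : ℕ → ℝ, ∀ j, ∃ f : ℝ →ₗ[ℚ] ℚ, f 1 = 0 ∧ (∀ i, i ≠ j → f (t i) = 0) ∧ f (t j) = 1 := by
  have hτ : Transcendental ℚ (liouvilleNumber (2 : ℕ)) := by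
    have h := transcendental_liouvilleNumber (le_refl 2)
    rwa [Transcendental, IsFractionRing.isAlgebraic_iff ℤ ℚ ℝ] at h
  set τ : ℝ := liouvilleNumber (2 : ℕ)
  obtain ⟨g, hg⟩ := LinearMap.exists_leftInverse_of_injective (aeval τ : ℚ[X] →ₐ[ℚ] ℝ).toLinearMap
    (LinearMap.ker_eq_bot.2 (transcendental_iff_injective.1 hτ))
  have hpow (n : ℕ) : g (τ ^ n) = X ^ n := by
    simpa using LinearMap.congr_fun hg (X ^ n)
  refine ⟨fun i => τ ^ (i + 1), fun j => ⟨lcoeff ℚ (j + 1) ∘ₗ g, ?_, fun i hij => ?_, ?_⟩⟩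
  · have := hpow 0
    rw [pow_zero, pow_zero] at this
    simp [this, coeff_one]
  · simp [hpow, coeff_X_pow, hij.symm]
  · simp [hpow]

/-- Arbitrarily small heights on finite sets that are generic over `ℚ`. -/
theorem exists_generic_heights {d k : ℕ} (V : Fin k → Finset (Fin d → ℤ)) {δ : ℝ} (hδ : 0 < δ) :
    ∃ h : Fin k → (Fin d → ℤ) → ℝ, (∀ i, ∀ v ∈ V i, |h i v| ≤ δ) ∧
      ∀ j, ∃ f : ℝ →ₗ[ℚ] ℚ, f 1 = 0 ∧ (∀ i, i ≠ j → ∀ v, f (h i v) = 0) ∧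
        Function.Injective fun v => f (h j v) := by
  obtain ⟨t, ht⟩ := exists_rat_independent_reals
  obtain ⟨q, hq⟩ := exists_injective_nat (Fin d → ℤ)
  set M : ℝ := ∑ i, ∑ v ∈ V i, |(q v : ℝ) * t i|
  obtain ⟨N, hN⟩ := exists_nat_gt (M / δ)
  have hM : 0 ≤ M := Finset.sum_nonneg fun i _ => Finset.sum_nonneg fun v _ => abs_nonneg _
  have hN0 : (0 : ℝ) < N := (div_nonneg hM hδ.le).trans_lt hN
  have hN0' : (N : ℚ) ≠ 0 := by
    intro h
    have : (N : ℝ) = 0 := by exact_mod_cast h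
    exact hN0.ne' this
  refine ⟨fun i v => ((q v : ℚ) / N) • t i, fun i v hv => ?_, fun j => ?_⟩
  · have h1 : |(q v : ℝ) * t i| ≤ M :=
      (Finset.single_le_sum (f := fun v => |(q v : ℝ) * t i|) (fun v _ => abs_nonneg _) hv).trans
        (Finset.single_le_sum (f := fun i => ∑ v ∈ V i, |(q v : ℝ) * t i|)
          (fun i _ => Finset.sum_nonneg fun v _ => abs_nonneg _) (Finset.mem_univ i))
    have h2 : ((q v : ℚ) / N) • t i = (q v * t i) / N := by
      rw [Rat.smul_def]; push_cast; ring
    show |((q v : ℚ) / N) • t i| ≤ δ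
    rw [h2, abs_div, abs_of_pos hN0, div_le_iff₀ hN0]
    rw [div_lt_iff₀ hδ] at hN
    linarith
  · obtain ⟨f, hf1, hf0, hfj⟩ := ht j
    refine ⟨f, hf1, fun i hij v => ?_, fun v w hvw => hq ?_⟩
    · simp [hf0 i (fun h => hij (Fin.ext h))]
    · simpa [hfj, hN0', div_left_inj'] using hvw

/-- The inclusion of `ℤ^d` into `ℝ^d`. -/
def intVec {d : ℕ} (z : Fin d → ℤ) : Fin d → ℝ := fun i => (z i : ℝ)

/-- The functional `(x, s) ↦ s - c ⬝ x` on `ℝ^d × ℝ`. -/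
def tilt {d : ℕ} (c : Fin d → ℝ) : (Fin d → ℝ) × ℝ →ₗ[ℝ] ℝ where
  toFun q := q.2 - c ⬝ᵥ q.1
  map_add' p q := by simp [dotProduct_add]; ring
  map_smul' a q := by simp [dotProduct_smul]; ring

theorem tilt_apply {d : ℕ} (c : Fin d → ℝ) (q : (Fin d → ℝ) × ℝ) :
    tilt c q = q.2 - c ⬝ᵥ q.1 := rfl

/-- The face of `Q` on which `tilt c` is minimal. -/
def lowerFace {d : ℕ} (c : Fin d → ℝ) (Q : Set ((Fin d → ℝ) × ℝ)) : Set ((Fin d → ℝ) × ℝ) :=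
  {q | q ∈ Q ∧ ∀ q' ∈ Q, tilt c q ≤ tilt c q'}

theorem lowerFace_zero {d : ℕ} (c : Fin d → ℝ) :
    lowerFace c (0 : Set ((Fin d → ℝ) × ℝ)) = 0 := by
  ext q
  simp only [lowerFace, Set.mem_zero, Set.mem_ofPred_eq]
  constructor
  · exact fun h => h.1
  · rintro rfl
    exact ⟨rfl, fun q' hq' => by rw [hq']⟩

theorem lowerFace_add {d : ℕ} (c : Fin d → ℝ) (A B : Set ((Fin d → ℝ) × ℝ)) :
    lowerFace c (A + B) = lowerFace c A + lowerFace c B := by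
  ext q
  constructor
  · rintro ⟨⟨a, ha, b, hb, rfl⟩, hmin⟩
    refine ⟨a, ⟨ha, fun a' ha' => ?_⟩, b, ⟨hb, fun b' hb' => ?_⟩, rfl⟩
    · simpa using hmin _ (Set.add_mem_add ha' hb)
    · simpa using hmin _ (Set.add_mem_add ha hb')
  · rintro ⟨a, ⟨ha, ha'⟩, b, ⟨hb, hb'⟩, rfl⟩
    refine ⟨Set.add_mem_add ha hb, ?_⟩
    rintro _ ⟨a', h1, b', h2, rfl⟩
    simpa using add_le_add (ha' a' h1) (hb' b' h2)

theorem lowerFace_sum {d : ℕ} {ι : Type*} (c : Fin d → ℝ) (K : Finset ι)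
    (Q : ι → Set ((Fin d → ℝ) × ℝ)) :
    lowerFace c (∑ i ∈ K, Q i) = ∑ i ∈ K, lowerFace c (Q i) := by
  induction K using Finset.induction_on with
  | empty => simpa using lowerFace_zero c
  | insert a s ha ih => rw [Finset.sum_insert ha, Finset.sum_insert ha, lowerFace_add, ih]

/-- The lower face of a convex hull is spanned by the generators it contains. -/
theorem lowerFace_convexHull_subset {d : ℕ} (c : Fin d → ℝ) (X : Finset ((Fin d → ℝ) × ℝ)) :
    lowerFace c (convexHull ℝ (X : Set ((Fin d → ℝ) × ℝ))) ⊆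
      convexHull ℝ (lowerFace c (X : Set ((Fin d → ℝ) × ℝ))) := by
  rintro q ⟨hq, hmin⟩
  have hqX : ∀ x ∈ X, tilt c q ≤ tilt c x := fun x hx => hmin x (subset_convexHull ℝ _ hx)
  obtain ⟨w, hw0, hw1, hwq⟩ := Finset.mem_convexHull'.1 hq
  have hz : ∑ x ∈ X, w x * (tilt c x - tilt c q) = 0 := by
    have h1 : tilt c q = ∑ x ∈ X, w x * tilt c x := by
      conv_lhs => rw [← hwq]
      simp
    simp only [mul_sub, Finset.sum_sub_distrib, ← Finset.sum_mul, hw1, one_mul]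
    rw [← h1, sub_self]
  have hz' := (Finset.sum_eq_zero_iff_of_nonneg fun x hx =>
    mul_nonneg (hw0 x hx) (sub_nonneg.2 (hqX x hx))).1 hz
  have hne : ∀ x ∈ X, w x ≠ 0 → x ∈ lowerFace c (X : Set ((Fin d → ℝ) × ℝ)) := by
    intro x hx hwx
    have h2 : tilt c x = tilt c q := sub_eq_zero.1 ((mul_eq_zero.1 (hz' x hx)).resolve_left hwx)
    exact ⟨hx, fun y hy => h2.trans_le (hqX y hy)⟩
  rw [← hwq, ← Finset.sum_filter_of_ne (p := fun x => w x ≠ 0)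
    (fun x _ h => fun h' => h (by rw [h', zero_smul]))]
  refine (convex_convexHull ℝ _).sum_mem (fun x hx => hw0 x (Finset.mem_filter.1 hx).1) ?_
    fun x hx => subset_convexHull ℝ _ (hne x (Finset.mem_filter.1 hx).1 (Finset.mem_filter.1 hx).2)
  rw [Finset.sum_filter_ne_zero, hw1]

/-- Minimising `‖z - x‖² / 2 + s` over `(x, s) ∈ Q` produces a lower face of `Q`. -/
theorem exists_mem_lowerFace {d : ℕ} {Q : Set ((Fin d → ℝ) × ℝ)} (hQ : IsCompact Q)
    (hconv : Convex ℝ Q) (hne : Q.Nonempty) (z : Fin d → ℝ) :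
    ∃ c, z - c ∈ Prod.fst '' lowerFace c Q := by
  obtain ⟨q, hq, hmin⟩ := hQ.exists_isMinOn hne
    (f := fun q : (Fin d → ℝ) × ℝ => ((z - q.1) ⬝ᵥ (z - q.1)) / 2 + q.2)
    (by unfold dotProduct; fun_prop)
  refine ⟨z - q.1, q, ⟨hq, fun q' hq' => ?_⟩, by simp⟩
  set c := z - q.1 with hc
  set w := q' - q with hw
  have hq'w : q' = q + w := by simp [hw]
  have key : ∀ r : ℝ, 0 < r → r ≤ 1 → 0 ≤ tilt c w + r * ((w.1 ⬝ᵥ w.1) / 2) := by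
    intro r hr hr1
    have h1 : q + r • w ∈ Q := hconv.add_smul_sub_mem hq hq' ⟨hr.le, hr1⟩
    have h2 := hmin h1
    have h3 : z - (q + r • w).1 = c - r • w.1 := by simp [hc]; abel
    simp only [Set.mem_ofPred_eq, h3, ← hc] at h2
    simp only [sub_dotProduct, dotProduct_sub, smul_dotProduct, dotProduct_smul, smul_eq_mul,
      Prod.snd_add, Prod.smul_snd, dotProduct_comm w.1 c] at h2
    rw [tilt_apply]
    by_contra! hneg
    nlinarith [mul_neg_of_pos_of_neg hr hneg]
  have hB : 0 ≤ w.1 ⬝ᵥ w.1 := Finset.sum_nonneg fun i _ => mul_self_nonneg _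
  rw [hq'w, map_add, le_add_iff_nonneg_right]
  refine ge_of_tendsto (x := nhdsWithin (0 : ℝ) (Set.Ioi 0)) (f := fun r => tilt c w + r * ((w.1 ⬝ᵥ w.1) / 2)) ?_ ?_
  · have : ContinuousAt (fun r : ℝ => tilt c w + r * ((w.1 ⬝ᵥ w.1) / 2)) 0 := by fun_prop
    simpa using this.tendsto.mono_left nhdsWithin_le_nhds
  · filter_upwards [Ioc_mem_nhdsGT one_pos] with r hr using key r hr.1 hr.2

theorem eq_of_mem_lowerFace {d : ℕ} {Q : Set ((Fin d → ℝ) × ℝ)} {z c c' : Fin d → ℝ}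
    (h : z - c ∈ Prod.fst '' lowerFace c Q) (h' : z - c' ∈ Prod.fst '' lowerFace c' Q) :
    c = c' := by
  obtain ⟨q, ⟨hq, hmin⟩, hqz⟩ := h
  obtain ⟨q', ⟨hq', hmin'⟩, hqz'⟩ := h'
  have h1 := hmin q' hq'
  have h2 := hmin' q hq
  rw [tilt_apply, tilt_apply, hqz, hqz'] at h1 h2
  have h3 : (c - c') ⬝ᵥ (c - c') ≤ 0 := by
    simp only [sub_dotProduct, dotProduct_sub] at h1 h2 ⊢
    linarith
  have h4 := le_antisymm h3 (Finset.sum_nonneg fun i _ => mul_self_nonneg _)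
  exact sub_eq_zero.1 (dotProduct_self_eq_zero.1 h4)

theorem dotProduct_self_le_of_mem_lowerFace {d : ℕ} {Q : Set ((Fin d → ℝ) × ℝ)} {δ : ℝ}
    (hδ : ∀ q ∈ Q, |q.2| ≤ δ) {z c : Fin d → ℝ} (hz : z ∈ Prod.fst '' Q)
    (h : z - c ∈ Prod.fst '' lowerFace c Q) : c ⬝ᵥ c ≤ 2 * δ := by
  obtain ⟨q, ⟨hq, hmin⟩, hqz⟩ := h
  obtain ⟨q', hq', rfl⟩ := hz
  have h1 := hmin q' hq'
  rw [tilt_apply, tilt_apply, hqz, dotProduct_sub] at h1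
  have := abs_le.1 (hδ q hq)
  have := abs_le.1 (hδ q' hq')
  linarith

/-- The polytope in `ℝ^d × ℝ` spanned by the points of `V` lifted to the heights `h`. -/
def liftedPolytope {d : ℕ} (V : Finset (Fin d → ℤ)) (h : (Fin d → ℤ) → ℝ) :
    Set ((Fin d → ℝ) × ℝ) :=
  convexHull ℝ ((fun v => (intVec v, h v)) '' (V : Set (Fin d → ℤ)))

theorem isCompact_liftedPolytope {d : ℕ} (V : Finset (Fin d → ℤ)) (h : (Fin d → ℤ) → ℝ) :
    IsCompact (liftedPolytope V h) :=
  (V.finite_toSet.image _).isCompact_convexHull ℝ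

theorem liftedPolytope_nonempty {d : ℕ} {V : Finset (Fin d → ℤ)} (hV : V.Nonempty)
    (h : (Fin d → ℤ) → ℝ) : (liftedPolytope V h).Nonempty :=
  ((Finset.coe_nonempty.2 hV).image _).convexHull

theorem fst_image_liftedPolytope {d : ℕ} (V : Finset (Fin d → ℤ)) (h : (Fin d → ℤ) → ℝ) :
    Prod.fst '' liftedPolytope V h = convexHull ℝ (intVec '' (V : Set (Fin d → ℤ))) := by
  have := LinearMap.image_convexHull (LinearMap.fst ℝ (Fin d → ℝ) ℝ)
    ((fun v => (intVec v, h v)) '' (V : Set (Fin d → ℤ)))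
  rw [LinearMap.coe_fst, Set.image_image] at this
  exact this

theorem abs_snd_le_of_mem_liftedPolytope {d : ℕ} {V : Finset (Fin d → ℤ)}
    {h : (Fin d → ℤ) → ℝ} {δ : ℝ} (hδ : ∀ v ∈ V, |h v| ≤ δ) :
    ∀ q ∈ liftedPolytope V h, |q.2| ≤ δ := by
  have hconv : Convex ℝ {q : (Fin d → ℝ) × ℝ | |q.2| ≤ δ} := by
    have : {q : (Fin d → ℝ) × ℝ | |q.2| ≤ δ} =
        LinearMap.snd ℝ (Fin d → ℝ) ℝ ⁻¹' Set.Icc (-δ) δ := by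
      ext q; simp [abs_le]
    rw [this]
    exact (convex_Icc _ _).linear_preimage _
  refine fun q hq => convexHull_min ?_ hconv hq
  rintro _ ⟨v, hv, rfl⟩
  exact hδ v hv

/-- The points of `V` whose lifts lie on the lower face in direction `c`. -/
def lowerVertices {d : ℕ} (V : Finset (Fin d → ℤ)) (h : (Fin d → ℤ) → ℝ) (c : Fin d → ℝ) :
    Set (Fin d → ℤ) :=
  {v | v ∈ V ∧ ∀ w ∈ V, h v - c ⬝ᵥ intVec v ≤ h w - c ⬝ᵥ intVec w}

theorem lowerVertices_nonempty {d : ℕ} {V : Finset (Fin d → ℤ)} (hV : V.Nonempty)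
    (h : (Fin d → ℤ) → ℝ) (c : Fin d → ℝ) : (lowerVertices V h c).Nonempty :=
  V.exists_min_image (fun v => h v - c ⬝ᵥ intVec v) hV

theorem lowerFace_liftedPolytope_subset {d : ℕ} (V : Finset (Fin d → ℤ)) (h : (Fin d → ℤ) → ℝ)
    (c : Fin d → ℝ) : lowerFace c (liftedPolytope V h) ⊆
      convexHull ℝ ((fun v => (intVec v, h v)) '' lowerVertices V h c) := by
  have h1 := lowerFace_convexHull_subset c (V.image fun v => (intVec v, h v))
  rw [Finset.coe_image] at h1
  refine h1.trans (convexHull_mono ?_)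
  rintro _ ⟨⟨v, hv, rfl⟩, hmin⟩
  exact ⟨v, ⟨hv, fun w hw => hmin _ ⟨w, hw, rfl⟩⟩, rfl⟩

theorem lowerFace_liftedPolytope_eq_singleton {d : ℕ} {V : Finset (Fin d → ℤ)}
    {h : (Fin d → ℤ) → ℝ} {c : Fin d → ℝ} {v : Fin d → ℤ} (hv : lowerVertices V h c = {v}) :
    lowerFace c (liftedPolytope V h) = {(intVec v, h v)} := by
  have hsub := lowerFace_liftedPolytope_subset V h c
  rw [hv, Set.image_singleton, convexHull_singleton] at hsub
  refine (Set.subset_singleton_iff_eq.1 hsub).resolve_left (Set.Nonempty.ne_empty ?_)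
  have hvV : v ∈ V := (hv.ge rfl : v ∈ lowerVertices V h c).1
  obtain ⟨q, hq, hmin⟩ := (isCompact_liftedPolytope V h).exists_isMinOn
    (liftedPolytope_nonempty ⟨v, hvV⟩ h) (f := tilt c)
    (LinearMap.continuous_of_finiteDimensional _).continuousOn
  exact ⟨q, hq, fun x hx => hmin hx⟩

/-- The lattice points `z` such that `z - c` lies in the cell dual to `c` of the mixed subdivision
of `∑ i ∈ K, conv (V i)` induced by the heights `h`. -/
def cellPoints {d k : ℕ} (V : Fin k → Finset (Fin d → ℤ)) (h : Fin k → (Fin d → ℤ) → ℝ)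
    (K : Finset (Fin k)) (c : Fin d → ℝ) : Set (Fin d → ℤ) :=
  {z | intVec z - c ∈ Prod.fst '' lowerFace c (∑ i ∈ K, liftedPolytope (V i) (h i))}

theorem intVec_add {d : ℕ} (z w : Fin d → ℤ) : intVec (z + w) = intVec z + intVec w := by
  ext a; simp [intVec]

theorem ncard_cellPoints_insert {d k : ℕ} {V : Fin k → Finset (Fin d → ℤ)}
    {h : Fin k → (Fin d → ℤ) → ℝ} {K : Finset (Fin k)} {c : Fin d → ℝ} {i : Fin k} (hi : i ∉ K)
    {v : Fin d → ℤ} (hv : lowerVertices (V i) (h i) c = {v}) :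
    (cellPoints V h (insert i K) c).ncard = (cellPoints V h K c).ncard := by
  have : cellPoints V h (insert i K) c = (fun z => v + z) '' cellPoints V h K c := by
    ext z
    rw [cellPoints, Finset.sum_insert hi, lowerFace_add, lowerFace_liftedPolytope_eq_singleton hv,
      Set.singleton_add]
    constructor
    · rintro ⟨_, ⟨q, hq, rfl⟩, hqz⟩
      refine ⟨-v + z, ⟨q, hq, ?_⟩, by simp⟩
      have h2 : intVec z = intVec v + intVec (-v + z) := by
        rw [← intVec_add]; simp
      rw [h2] at hqz
      simp only [Prod.fst_add] at hqz
      rw [add_sub_assoc] at hqz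
      exact add_left_cancel hqz
    · rintro ⟨w, ⟨q, hq, hqw⟩, rfl⟩
      refine ⟨_, ⟨q, hq, rfl⟩, ?_⟩
      simp [hqw, intVec_add, add_sub_assoc]
  rw [this, Set.ncard_image_of_injective _ (add_right_injective v)]

/-- A cell dual to `c` omitting some `V j` contains no lattice point once all the faces selected by
`c` are positive-dimensional and the heights of `V j` are generic. -/
theorem cellPoints_eq_empty {d k : ℕ} {V : Fin k → Finset (Fin d → ℤ)}
    {h : Fin k → (Fin d → ℤ) → ℝ} {K : Finset (Fin k)} {c : Fin d → ℝ}
    (hc : ∀ i, (lowerVertices (V i) (h i) c).Nontrivial) {j : Fin k} (hj : j ∉ K)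
    {f : ℝ →ₗ[ℚ] ℚ} (hf1 : f 1 = 0) (hf0 : ∀ i, i ≠ j → ∀ v, f (h i v) = 0)
    (hfj : Function.Injective fun v => f (h j v)) :
    cellPoints V h K c = ∅ := by
  rw [Set.eq_empty_iff_forall_notMem]
  rintro z ⟨q, hq, hqz⟩
  rw [lowerFace_sum, Set.mem_finsetSum] at hq
  obtain ⟨g, hg, rfl⟩ := hq
  set b : Fin d → ℚ := fun a => f (c a) with hb
  have hf_rat (r : ℚ) : f (r : ℝ) = 0 := by
    have : (r : ℝ) = r • (1 : ℝ) := by simp [Rat.smul_def]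
    rw [this, map_smul, hf1, smul_zero]
  have hfc (v : Fin d → ℤ) : f (c ⬝ᵥ intVec v) = ∑ a, b a * v a := by
    rw [dotProduct, map_sum]
    refine Finset.sum_congr rfl fun a _ => ?_
    have : c a * intVec v a = (v a : ℚ) • c a := by
      rw [Rat.smul_def, mul_comm]; simp [intVec]
    rw [this, map_smul, smul_eq_mul, mul_comm]
  have hheight {i : Fin k} {v w : Fin d → ℤ} (hv : v ∈ lowerVertices (V i) (h i) c)
      (hw : w ∈ lowerVertices (V i) (h i) c) :
      f (h i v) - ∑ a, b a * v a = f (h i w) - ∑ a, b a * w a := by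
    rw [← hfc, ← hfc, ← map_sub, ← map_sub, le_antisymm (hv.2 w hw.1) (hw.2 v hv.1)]
  choose u hu using fun i => (hc i).nonempty
  set bR : Fin d → ℝ := fun a => (b a : ℝ) with hbR
  have hface (i : Fin k) (hi : i ∈ K) : bR ⬝ᵥ (g i).1 = ((∑ a, b a * u i a : ℚ) : ℝ) := by
    have hconv : Convex ℝ {q : (Fin d → ℝ) × ℝ | bR ⬝ᵥ q.1 = ((∑ a, b a * u i a : ℚ) : ℝ)} := by
      refine convex_hyperplane ⟨fun x y => ?_, fun r x => ?_⟩ _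
      · simp [dotProduct_add]
      · simp [dotProduct_smul]
    refine convexHull_min ?_ hconv (lowerFace_liftedPolytope_subset _ _ _ (hg hi))
    rintro _ ⟨v, hv, rfl⟩
    have hij : i ≠ j := fun e => hj (e ▸ hi)
    have h1 := hheight hv (hu i)
    rw [hf0 i hij, hf0 i hij, sub_right_inj] at h1
    simp only [Set.mem_ofPred_eq, ← h1]
    simp [dotProduct, hbR, intVec]
  have hbc : bR ⬝ᵥ c = ((∑ a, b a * z a - ∑ i ∈ K, ∑ a, b a * u i a : ℚ) : ℝ) := by
    have h1 : bR ⬝ᵥ (intVec z - c) = ∑ i ∈ K, ((∑ a, b a * u i a : ℚ) : ℝ) := by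
      rw [← hqz, Prod.fst_sum, dotProduct_sum]
      exact Finset.sum_congr rfl hface
    have h2 : bR ⬝ᵥ intVec z = ((∑ a, b a * z a : ℚ) : ℝ) := by
      simp [dotProduct, hbR, intVec]
    rw [dotProduct_sub, h2] at h1
    rw [Rat.cast_sub, Rat.cast_sum (s := K)]
    linarith
  have hb0 : ∑ a, b a * b a = 0 := by
    rw [← hf_rat (∑ a, b a * z a - ∑ i ∈ K, ∑ a, b a * u i a), ← hbc, dotProduct, map_sum]
    refine Finset.sum_congr rfl fun a _ => ?_
    have : bR a * c a = b a • c a := by rw [Rat.smul_def]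
    rw [this, map_smul, smul_eq_mul]
  have hb0' (a : Fin d) : b a = 0 := by
    have := (Finset.sum_eq_zero_iff_of_nonneg fun a _ => mul_self_nonneg (b a)).1 hb0 a
      (Finset.mem_univ a)
    exact mul_self_eq_zero.1 this
  obtain ⟨v, hv, w, hw, hvw⟩ := hc j
  have h1 := hheight hv hw
  simp only [hb0', zero_mul, Finset.sum_const_zero, sub_zero] at h1
  exact hvw (hfj h1)

/-- The contribution of a single cell to the discrete mixed volume is non-negative. -/
theorem sum_ncard_cellPoints_nonneg {d k : ℕ} {V : Fin k → Finset (Fin d → ℤ)}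
    (hV : ∀ i, (V i).Nonempty) {h : Fin k → (Fin d → ℤ) → ℝ}
    (hgen : ∀ j, ∃ f : ℝ →ₗ[ℚ] ℚ, f 1 = 0 ∧ (∀ i, i ≠ j → ∀ v, f (h i v) = 0) ∧
      Function.Injective fun v => f (h j v)) (c : Fin d → ℝ) :
    0 ≤ ∑ J : Finset (Fin k), (-1 : ℤ) ^ (k - J.card) * ((cellPoints V h J c).ncard : ℤ) := by
  by_cases hc : ∀ i, (lowerVertices (V i) (h i) c).Nontrivial
  · refine Finset.sum_nonneg fun J _ => ?_
    by_cases hJ : J = Finset.univ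
    · simp [hJ]
    · obtain ⟨j, hj⟩ : ∃ j, j ∉ J := by
        simpa [Finset.eq_univ_iff_forall] using hJ
      obtain ⟨f, hf1, hf0, hfj⟩ := hgen j
      simp [cellPoints_eq_empty hc hj hf1 hf0 hfj]
  · push Not at hc
    obtain ⟨i, hi⟩ := hc
    obtain ⟨v, hv⟩ : ∃ v, lowerVertices (V i) (h i) c = {v} :=
      Set.exists_eq_singleton_iff_nonempty_subsingleton.2
        ⟨lowerVertices_nonempty (hV i) _ _, hi⟩
    rw [← Finset.powerset_univ, ← Finset.insert_erase (Finset.mem_univ i),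
      Finset.sum_powerset_insert (Finset.notMem_erase i _), ← Finset.sum_add_distrib]
    refine (Finset.sum_eq_zero fun J hJ => ?_).ge
    have hiJ : i ∉ J := fun h' => Finset.notMem_erase i _ (Finset.mem_powerset.1 hJ h')
    have hcard : J.card < k := by
      simpa using Finset.card_lt_univ_of_notMem hiJ
    rw [ncard_cellPoints_insert hiJ hv, Finset.card_insert_of_notMem hiJ,
      show k - J.card = (k - (J.card + 1)) + 1 by omega, pow_succ]
    ring

theorem finite_latticePoints {d : ℕ} {P : Set (Fin d → ℝ)} (hP : IsCompact P) :
    {z : Fin d → ℤ | intVec z ∈ P}.Finite := by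
  obtain ⟨r, hr⟩ := hP.isBounded.exists_norm_le
  refine (Set.finite_Icc (fun _ : Fin d => -⌈r⌉) fun _ => ⌈r⌉).subset fun z hz => ?_
  have h1 (a : Fin d) : |(z a : ℝ)| ≤ ⌈r⌉ :=
    ((norm_le_pi_norm (intVec z) a).trans (hr _ hz)).trans (Int.le_ceil r)
  have h2 (a : Fin d) : |z a| ≤ ⌈r⌉ := by exact_mod_cast h1 a
  exact ⟨fun a => (abs_le.1 (h2 a)).1, fun a => (abs_le.1 (h2 a)).2⟩

/-- Lattice points close enough to a compact set belong to it. -/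
theorem exists_pos_forall_intVec_mem {d : ℕ} {P : Set (Fin d → ℝ)} (hP : IsCompact P) :
    ∃ ε > 0, ∀ (z : Fin d → ℤ) (c : Fin d → ℝ), ‖c‖ < ε → intVec z - c ∈ P → intVec z ∈ P := by
  set L : Set (Fin d → ℝ) := Set.range intVec \ P with hL
  have hclosed : IsClosed L := by
    refine Metric.isClosed_of_pairwise_le_dist one_pos ?_
    rintro _ ⟨⟨z, rfl⟩, -⟩ _ ⟨⟨w, rfl⟩, -⟩ hne
    obtain ⟨a, ha⟩ : ∃ a, z a ≠ w a := by
      by_contra! h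
      exact hne (by rw [funext h])
    refine le_trans ?_ (dist_le_pi_dist (intVec z) (intVec w) a)
    have : (1 : ℤ) ≤ |z a - w a| := Int.one_le_abs (sub_ne_zero.2 ha)
    rw [Real.dist_eq]
    simp only [intVec]
    exact_mod_cast this
  obtain ⟨ε, hε, hdisj⟩ := Disjoint.exists_thickenings Set.disjoint_sdiff_right hP hclosed
  refine ⟨ε, hε, fun z c hc hzc => by_contra fun hz => ?_⟩
  refine Set.disjoint_left.1 hdisj (Metric.self_subset_thickening hε _ hzc)
    (Metric.mem_thickening_iff.2 ⟨intVec z, ⟨⟨z, rfl⟩, hz⟩, ?_⟩)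
  simpa [dist_eq_norm] using hc

theorem dmv_convexHull_nonneg {d k : ℕ} {V : Fin k → Finset (Fin d → ℤ)}
    (hV : ∀ i, (V i).Nonempty) :
    0 ≤ DMV fun i => convexHull ℝ (intVec '' (V i : Set (Fin d → ℤ))) := by
  have hcomp (K : Finset (Fin k)) :
      IsCompact (∑ i ∈ K, convexHull ℝ (intVec '' (V i : Set (Fin d → ℤ)))) :=
    Finset.sum_induction _ IsCompact (fun _ _ => IsCompact.add) isCompact_singleton
      fun i _ => ((V i).finite_toSet.image _).isCompact_convexHull ℝ
  choose ε' hε' hε'P using fun K => exists_pos_forall_intVec_mem (hcomp K)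
  obtain ⟨ε, hε, hεle⟩ : ∃ ε > 0, ∀ K, ε ≤ ε' K := by
    obtain ⟨K, -, hK⟩ := Finset.exists_min_image Finset.univ ε' Finset.univ_nonempty
    exact ⟨ε' K, hε' K, fun K' => hK K' (Finset.mem_univ _)⟩
  set δ : ℝ := ε ^ 2 / (4 * (k + 1)) with hδ
  obtain ⟨h, hsmall, hgen⟩ := exists_generic_heights V (δ := δ) (by positivity)
  set Q : Finset (Fin k) → Set ((Fin d → ℝ) × ℝ) :=
    fun K => ∑ i ∈ K, liftedPolytope (V i) (h i) with hQ
  have hQfst (K : Finset (Fin k)) : Prod.fst '' Q K =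
      ∑ i ∈ K, convexHull ℝ (intVec '' (V i : Set (Fin d → ℤ))) :=
    (Set.image_finsetSum (LinearMap.fst ℝ (Fin d → ℝ) ℝ) K _).trans
      (Finset.sum_congr rfl fun i _ => fst_image_liftedPolytope _ _)
  have hQsnd (K : Finset (Fin k)) : ∀ q ∈ Q K, |q.2| ≤ k * δ := by
    intro q hq
    obtain ⟨g, hg, rfl⟩ := (Set.mem_finsetSum _ _ _).1 hq
    rw [Prod.snd_sum]
    calc |∑ i ∈ K, (g i).2| ≤ ∑ i ∈ K, |(g i).2| := Finset.abs_sum_le_sum_abs _ _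
      _ ≤ ∑ i ∈ K, δ := Finset.sum_le_sum fun i hi =>
        abs_snd_le_of_mem_liftedPolytope (hsmall i) _ (hg hi)
      _ ≤ k * δ := by
        rw [Finset.sum_const, nsmul_eq_mul]
        have : (K.card : ℝ) ≤ k := by
          exact_mod_cast (Finset.card_le_univ K).trans_eq (Fintype.card_fin k)
        gcongr
  have hQcomp (K : Finset (Fin k)) : IsCompact (Q K) :=
    Finset.sum_induction _ IsCompact (fun _ _ => IsCompact.add) isCompact_singleton
      fun i _ => isCompact_liftedPolytope _ _
  have hQne (K : Finset (Fin k)) : (Q K).Nonempty :=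
    Finset.sum_induction _ Set.Nonempty (fun _ _ => Set.Nonempty.add) (Set.singleton_nonempty _)
      fun i _ => liftedPolytope_nonempty (hV i) _
  choose γ hγ using fun K (z : Fin d → ℤ) => exists_mem_lowerFace (hQcomp K)
    (convex_sum _ fun i _ => convex_convexHull ℝ _) (hQne K) (intVec z)
  have hγ_norm (K : Finset (Fin k)) (z : Fin d → ℤ) : intVec z ∈
      ∑ i ∈ K, convexHull ℝ (intVec '' (V i : Set (Fin d → ℤ))) ↔ ‖γ K z‖ < ε := by
    constructor
    · intro hz
      rw [← hQfst] at hz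
      have h1 := dotProduct_self_le_of_mem_lowerFace (hQsnd K) hz (hγ K z)
      rw [pi_norm_lt_iff hε]
      intro a
      have h2 : γ K z a * γ K z a ≤ γ K z ⬝ᵥ γ K z :=
        Finset.single_le_sum (f := fun a => γ K z a * γ K z a)
          (fun a _ => mul_self_nonneg _) (Finset.mem_univ a)
      have h3 : 2 * (k * δ) < ε ^ 2 := by
        have : 2 * (k * δ) = ε ^ 2 * (k / (2 * (k + 1))) := by rw [hδ]; field_simp; ring
        rw [this]
        refine mul_lt_of_lt_one_right (by positivity) ?_
        rw [div_lt_one (by positivity)]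
        have : (0 : ℝ) ≤ k := by positivity
        linarith
      rw [Real.norm_eq_abs]
      exact abs_lt_of_sq_lt_sq (by nlinarith) hε.le
    · intro hz
      refine hε'P K z (γ K z) (hz.trans_le (hεle K)) ?_
      rw [← hQfst]
      exact Set.image_mono (fun q hq => hq.1) (hγ K z)
  set L : Finset (Fin k) → Finset (Fin d → ℤ) :=
    fun K => (finite_latticePoints (hcomp K)).toFinset with hL
  have hmemL {K : Finset (Fin k)} {z : Fin d → ℤ} : z ∈ L K ↔ ‖γ K z‖ < ε := by
    rw [← hγ_norm, hL]
    simp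
  set C : Finset (Fin d → ℝ) := Finset.univ.biUnion fun K => (L K).image (γ K) with hC
  have hcount (K : Finset (Fin k)) :
      latticePointCount (∑ i ∈ K, convexHull ℝ (intVec '' (V i : Set (Fin d → ℤ)))) =
        ∑ c ∈ C, (cellPoints V h K c).ncard := by
    have h1 : latticePointCount (∑ i ∈ K, convexHull ℝ (intVec '' (V i : Set (Fin d → ℤ)))) =
        (L K).card := Set.ncard_eq_toFinset_card _ (finite_latticePoints (hcomp K))
    rw [h1, Finset.card_eq_sum_card_fiberwise (f := γ K) (t := C)]
    · refine Finset.sum_congr rfl fun c hc => ?_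
      rw [← Set.ncard_coe_finset]
      congr 1
      ext z
      simp only [Finset.coe_filter, Set.mem_ofPred_eq]
      constructor
      · rintro ⟨-, rfl⟩
        exact hγ K z
      · intro hz
        have h2 : γ K z = c := eq_of_mem_lowerFace (hγ K z) hz
        refine ⟨hmemL.2 ?_, h2⟩
        obtain ⟨K', -, h3⟩ := Finset.mem_biUnion.1 hc
        obtain ⟨w, hw, rfl⟩ := Finset.mem_image.1 h3
        rw [h2]
        exact hmemL.1 hw
    · intro z hz
      exact Finset.mem_biUnion.2 ⟨K, Finset.mem_univ K, Finset.mem_image_of_mem _ hz⟩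
  simp only [DMV, hcount, Nat.cast_sum, Finset.mul_sum]
  rw [Finset.sum_comm]
  exact Finset.sum_nonneg fun c _ => sum_ncard_cellPoints_nonneg hV hgen c

theorem dmv_nonneg_of_isLatticePolytope {d k : ℕ} {P : Fin k → Set (Fin d → ℝ)}
    (hP : ∀ i, IsLatticePolytope (P i)) : 0 ≤ DMV P := by
  choose V hV hPV using hP
  rw [funext hPV]
  exact dmv_convexHull_nonneg hV

theorem IsLatticePolytope.nsmul {d : ℕ} {P : Set (Fin d → ℝ)} (hP : IsLatticePolytope P) (n : ℕ) :
    IsLatticePolytope ((n : ℝ) • P) := by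
  obtain ⟨V, hV, rfl⟩ := hP
  refine ⟨V.image fun v => n • v, hV.image _, ?_⟩
  rw [← convexHull_smul, Finset.coe_image, Set.image_image, ← Set.image_smul, Set.image_image]
  congr 1
  refine Set.image_congr fun v _ => ?_
  ext a
  simp

/-- **Bihan's non-negativity theorem.** For lattice polytopes `P_1, …, P_k ⊆ ℝ^d`, the
discrete mixed volume is non-negative; consequently the mixed Ehrhart polynomial
`ME_{P_1,…,P_k}(n) = DMV(nP_1, …, nP_k)` is non-negative for every integer `n ≥ 0`. -/
theorem dmv_nonneg
    {d k : ℕ} (P : Fin k → Set (Fin d → ℝ))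
    (hP : ∀ i, IsLatticePolytope (P i)) :
    0 ≤ DMV P ∧ ∀ n : ℕ, 0 ≤ DMV (fun i => (n : ℝ) • P i) :=
  ⟨dmv_nonneg_of_isLatticePolytope hP,
    fun n => dmv_nonneg_of_isLatticePolytope fun i => (hP i).nsmul n⟩
end

section
/- Let P_1 and P_2 be lattice polytopes in ℝ^d. Then for every integer n ≥ 0, |n(P_1 + P_2) ∩ ℤ^d| ≥ |nP_1 ∩ ℤ^d| + |nP_2 ∩ ℤ^d| − 1; equivalently, ME_{P_1,P_2}(n) ≥ 0 for all integers n ≥ 0. -/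
open Pointwise MeasureTheory Filter
open scoped Classical

/-- A bounded subset of `ℝ^d` contains finitely many lattice points. -/
theorem finite_lattice_points_of_isBounded {d : ℕ} {P : Set (Fin d → ℝ)}
    (hP : Bornology.IsBounded P) : {z : Fin d → ℤ | (fun i => (z i : ℝ)) ∈ P}.Finite := by
  obtain ⟨R, hR⟩ := hP.exists_norm_le
  refine (Set.finite_Icc (fun _ : Fin d => -⌈R⌉) (fun _ => ⌈R⌉)).subset fun z hz => ?_
  have h : ∀ i, |(z i : ℝ)| ≤ ⌈R⌉ := fun i =>
    ((norm_le_pi_norm (fun i => (z i : ℝ)) i).trans (hR _ hz)).trans (Int.le_ceil R)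
  have h' : ∀ i, |z i| ≤ ⌈R⌉ := fun i => by exact_mod_cast h i
  exact ⟨fun i => (abs_le.1 (h' i)).1, fun i => (abs_le.1 (h' i)).2⟩

theorem IsLatticePolytope.isBounded {d : ℕ} {P : Set (Fin d → ℝ)} (hP : IsLatticePolytope P) :
    Bornology.IsBounded P := by
  obtain ⟨V, -, rfl⟩ := hP
  exact isBounded_convexHull.2 (V.finite_toSet.image _).isBounded

theorem IsLatticePolytope.exists_lattice_point_mem_smul {d : ℕ} {P : Set (Fin d → ℝ)}
    (hP : IsLatticePolytope P) (n : ℕ) :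
    {z : Fin d → ℤ | (fun i => (z i : ℝ)) ∈ (n : ℝ) • P}.Nonempty := by
  obtain ⟨V, ⟨v, hv⟩, rfl⟩ := hP
  refine ⟨n • v, _, subset_convexHull ℝ _ ⟨v, hv, rfl⟩, ?_⟩
  ext i
  simp

/-- The number of lattice points is superadditive, up to one, under Minkowski sums of bounded
sets containing lattice points. -/
theorem latticePointCount_add_le {d : ℕ} {P Q : Set (Fin d → ℝ)}
    (hP : Bornology.IsBounded P) (hQ : Bornology.IsBounded Q)
    (hP' : {z : Fin d → ℤ | (fun i => (z i : ℝ)) ∈ P}.Nonempty)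
    (hQ' : {z : Fin d → ℤ | (fun i => (z i : ℝ)) ∈ Q}.Nonempty) :
    latticePointCount P + latticePointCount Q ≤ latticePointCount (P + Q) + 1 := by
  have hA := finite_lattice_points_of_isBounded hP
  have hB := finite_lattice_points_of_isBounded hQ
  have hC := finite_lattice_points_of_isBounded (hP.add hQ)
  unfold latticePointCount
  rw [Set.ncard_eq_toFinset_card _ hA, Set.ncard_eq_toFinset_card _ hB,
    Set.ncard_eq_toFinset_card _ hC]
  have key := cauchy_davenport_of_isAddTorsionFree
    (hA.toFinset_nonempty.2 hP') (hB.toFinset_nonempty.2 hQ')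
  have hsub : hA.toFinset + hB.toFinset ⊆ hC.toFinset := by
    intro z hz
    obtain ⟨a, ha, b, hb, rfl⟩ := Finset.mem_add.1 hz
    rw [Set.Finite.mem_toFinset] at ha hb ⊢
    refine ⟨_, ha, _, hb, ?_⟩
    ext i
    simp
  have := Finset.card_le_card hsub
  omega

/-- **Non-negativity of the mixed Ehrhart polynomial of two polytopes.**
For lattice polytopes `P_1, P_2 ⊆ ℝ^d` and every integer `n ≥ 0`,
`|n(P_1 + P_2) ∩ ℤ^d| ≥ |nP_1 ∩ ℤ^d| + |nP_2 ∩ ℤ^d| - 1`; equivalently,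
`ME_{P_1,P_2}(n) = |n(P_1+P_2) ∩ ℤ^d| - |nP_1 ∩ ℤ^d| - |nP_2 ∩ ℤ^d| + 1 ≥ 0`. -/
theorem lattice_points_of_minkowski_sum_ge
    {d : ℕ} (P₁ P₂ : Set (Fin d → ℝ))
    (hP₁ : IsLatticePolytope P₁) (hP₂ : IsLatticePolytope P₂) :
    ∀ n : ℕ,
      latticePointCount ((n : ℝ) • P₁) + latticePointCount ((n : ℝ) • P₂)
        ≤ latticePointCount ((n : ℝ) • (P₁ + P₂)) + 1 ∧
      0 ≤ (latticePointCount ((n : ℝ) • (P₁ + P₂)) : ℤ)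
            - latticePointCount ((n : ℝ) • P₁) - latticePointCount ((n : ℝ) • P₂) + 1 := by
  intro n
  have h : latticePointCount ((n : ℝ) • P₁) + latticePointCount ((n : ℝ) • P₂)
      ≤ latticePointCount ((n : ℝ) • (P₁ + P₂)) + 1 := by
    rw [smul_add]
    exact latticePointCount_add_le (hP₁.isBounded.smul₀ _) (hP₂.isBounded.smul₀ _)
      (hP₁.exists_lattice_point_mem_smul n) (hP₂.exists_lattice_point_mem_smul n)
  exact ⟨h, by omega⟩
end

section
/- Let P_1, …, P_{d−1} be d-dimensional lattice polytopes in ℝ^d (a collection of k = d − 1 polytopes). Then the mixed Ehrhart polynomial has the form ME_{P_1,…,P_{d−1}}(n) = me_d n^d + me_{d−1} n^{d−1} with me_d ≥ 0 and me_{d−1} ≥ 0; in particular, ME_{P_1,…,P_{d−1}}(n) ≥ 0 for all integers n ≥ 0. -/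
open Pointwise MeasureTheory Filter
open scoped Classical

namespace MixedEhrhart

section Triangulation

variable {ι E : Type*} [AddCommGroup E] [Module ℝ E]

/-- The vectors `v i`, `i ∈ B`, form a basis of `E`. -/
def IsBasisOn (v : ι → E) (B : Finset ι) : Prop :=
  LinearIndepOn ℝ v (B : Set ι) ∧ Submodule.span ℝ (v '' (B : Set ι)) = ⊤

theorem IsBasisOn.card_eq {v : ι → E} {B : Finset ι} (h : IsBasisOn v B) :
    B.card = Module.finrank ℝ E := by
  have hsp' : ⊤ ≤ Submodule.span ℝ (Set.range fun i : (B : Set ι) => v i) := by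
    rw [← h.2, Set.image_eq_range]
  rw [Module.finrank_eq_card_basis (Module.Basis.mk h.1 hsp')]
  simp

variable [Fintype ι]

theorem IsBasisOn.exists_coord {v : ι → E} {B : Finset ι} (h : IsBasisOn v B) :
    ∃ r : E →ₗ[ℝ] (ι → ℝ), (∀ x, ∑ i, r x i • v i = x) ∧ ∀ x, ∀ i ∉ B, r x i = 0 := by
  obtain ⟨hli, hsp⟩ := h
  have hsp' : ⊤ ≤ Submodule.span ℝ (Set.range fun i : (B : Set ι) => v i) := by
    rw [← hsp, Set.image_eq_range]
  let b := Module.Basis.mk hli hsp'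
  refine ⟨LinearMap.pi fun i => if h : i ∈ B then b.coord ⟨i, h⟩ else 0, fun x => ?_,
    fun x i hi => by simp [hi]⟩
  have h1 := b.sum_repr x
  rw [← Finset.sum_subset (Finset.subset_univ B) (fun i _ hi => by simp [hi]),
    ← Finset.sum_coe_sort]
  conv_rhs => rw [← h1]
  refine Finset.sum_congr rfl fun i _ => ?_
  have : (i : ι) ∈ B := i.2
  simp [this, b]

/-- Coordinates with respect to the basis `v i`, `i ∈ B`, extended by zero outside `B`. -/
noncomputable def coord (v : ι → E) (B : Finset ι) : E →ₗ[ℝ] (ι → ℝ) :=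
  if h : ∃ r : E →ₗ[ℝ] (ι → ℝ), (∀ x, ∑ i, r x i • v i = x) ∧ ∀ x, ∀ i ∉ B, r x i = 0 then
    h.choose else 0

theorem IsBasisOn.sum_coord {v : ι → E} {B : Finset ι} (h : IsBasisOn v B) (x : E) :
    ∑ i, coord v B x i • v i = x := by
  rw [coord, dif_pos h.exists_coord]
  exact h.exists_coord.choose_spec.1 x

theorem IsBasisOn.coord_eq_zero {v : ι → E} {B : Finset ι} (h : IsBasisOn v B) (x : E) {i : ι}
    (hi : i ∉ B) : coord v B x i = 0 := by
  rw [coord, dif_pos h.exists_coord]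
  exact h.exists_coord.choose_spec.2 x i hi

theorem IsBasisOn.coord_eq {v : ι → E} {B : Finset ι} (h : IsBasisOn v B) {x : E} {μ : ι → ℝ}
    (hμ : ∀ i ∉ B, μ i = 0) (hx : ∑ i, μ i • v i = x) : coord v B x = μ := by
  funext i
  by_cases hi : i ∈ B
  · have h0 : ∑ i ∈ B, (coord v B x i - μ i) • v i = 0 := by
      rw [Finset.sum_subset (Finset.subset_univ B)
        (fun i _ hi => by simp [hμ i hi, h.coord_eq_zero x hi])]
      simp [sub_smul, Finset.sum_sub_distrib, hx, h.sum_coord]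
    exact sub_eq_zero.1 (linearIndepOn_finset_iff.1 h.1 _ h0 i hi)
  · rw [hμ i hi, h.coord_eq_zero x hi]

theorem IsBasisOn.coord_self {v : ι → E} {B : Finset ι} (h : IsBasisOn v B) {b : ι}
    (hb : b ∈ B) : coord v B (v b) = Pi.single b 1 := by
  refine h.coord_eq (fun i hi => ?_) ?_
  · exact Pi.single_eq_of_ne (fun e : i = b => hi (e ▸ hb)) _
  · simp [Pi.single_apply]

theorem exists_isBasisOn_superset {v : ι → E} (hv : Submodule.span ℝ (Set.range v) = ⊤)
    {S : Finset ι} (hS : LinearIndepOn ℝ v (S : Set ι)) : ∃ B, S ⊆ B ∧ IsBasisOn v B := by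
  obtain ⟨b, -, h1, h2, h3⟩ := exists_linearIndepOn_extension hS (Set.subset_univ _)
  refine ⟨b.toFinite.toFinset, by simpa [← Finset.coe_subset] using h1, by simpa using h3, ?_⟩
  rw [eq_top_iff, ← hv]
  simpa [Submodule.span_le] using h2

/-- The linear functional taking the value `ω b` at `v b` for `b ∈ B`. -/
noncomputable def lift (v : ι → E) (ω : ι → ℝ) (B : Finset ι) : E →ₗ[ℝ] ℝ :=
  ∑ i, ω i • (LinearMap.proj i ∘ₗ coord v B)

theorem lift_apply (v : ι → E) (ω : ι → ℝ) (B : Finset ι) (x : E) :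
    lift v ω B x = ∑ i, ω i * coord v B x i := by
  simp [lift]

theorem IsBasisOn.lift_self {v : ι → E} {B : Finset ι} (h : IsBasisOn v B) (ω : ι → ℝ) {b : ι}
    (hb : b ∈ B) : lift v ω B (v b) = ω b := by
  simp [lift_apply, h.coord_self hb, Pi.single_apply]

/-- The maximal cells of the regular triangulation of the cone over `v` with heights `ω`. -/
def IsCell (v : ι → E) (ω : ι → ℝ) (B : Finset ι) : Prop :=
  IsBasisOn v B ∧ ∀ i ∉ B, lift v ω B (v i) < ω i

theorem IsCell.lift_le {v : ι → E} {ω : ι → ℝ} {B : Finset ι} (h : IsCell v ω B) (i : ι) :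
    lift v ω B (v i) ≤ ω i := by
  by_cases hi : i ∈ B
  · exact (h.1.lift_self ω hi).le
  · exact (h.2 i hi).le

theorem IsCell.mem_of_lift_eq {v : ι → E} {ω : ι → ℝ} {B : Finset ι} (h : IsCell v ω B) {i : ι}
    (hi : lift v ω B (v i) = ω i) : i ∈ B := by
  by_contra hB
  exact (h.2 i hB).ne hi

/-- The heights `ω` and the positive combination of the `v i` with weights `t` are generic. -/
structure IsGeneric (v : ι → E) (ω t : ι → ℝ) : Prop where
  pos : ∀ i, 0 < t i
  lift_ne : ∀ B, IsBasisOn v B → ∀ i ∉ B, lift v ω B (v i) ≠ ω i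
  coord_ne : ∀ B, IsBasisOn v B → ∀ b ∈ B, coord v B (∑ i, t i • v i) b ≠ 0

/-- A vector of positive numbers avoiding finitely many hyperplanes. -/
theorem exists_pos_forall_sum_ne_zero (F : Set (ι → ℝ)) (hfin : F.Finite) (hF : ∀ f ∈ F, f ≠ 0) :
    ∃ t : ι → ℝ, (∀ i, 0 < t i) ∧ ∀ f ∈ F, ∑ i, t i * f i ≠ 0 := by
  let e := Fintype.equivFin ι
  let p : (ι → ℝ) → Polynomial ℝ := fun f => ∑ i, Polynomial.monomial (e i : ℕ) (f i)
  have hp : ∀ f ∈ F, p f ≠ 0 := by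
    intro f hf h0
    refine hF f hf (funext fun i => ?_)
    have := congrArg (fun P => Polynomial.coeff P (e i : ℕ)) h0
    simpa [p, Polynomial.finsetSum_coeff, Polynomial.coeff_monomial, Fin.val_inj] using this
  have hprod : ∏ f ∈ hfin.toFinset, p f ≠ 0 :=
    Finset.prod_ne_zero_iff.2 fun f hf => hp f (hfin.mem_toFinset.1 hf)
  obtain ⟨τ, hτ, hroot⟩ : ∃ τ : ℝ, 0 < τ ∧ (∏ f ∈ hfin.toFinset, p f).eval τ ≠ 0 := by
    by_contra! hcon
    exact hprod (Polynomial.eq_zero_of_infinite_isRoot _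
      ((Set.Ioi_infinite (0 : ℝ)).mono fun τ hτ => hcon τ hτ))
  refine ⟨fun i => τ ^ (e i : ℕ), fun i => by positivity, fun f hf h0 => hroot ?_⟩
  rw [Polynomial.eval_prod]
  refine Finset.prod_eq_zero (hfin.mem_toFinset.2 hf) ?_
  rw [← h0]
  simp [p, Polynomial.eval_finsetSum, mul_comm]

theorem exists_isGeneric (v : ι → E) : ∃ ω t : ι → ℝ, IsGeneric v ω t := by
  let F1 : Set (ι → ℝ) := {f | ∃ z : Finset ι × ι, (IsBasisOn v z.1 ∧ z.2 ∉ z.1) ∧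
    coord v z.1 (v z.2) - Pi.single z.2 1 = f}
  let F2 : Set (ι → ℝ) := {f | ∃ z : Finset ι × ι, (IsBasisOn v z.1 ∧ z.2 ∈ z.1) ∧
    (fun i => coord v z.1 (v i) z.2) = f}
  obtain ⟨ω, -, hω⟩ := exists_pos_forall_sum_ne_zero F1 (Set.Finite.image _ (Set.toFinite _)) (by
    rintro _ ⟨⟨B, i⟩, ⟨hB, hi⟩, rfl⟩ h0
    have := congrFun h0 i
    simp [hB.coord_eq_zero _ hi] at this)
  obtain ⟨t, ht, htF⟩ := exists_pos_forall_sum_ne_zero F2 (Set.Finite.image _ (Set.toFinite _)) (by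
    rintro _ ⟨⟨B, i⟩, ⟨hB, hi⟩, rfl⟩ h0
    have := congrFun h0 i
    simp [hB.coord_self hi] at this)
  refine ⟨ω, t, ht, fun B hB i hi h => hω _ ⟨(B, i), ⟨hB, hi⟩, rfl⟩ ?_,
    fun B hB b hb h => htF _ ⟨(B, b), ⟨hB, hb⟩, rfl⟩ ?_⟩
  · rw [lift_apply] at h
    simp [mul_sub, Finset.sum_sub_distrib, h, Pi.single_apply]
  · simpa [map_sum, Finset.sum_apply] using h

/-- Carathéodory's theorem for cones, without increasing a linear objective. -/
theorem exists_linearIndepOn_support {v : ι → E} {δ : E →ₗ[ℝ] ℝ} (hδ : ∀ i, δ (v i) = 1)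
    (ω : ι → ℝ) (y : E) (ν : ι → ℝ) (hν : ∀ i, 0 ≤ ν i) (hy : ∑ i, ν i • v i = y) :
    ∃ ν' : ι → ℝ, (∀ i, 0 ≤ ν' i) ∧ ∑ i, ν' i • v i = y ∧
      LinearIndepOn ℝ v ((Finset.univ.filter fun i => ν' i ≠ 0 : Finset ι) : Set ι) ∧
      ∑ i, ω i * ν' i ≤ ∑ i, ω i * ν i := by
  induction hn : (Finset.univ.filter fun i => ν i ≠ 0).card using Nat.strong_induction_on
    generalizing ν with
  | _ n ih =>
  by_cases hli : LinearIndepOn ℝ v ((Finset.univ.filter fun i => ν i ≠ 0 : Finset ι) : Set ι)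
  · exact ⟨ν, hν, hy, hli, le_rfl⟩
  obtain ⟨c, hc0, hcsupp, hcsum, hcω⟩ : ∃ c : ι → ℝ, c ≠ 0 ∧ (∀ i, ν i = 0 → c i = 0) ∧
      ∑ i, c i • v i = 0 ∧ 0 ≤ ∑ i, ω i * c i := by
    rw [linearIndepOn_finset_iff] at hli
    push Not at hli
    obtain ⟨c', hs, i, hi, hci⟩ := hli
    let c : ι → ℝ := fun i => if ν i ≠ 0 then c' i else 0
    have hcs : ∑ i, c i • v i = 0 := by
      rw [← hs, Finset.sum_filter]
      exact Finset.sum_congr rfl fun i _ => by by_cases h : ν i = 0 <;> simp [c, h]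
    have hcne : c ≠ 0 := fun h => hci (by
      have := congrFun h i
      simpa [c, (Finset.mem_filter.1 hi).2] using this)
    rcases le_total 0 (∑ i, ω i * c i) with h | h
    · exact ⟨c, hcne, fun i hi => by simp [c, hi], hcs, h⟩
    · exact ⟨-c, neg_ne_zero.2 hcne, fun i hi => by simp [c, hi], by simp [hcs], by simpa using h⟩
  have hcsum1 : ∑ i, c i = 0 := by
    have := congrArg δ hcsum
    simpa [map_sum, hδ] using this
  obtain ⟨i1, hi1⟩ : ∃ i, 0 < c i := by
    by_contra! hneg
    refine hc0 (funext fun i => ?_)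
    exact (Finset.sum_eq_zero_iff_of_nonpos (fun i _ => hneg i)).1 hcsum1 i (Finset.mem_univ i)
  obtain ⟨i0, hi0, hmin⟩ := Finset.exists_min_image (Finset.univ.filter fun i => 0 < c i)
    (fun i => ν i / c i) ⟨i1, by simpa using hi1⟩
  have hci0 : 0 < c i0 := by simpa using hi0
  have hνi0 : ν i0 ≠ 0 := fun h => hci0.ne' (hcsupp i0 h)
  let τ := ν i0 / c i0
  have hτ : 0 ≤ τ := div_nonneg (hν i0) hci0.le
  obtain ⟨ν', h1, h2, h3, h4⟩ := ih (Finset.univ.filter fun i => ν i - τ * c i ≠ 0).card (by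
      rw [← hn]
      refine Finset.card_lt_card (Finset.ssubset_iff_of_subset ?_ |>.2 ⟨i0, by simpa using hνi0, ?_⟩)
      · intro i
        simp only [Finset.mem_filter, Finset.mem_univ, true_and]
        intro h h0
        exact h (by simp [h0, hcsupp i h0])
      · have : ν i0 - τ * c i0 = 0 := by simp only [τ]; field_simp; simp
        simp [this])
    (fun i => ν i - τ * c i) (fun i => by
      rcases lt_or_ge 0 (c i) with h | h
      · have := hmin i (by simpa using h)
        rw [le_div_iff₀ h] at this
        simpa [τ] using this
      · have := mul_nonneg hτ (neg_nonneg.2 h)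
        have := hν i
        linarith)
    (by simp [sub_smul, Finset.sum_sub_distrib, mul_smul, ← Finset.smul_sum, hy, hcsum]) rfl
  refine ⟨ν', h1, h2, h3, h4.trans ?_⟩
  simp only [mul_sub, Finset.sum_sub_distrib]
  have : ∑ i, ω i * (τ * c i) = τ * ∑ i, ω i * c i := by
    rw [Finset.mul_sum]
    exact Finset.sum_congr rfl fun i _ => by ring
  rw [this]
  linarith [mul_nonneg hτ hcω]

/-- A point of the cone in general position lies in the interior of a cell. -/
theorem exists_isCell_coord_pos {v : ι → E} (hv : Submodule.span ℝ (Set.range v) = ⊤)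
    {δ : E →ₗ[ℝ] ℝ} (hδ : ∀ i, δ (v i) = 1) {ω : ι → ℝ}
    (hω : ∀ B, IsBasisOn v B → ∀ i ∉ B, lift v ω B (v i) ≠ ω i) {y : E}
    (hgen : ∀ B, IsBasisOn v B → ∀ b ∈ B, coord v B y b ≠ 0)
    {ν : ι → ℝ} (hν : ∀ i, 0 ≤ ν i) (hy : ∑ i, ν i • v i = y) :
    ∃ B, IsCell v ω B ∧ ∀ b ∈ B, 0 < coord v B y b := by
  have key : ∀ ν : ι → ℝ, (∀ i, 0 ≤ ν i) → ∑ i, ν i • v i = y →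
      ∃ B, (IsBasisOn v B ∧ ∀ b ∈ B, 0 < coord v B y b) ∧ lift v ω B y ≤ ∑ i, ω i * ν i := by
    intro ν hν hy
    obtain ⟨ν', h1, h2, h3, h4⟩ := exists_linearIndepOn_support hδ ω y ν hν hy
    obtain ⟨B, hSB, hB⟩ := exists_isBasisOn_superset hv h3
    have hco : coord v B y = ν' := hB.coord_eq (fun i hi => by
      by_contra h
      exact hi (hSB (by simpa using h))) h2
    refine ⟨B, ⟨hB, fun b hb => ?_⟩, ?_⟩
    · exact lt_of_le_of_ne (by rw [hco]; exact h1 b) (hgen B hB b hb).symm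
    · rw [lift_apply, hco]
      exact h4
  obtain ⟨B0, hB0, -⟩ := key ν hν hy
  obtain ⟨B, hB, hmin⟩ := Finset.exists_min_image
    (Finset.univ.filter fun B => IsBasisOn v B ∧ ∀ b ∈ B, 0 < coord v B y b)
    (fun B => lift v ω B y) ⟨B0, by simpa using hB0⟩
  simp only [Finset.mem_filter, Finset.mem_univ, true_and] at hB hmin
  refine ⟨B, ⟨hB.1, fun i hi => ?_⟩, hB.2⟩
  by_contra! hlt
  have hlt : ω i < lift v ω B (v i) := lt_of_le_of_ne hlt (hω B hB.1 i hi).symm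
  have hBne : B.Nonempty := by
    by_contra hne
    rw [Finset.not_nonempty_iff_eq_empty] at hne
    have h0 := hB.1.sum_coord (v i)
    rw [Finset.sum_eq_zero (fun j _ => by
      rw [hB.1.coord_eq_zero _ (by simp [hne]), zero_smul])] at h0
    have := hδ i
    rw [← h0] at this
    simp at this
  obtain ⟨b0, hb0, hb0min⟩ := Finset.exists_min_image B (fun b => coord v B y b) hBne
  let C := ∑ j, |coord v B (v i) j|
  have hC : 0 ≤ C := Finset.sum_nonneg fun j _ => abs_nonneg _
  let τ := coord v B y b0 / (C + 1)
  have hτ : 0 < τ := div_pos (hB.2 b0 hb0) (by linarith)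
  obtain ⟨B', hB', hle⟩ := key (coord v B y - τ • coord v B (v i) + τ • (Pi.single i 1 : ι → ℝ)) (by
      intro j
      by_cases hj : j ∈ B
      · have hji : j ≠ i := fun e => hi (e ▸ hj)
        have h1 := hb0min j hj
        have h2 : coord v B (v i) j ≤ C := (le_abs_self _).trans
          (Finset.single_le_sum (f := fun j => |coord v B (v i) j|)
            (fun j _ => abs_nonneg _) (Finset.mem_univ j))
        have h3 : τ * (C + 1) = coord v B y b0 := by
          simp only [τ]
          field_simp
        have h4 : τ * coord v B (v i) j ≤ τ * C := mul_le_mul_of_nonneg_left h2 hτ.le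
        simp [hji]
        linarith
      · have : 0 ≤ (Pi.single i 1 : ι → ℝ) j := by
          by_cases h : j = i
          · subst h; simp
          · simp [h]
        simp [hB.1.coord_eq_zero _ hj]
        exact mul_nonneg hτ.le this)
    (by
      simp [add_smul, sub_smul, Finset.sum_add_distrib, mul_smul,
        ← Finset.smul_sum, hB.1.sum_coord, Pi.single_apply])
  have h5 := hmin B' hB'
  have h6 : ∑ j, ω j * (coord v B y - τ • coord v B (v i) + τ • (Pi.single i 1 : ι → ℝ)) j
      = lift v ω B y - τ * (lift v ω B (v i) - ω i) := by
    simp only [lift_apply, Pi.add_apply, Pi.sub_apply, Pi.smul_apply, smul_eq_mul, mul_add, mul_sub,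
      Finset.sum_add_distrib, Finset.sum_sub_distrib, Finset.mul_sum, mul_left_comm τ]
    simp [Pi.single_apply, mul_comm]
    ring
  rw [h6] at hle
  linarith [mul_pos hτ (sub_pos.2 hlt)]

/-- The point `x` lies in the cell `B` after an infinitesimal perturbation in direction `q`. -/
def LexPos (v : ι → E) (q : E) (B : Finset ι) (x : E) : Prop :=
  ∀ b ∈ B, 0 ≤ coord v B x b ∧ (coord v B x b = 0 → 0 < coord v B q b)

theorem eventually_ne_nhdsGT_zero (r : ℝ) : ∀ᶠ ε in nhdsWithin (0 : ℝ) (Set.Ioi 0), ε ≠ r := by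
  rcases le_or_gt r 0 with h | h
  · filter_upwards [self_mem_nhdsWithin] with ε (hε : 0 < ε)
    exact (h.trans_lt hε).ne'
  · filter_upwards [nhdsWithin_le_nhds (Iio_mem_nhds h)] with ε hε
    exact ne_of_lt hε

theorem LexPos.eventually_pos {v : ι → E} {q : E} {B : Finset ι} {x : E} (h : LexPos v q B x) :
    ∀ᶠ ε in nhdsWithin (0 : ℝ) (Set.Ioi 0), ∀ b ∈ B, 0 < coord v B (x + ε • q) b := by
  rw [Filter.eventually_all_finset]
  intro b hb
  obtain ⟨h0, h1⟩ := h b hb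
  simp only [map_add, map_smul, Pi.add_apply, Pi.smul_apply, smul_eq_mul]
  rcases h0.eq_or_lt with h0 | h0
  · filter_upwards [self_mem_nhdsWithin] with ε (hε : 0 < ε)
    rw [← h0, zero_add]
    exact mul_pos hε (h1 h0.symm)
  · refine nhdsWithin_le_nhds (ContinuousAt.eventually_lt continuousAt_const
      (g := fun ε => coord v B x b + ε * coord v B q b) (by fun_prop) (by simpa using h0))

theorem lexPos_of_frequently {v : ι → E} {q : E} {B : Finset ι} {x : E}
    (h : ∃ᶠ ε in nhdsWithin (0 : ℝ) (Set.Ioi 0), ∀ b ∈ B, 0 < coord v B (x + ε • q) b) :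
    LexPos v q B x := by
  intro b hb
  simp only [map_add, map_smul, Pi.add_apply, Pi.smul_apply, smul_eq_mul] at h
  constructor
  · by_contra! hneg
    have : ∀ᶠ ε in nhdsWithin (0 : ℝ) (Set.Ioi 0), coord v B x b + ε * coord v B q b < 0 :=
      nhdsWithin_le_nhds (ContinuousAt.eventually_lt
        (f := fun ε => coord v B x b + ε * coord v B q b) (by fun_prop)
        continuousAt_const (by simpa using hneg))
    obtain ⟨ε, h1, h2⟩ := (h.and_eventually this).exists
    linarith [h1 b hb]
  · intro h0
    obtain ⟨ε, h1, h2⟩ := (h.and_eventually self_mem_nhdsWithin).exists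
    have := h1 b hb
    rw [h0, zero_add] at this
    exact pos_of_mul_pos_right this (le_of_lt h2)

theorem IsGeneric.exists_lexPos {v : ι → E} (hv : Submodule.span ℝ (Set.range v) = ⊤)
    {δ : E →ₗ[ℝ] ℝ} (hδ : ∀ i, δ (v i) = 1) {ω t : ι → ℝ} (hg : IsGeneric v ω t)
    {μ : ι → ℝ} (hμ : ∀ i, 0 ≤ μ i) :
    ∃ B, IsCell v ω B ∧ LexPos v (∑ i, t i • v i) B (∑ i, μ i • v i) := by
  set q := ∑ i, t i • v i with hq
  set x := ∑ i, μ i • v i with hx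
  have hgen : ∀ᶠ ε in nhdsWithin (0 : ℝ) (Set.Ioi 0), ∀ B ∈ (Finset.univ : Finset (Finset ι)),
      ∀ b ∈ B, IsBasisOn v B → coord v B (x + ε • q) b ≠ 0 := by
    simp only [Filter.eventually_all_finset]
    intro B _ b hb
    by_cases hB : IsBasisOn v B
    · have hqb := hg.coord_ne B hB b hb
      filter_upwards [eventually_ne_nhdsGT_zero (-coord v B x b / coord v B q b)] with ε hε _ h0
      refine hε ?_
      simp only [map_add, map_smul, Pi.add_apply, Pi.smul_apply, smul_eq_mul] at h0
      rw [eq_div_iff hqb]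
      linarith
    · simp [hB]
  have hex : ∀ᶠ ε in nhdsWithin (0 : ℝ) (Set.Ioi 0),
      ∃ B, IsCell v ω B ∧ ∀ b ∈ B, 0 < coord v B (x + ε • q) b := by
    filter_upwards [hgen, self_mem_nhdsWithin] with ε h1 (hε : 0 < ε)
    refine exists_isCell_coord_pos hv hδ hg.lift_ne
      (fun B hB b hb => h1 B (Finset.mem_univ B) b hb hB) (ν := fun i => μ i + ε * t i)
      (fun i => add_nonneg (hμ i) (mul_nonneg hε.le (hg.pos i).le)) ?_
    simp [add_smul, Finset.sum_add_distrib, mul_smul, ← Finset.smul_sum, hx, hq]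
  by_contra! hcon
  have hnot : ∀ᶠ ε in nhdsWithin (0 : ℝ) (Set.Ioi 0), ∀ B ∈ (Finset.univ : Finset (Finset ι)),
      ¬ (IsCell v ω B ∧ ∀ b ∈ B, 0 < coord v B (x + ε • q) b) := by
    rw [Filter.eventually_all_finset]
    intro B _
    by_cases hB : IsCell v ω B
    · by_contra hfr
      refine hcon B hB (lexPos_of_frequently ?_)
      rw [← Filter.Frequently] at hfr
      exact hfr.mono fun ε h => h.2
    · simp [hB]
  obtain ⟨ε, ⟨B, hB⟩, h2⟩ := (hex.and hnot).exists
  exact h2 B (Finset.mem_univ B) hB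

/-- Comparing two cells at a point of the second one. -/
theorem IsCell.lift_le_lift {v : ι → E} {ω : ι → ℝ} {B B' : Finset ι} (h : IsCell v ω B)
    (h' : IsBasisOn v B') {y : E} (hy : ∀ b ∈ B', 0 ≤ coord v B' y b) :
    lift v ω B y ≤ lift v ω B' y ∧ (lift v ω B y = lift v ω B' y →
      ∀ b ∈ B', 0 < coord v B' y b → b ∈ B) := by
  have e : lift v ω B y = ∑ i, coord v B' y i * lift v ω B (v i) := by
    conv_lhs => rw [← h'.sum_coord y]
    simp [map_sum]
  have hnn : ∀ i, 0 ≤ coord v B' y i := fun i => by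
    by_cases hi : i ∈ B'
    · exact hy i hi
    · rw [h'.coord_eq_zero _ hi]
  have hterm : ∀ i ∈ Finset.univ, coord v B' y i * lift v ω B (v i) ≤ ω i * coord v B' y i :=
    fun i _ => by
      rw [mul_comm (ω i)]
      exact mul_le_mul_of_nonneg_left (h.lift_le i) (hnn i)
  rw [e, lift_apply v ω B']
  refine ⟨Finset.sum_le_sum hterm, fun heq b _ hpos => h.mem_of_lift_eq ?_⟩
  have := (Finset.sum_eq_sum_iff_of_le hterm).1 heq b (Finset.mem_univ b)
  rw [mul_comm (ω b)] at this
  exact mul_left_cancel₀ hpos.ne' this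

theorem IsCell.eq_of_lexPos {v : ι → E} {ω : ι → ℝ} {q : E} {B B' : Finset ι} (h : IsCell v ω B)
    (h' : IsCell v ω B') {x : E} (hx : LexPos v q B x) (hx' : LexPos v q B' x) : B = B' := by
  obtain ⟨ε, h1, h2⟩ := (hx.eventually_pos.and hx'.eventually_pos).exists
  obtain ⟨le1, eq1⟩ := h.lift_le_lift h'.1 fun b hb => (h2 b hb).le
  obtain ⟨le2, eq2⟩ := h'.lift_le_lift h.1 fun b hb => (h1 b hb).le
  exact Finset.Subset.antisymm (fun b hb => eq2 (le_antisymm le2 le1) b hb (h1 b hb))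
    (fun b hb => eq1 (le_antisymm le1 le2) b hb (h2 b hb))

/-- Every facet of a cell lies in a cell on the same side of the facet as `∑ i, t i • v i`. -/
theorem IsGeneric.exists_adjacent {v : ι → E} (hv : Submodule.span ℝ (Set.range v) = ⊤)
    {δ : E →ₗ[ℝ] ℝ} (hδ : ∀ i, δ (v i) = 1) {ω t : ι → ℝ} (hg : IsGeneric v ω t)
    {B : Finset ι} (hB : IsCell v ω B) {a : ι} (ha : a ∈ B) :
    ∃ B' a', IsCell v ω B' ∧ a' ∈ B' ∧ 0 < coord v B' (∑ i, t i • v i) a' ∧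
      B'.erase a' = B.erase a := by
  let μ : ι → ℝ := fun i => if i ∈ B.erase a then 1 else 0
  obtain ⟨B', hB', hlex⟩ := hg.exists_lexPos hv hδ (μ := μ) (fun i => by
    by_cases h : i ∈ B.erase a <;> simp only [μ, h, if_true, if_false] <;> norm_num)
  set x := ∑ i, μ i • v i with hx
  have hcoB : coord v B x = μ :=
    hB.1.coord_eq (fun i hi => if_neg fun h => hi (Finset.mem_of_mem_erase h)) rfl
  have hμB : ∀ b ∈ B, 0 ≤ coord v B x b := fun b _ => by
    rw [hcoB]
    by_cases h : b ∈ B.erase a <;> simp only [μ, h, if_true, if_false] <;> norm_num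
  have heq : lift v ω B' x = lift v ω B x := le_antisymm
    (hB'.lift_le_lift hB.1 hμB).1 (hB.lift_le_lift hB'.1 fun b hb => (hlex b hb).1).1
  have hsub : B.erase a ⊆ B' := fun b hb =>
    (hB'.lift_le_lift hB.1 hμB).2 heq b (Finset.mem_of_mem_erase hb) (by
      rw [hcoB]
      simp [μ, Finset.mem_erase.1 hb])
  have hcard : B'.card = (B.erase a).card + 1 := by
    rw [Finset.card_erase_add_one ha, hB.1.card_eq, hB'.1.card_eq]
  obtain ⟨a', ha', hB'eq⟩ : ∃ a', a' ∉ B.erase a ∧ insert a' (B.erase a) = B' := by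
    obtain ⟨a', h⟩ := Finset.card_eq_one.1 (show (B' \ B.erase a).card = 1 by
      rw [Finset.card_sdiff_of_subset hsub]
      omega)
    refine ⟨a', (Finset.mem_sdiff.1 (h ▸ Finset.mem_singleton_self a')).2, ?_⟩
    rw [Finset.insert_eq, ← h, Finset.sdiff_union_of_subset hsub]
  have ha'B' : a' ∈ B' := hB'eq ▸ Finset.mem_insert_self _ _
  have hcoB' : coord v B' x = μ := hB'.1.coord_eq (fun i hi => if_neg fun h => hi (hsub h)) rfl
  refine ⟨B', a', hB', ha'B', (hlex a' ha'B').2 ?_, ?_⟩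
  · rw [hcoB']
    exact if_neg ha'
  · rw [← hB'eq, Finset.erase_insert ha']

/-- On each side of a facet there is at most one cell. -/
theorem IsCell.eq_of_erase_eq {v : ι → E} {ω : ι → ℝ} {q : E} {B B' : Finset ι}
    (h : IsCell v ω B) (h' : IsCell v ω B') {a a' : ι} (ha : a ∈ B) (ha' : a' ∈ B')
    (he : B.erase a = B'.erase a') (hq : coord v B q a < 0) (hq' : coord v B' q a' < 0) :
    a = a' := by
  have e : ∀ {C : Finset ι} {c : ι}, IsBasisOn v C → c ∈ C → C.erase c = B.erase a →
      lift v ω B q - lift v ω B' q = coord v C q c * (lift v ω B (v c) - lift v ω B' (v c)) := by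
    intro C c hC hc heC
    conv_lhs => rw [← hC.sum_coord q]
    simp only [map_sum, map_smul, smul_eq_mul, ← Finset.sum_sub_distrib, ← mul_sub]
    refine Finset.sum_eq_single c (fun i _ hic => ?_) (by simp)
    by_cases hi : i ∈ C
    · have hiB : i ∈ B.erase a := heC ▸ Finset.mem_erase.2 ⟨hic, hi⟩
      have hiB' : i ∈ B'.erase a' := he ▸ hiB
      rw [h.1.lift_self ω (Finset.mem_of_mem_erase hiB),
        h'.1.lift_self ω (Finset.mem_of_mem_erase hiB'), sub_self, mul_zero]
    · rw [hC.coord_eq_zero _ hi, zero_mul]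
  have e1 := e h.1 ha rfl
  have e2 := e h'.1 ha' he.symm
  rw [h.1.lift_self ω ha] at e1
  rw [h'.1.lift_self ω ha'] at e2
  have h1 := h'.lift_le a
  have h2 := h.lift_le a'
  have h3 : ω a - lift v ω B' (v a) = 0 := by
    have : coord v B q a * (ω a - lift v ω B' (v a)) ≤ 0 :=
      mul_nonpos_of_nonpos_of_nonneg hq.le (by linarith)
    have : 0 ≤ coord v B' q a' * (lift v ω B (v a') - ω a') :=
      mul_nonneg_of_nonpos_of_nonpos hq'.le (by linarith)
    have : coord v B q a * (ω a - lift v ω B' (v a)) = 0 := by linarith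
    exact (mul_eq_zero.1 this).resolve_left hq.ne
  have haB' : a ∈ B' := h'.mem_of_lift_eq (by linarith)
  by_contra hne
  exact (Finset.mem_erase.1 (he ▸ Finset.mem_erase.2 ⟨hne, haB'⟩ : a ∈ B.erase a)).1 rfl

end Triangulation

section Box

/-- Rounding down to an integer, such that the remainder lies in `[0, 1)` if `c` holds and in
`(0, 1]` otherwise. -/
noncomputable def roundDown (c : Prop) (r : ℝ) : ℤ := if c then ⌊r⌋ else ⌈r⌉ - 1

theorem roundDown_sub_intCast (c : Prop) (r : ℝ) (n : ℤ) :
    roundDown c (r - n) = roundDown c r - n := by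
  unfold roundDown
  split_ifs
  · simp
  · rw [Int.ceil_sub_intCast]
    ring

theorem roundDown_add_intCast (c : Prop) (r : ℝ) (n : ℤ) :
    roundDown c (r + n) = roundDown c r + n := by
  simpa using roundDown_sub_intCast c r (-n)

theorem roundDown_eq_zero_iff {c : Prop} {r : ℝ} :
    roundDown c r = 0 ↔ 0 ≤ r ∧ r ≤ 1 ∧ (c → r ≠ 1) ∧ (¬ c → r ≠ 0) := by
  unfold roundDown
  split_ifs with h
  · rw [Int.floor_eq_zero_iff, Set.mem_Ico, lt_iff_le_and_ne]
    tauto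
  · rw [sub_eq_zero, Int.ceil_eq_iff, lt_iff_le_and_ne]
    norm_num [h]
    tauto

theorem roundDown_nonneg_iff {s r : ℝ} :
    0 ≤ roundDown (0 < s) r ↔ 0 ≤ r ∧ (r = 0 → 0 < s) := by
  unfold roundDown
  split_ifs with h
  · rw [Int.floor_nonneg]
    tauto
  · rw [sub_nonneg, Int.one_le_ceil_iff, lt_iff_le_and_ne]
    tauto

variable {ι E Λ : Type*} [Fintype ι] [AddCommGroup E] [Module ℝ E] [AddCommGroup Λ]

/-- The representative of `w` in the half-open fundamental parallelepiped spanned by `B`; the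
predicate `c` selects the coordinates that are allowed to vanish. -/
noncomputable def boxRep (φ : Λ →+ E) (u : ι → Λ) (B : Finset ι) (c : ι → Prop) (w : Λ) : Λ :=
  w - ∑ b ∈ B, roundDown (c b) (coord (φ ∘ u) B (φ w) b) • u b

/-- Membership in the half-open fundamental parallelepiped spanned by `B`. -/
def IsBox (φ : Λ →+ E) (u : ι → Λ) (B : Finset ι) (c : ι → Prop) (w : Λ) : Prop :=
  ∀ b ∈ B, roundDown (c b) (coord (φ ∘ u) B (φ w) b) = 0

variable {φ : Λ →+ E} {u : ι → Λ} {B : Finset ι} {c : ι → Prop}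

theorem coord_map_sum_smul (hB : IsBasisOn (φ ∘ u) B) (n : ι → ℤ) {b : ι} (hb : b ∈ B) :
    coord (φ ∘ u) B (φ (∑ i ∈ B, n i • u i)) b = n b := by
  have : coord (φ ∘ u) B (φ (∑ i ∈ B, n i • u i)) = fun i => if i ∈ B then (n i : ℝ) else 0 := by
    refine hB.coord_eq (fun i hi => if_neg hi) ?_
    simp only [ite_smul, zero_smul, Finset.sum_ite_mem, Finset.univ_inter, map_sum, map_zsmul,
      Function.comp_apply]
    exact Finset.sum_congr rfl fun i _ => Int.cast_smul_eq_zsmul ℝ _ _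
  rw [this]
  simp [hb]

theorem coord_add_sum_smul (hB : IsBasisOn (φ ∘ u) B) (w : Λ) (n : ι → ℤ) {b : ι} (hb : b ∈ B) :
    coord (φ ∘ u) B (φ (w + ∑ i ∈ B, n i • u i)) b = coord (φ ∘ u) B (φ w) b + n b := by
  rw [map_add, map_add, Pi.add_apply, coord_map_sum_smul hB n hb]

theorem coord_boxRep (hB : IsBasisOn (φ ∘ u) B) (w : Λ) {b : ι} (hb : b ∈ B) :
    coord (φ ∘ u) B (φ (boxRep φ u B c w)) b
      = coord (φ ∘ u) B (φ w) b - roundDown (c b) (coord (φ ∘ u) B (φ w) b) := by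
  rw [boxRep, map_sub, map_sub, Pi.sub_apply, coord_map_sum_smul hB _ hb]

theorem isBox_boxRep (hB : IsBasisOn (φ ∘ u) B) (w : Λ) :
    IsBox φ u B c (boxRep φ u B c w) := by
  intro b hb
  rw [coord_boxRep hB w hb, roundDown_sub_intCast, sub_self]

theorem boxRep_add_sum_smul (hB : IsBasisOn (φ ∘ u) B) (w : Λ) (n : ι → ℤ) :
    boxRep φ u B c (w + ∑ i ∈ B, n i • u i) = boxRep φ u B c w := by
  have : ∀ b ∈ B, roundDown (c b) (coord (φ ∘ u) B (φ (w + ∑ i ∈ B, n i • u i)) b) • u b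
      = roundDown (c b) (coord (φ ∘ u) B (φ w) b) • u b + n b • u b := fun b hb => by
    rw [coord_add_sum_smul hB w n hb, roundDown_add_intCast, add_smul]
  rw [boxRep, boxRep, Finset.sum_congr rfl this, Finset.sum_add_distrib]
  abel

theorem boxRep_boxRep (hB : IsBasisOn (φ ∘ u) B) (c c' : ι → Prop) (w : Λ) :
    boxRep φ u B c (boxRep φ u B c' w) = boxRep φ u B c w := by
  conv_lhs => rw [boxRep.eq_def φ u B c', sub_eq_add_neg, ← Finset.sum_neg_distrib]
  simp only [← neg_smul]
  exact boxRep_add_sum_smul hB w _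

theorem boxRep_neg_boxRep (hB : IsBasisOn (φ ∘ u) B) (c c' : ι → Prop) (w : Λ) :
    boxRep φ u B c (-boxRep φ u B c' w) = boxRep φ u B c (-w) := by
  rw [boxRep.eq_def φ u B c', neg_sub, sub_eq_neg_add]
  exact boxRep_add_sum_smul hB (-w) _

theorem IsBox.boxRep_eq {w : Λ} (h : IsBox φ u B c w) : boxRep φ u B c w = w := by
  rw [boxRep, Finset.sum_eq_zero fun b hb => by rw [h b hb, zero_smul], sub_zero]

/-- Finiteness of the set of lattice points with bounded coordinates. -/
def FiniteBoxes (φ : Λ →+ E) (u : ι → Λ) : Prop :=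
  ∀ B, IsBasisOn (φ ∘ u) B → {w : Λ | ∀ b ∈ B, 0 ≤ coord (φ ∘ u) B (φ w) b ∧
    coord (φ ∘ u) B (φ w) b ≤ 1}.Finite

/-- The finite set of lattice points in a half-open fundamental parallelepiped. -/
noncomputable def box (φ : Λ →+ E) (u : ι → Λ) (B : Finset ι) (c : ι → Prop) : Finset Λ :=
  if h : {w | IsBox φ u B c w}.Finite then h.toFinset else ∅

theorem FiniteBoxes.mem_box (hfin : FiniteBoxes φ u) (hB : IsBasisOn (φ ∘ u) B) {w : Λ} :
    w ∈ box φ u B c ↔ IsBox φ u B c w := by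
  have h : {w | IsBox φ u B c w}.Finite := (hfin B hB).subset fun w hw b hb => by
    have := roundDown_eq_zero_iff.1 (hw b hb)
    exact ⟨this.1, this.2.1⟩
  simp [box, dif_pos h]

/-- The lattice points in the half-open parallelepiped spanned by linearly independent vectors. -/
def faceBox (φ : Λ →+ E) (u : ι → Λ) (W : Finset ι) : Set Λ :=
  {w | ∃ μ : ι → ℝ, (∀ i, 0 ≤ μ i ∧ μ i < 1) ∧ (∀ i ∉ W, μ i = 0) ∧
    ∑ i, μ i • φ (u i) = φ w}

theorem card_box_filter_intCast (hfin : FiniteBoxes φ u) (hB : IsBasisOn (φ ∘ u) B) {a : ι}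
    (ha : a ∈ B) :
    ((box φ u B c).filter fun w => ∃ n : ℤ, coord (φ ∘ u) B (φ w) a = n).card
      = (faceBox φ u (B.erase a)).ncard := by
  rw [← Set.ncard_coe_finset]
  refine Set.ncard_congr (fun w _ => boxRep φ u B (fun _ => True) w) ?_ ?_ ?_
  · rintro w hw
    simp only [Finset.coe_filter, Set.mem_ofPred_eq, hfin.mem_box hB] at hw
    obtain ⟨hbox, n, hn⟩ := hw
    refine ⟨coord (φ ∘ u) B (φ (boxRep φ u B (fun _ => True) w)), fun i => ?_, fun i hi => ?_,
      hB.sum_coord _⟩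
    · by_cases hi : i ∈ B
      · have := roundDown_eq_zero_iff.1 (isBox_boxRep (c := fun _ => True) hB w i hi)
        exact ⟨this.1, lt_of_le_of_ne this.2.1 (this.2.2.1 trivial)⟩
      · rw [hB.coord_eq_zero _ hi]
        norm_num
    · by_cases hiB : i ∈ B
      · obtain rfl : i = a := by
          by_contra hne
          exact hi (Finset.mem_erase.2 ⟨hne, hiB⟩)
        rw [coord_boxRep hB w hiB, hn]
        simp [roundDown]
      · exact hB.coord_eq_zero _ hiB
  · intro w w' hw hw' h
    simp only [Finset.coe_filter, Set.mem_ofPred_eq, hfin.mem_box hB] at hw hw'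
    have := congrArg (boxRep φ u B c) h
    rwa [boxRep_boxRep hB, boxRep_boxRep hB, hw.1.boxRep_eq, hw'.1.boxRep_eq] at this
  · rintro w ⟨μ, hμ, hμ0, hsum⟩
    have hco : coord (φ ∘ u) B (φ w) = μ :=
      hB.coord_eq (fun i hi => hμ0 i fun h => hi (Finset.mem_of_mem_erase h)) hsum
    have hbox : IsBox φ u B (fun _ => True) w := fun b _ => by
      rw [hco, roundDown_eq_zero_iff]
      exact ⟨(hμ b).1, (hμ b).2.le, fun _ => (hμ b).2.ne, fun h => (h trivial).elim⟩
    refine ⟨boxRep φ u B c w, ?_, by rw [boxRep_boxRep hB, hbox.boxRep_eq]⟩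
    simp only [Finset.coe_filter, Set.mem_ofPred_eq, hfin.mem_box hB]
    refine ⟨isBox_boxRep hB w, -roundDown (c a) 0, ?_⟩
    rw [coord_boxRep hB w ha, hco, hμ0 a (by simp)]
    simp

theorem sum_box_one_sub_two_mul_coord (hfin : FiniteBoxes φ u) (hB : IsBasisOn (φ ∘ u) B) {a : ι}
    (ha : a ∈ B) :
    ∑ w ∈ box φ u B c, (1 - 2 * coord (φ ∘ u) B (φ w) a)
      = if c a then ((faceBox φ u (B.erase a)).ncard : ℝ)
        else -((faceBox φ u (B.erase a)).ncard : ℝ) := by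
  rw [← Finset.sum_filter_add_sum_filter_not (box φ u B c)
    (fun w => ∃ n : ℤ, coord (φ ∘ u) B (φ w) a = n), ← card_box_filter_intCast (c := c) hfin hB ha]
  have hnonint : ∑ w ∈ (box φ u B c).filter (fun w => ¬ ∃ n : ℤ, coord (φ ∘ u) B (φ w) a = n),
      (1 - 2 * coord (φ ∘ u) B (φ w) a) = 0 := by
    have hco : ∀ w ∈ (box φ u B c).filter (fun w => ¬ ∃ n : ℤ, coord (φ ∘ u) B (φ w) a = n),
        coord (φ ∘ u) B (φ (boxRep φ u B c (-w))) a = 1 - coord (φ ∘ u) B (φ w) a := by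
      intro w hw
      simp only [Finset.mem_filter, hfin.mem_box hB] at hw
      obtain ⟨h0, h1, -⟩ := roundDown_eq_zero_iff.1 (hw.1 a ha)
      have hne0 : coord (φ ∘ u) B (φ w) a ≠ 0 := fun h => hw.2 ⟨0, by simpa using h⟩
      have hne1 : coord (φ ∘ u) B (φ w) a ≠ 1 := fun h => hw.2 ⟨1, by simpa using h⟩
      have hr : roundDown (c a) (1 - coord (φ ∘ u) B (φ w) a) = 0 := by
        rw [roundDown_eq_zero_iff]
        exact ⟨by linarith, by linarith, fun _ h => hne0 (by linarith),
          fun _ h => hne1 (by linarith)⟩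
      have hr' : roundDown (c a) (-coord (φ ∘ u) B (φ w) a) = -1 := by
        have := roundDown_sub_intCast (c a) (1 - coord (φ ∘ u) B (φ w) a) 1
        rw [hr] at this
        simpa using this
      rw [coord_boxRep hB _ ha, map_neg, map_neg, Pi.neg_apply, hr']
      push_cast
      ring
    refine Finset.sum_involution (fun w _ => boxRep φ u B c (-w)) ?_ ?_ ?_ ?_
    · intro w hw
      rw [hco w hw]
      ring
    · intro w hw hne h
      have := hco w hw
      rw [h] at this
      exact hne (by linarith)
    · intro w hw
      have hc := hco w hw
      simp only [Finset.mem_filter, hfin.mem_box hB] at hw ⊢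
      refine ⟨isBox_boxRep hB _, ?_⟩
      rintro ⟨n, hn⟩
      exact hw.2 ⟨1 - n, by push_cast; linarith⟩
    · intro w hw
      simp only [Finset.mem_filter, hfin.mem_box hB] at hw
      rw [boxRep_neg_boxRep hB, neg_neg, hw.1.boxRep_eq]
  rw [hnonint, add_zero]
  have hval : ∀ w ∈ (box φ u B c).filter (fun w => ∃ n : ℤ, coord (φ ∘ u) B (φ w) a = n),
      1 - 2 * coord (φ ∘ u) B (φ w) a = if c a then 1 else -1 := by
    intro w hw
    simp only [Finset.mem_filter, hfin.mem_box hB] at hw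
    obtain ⟨hbox, n, hn⟩ := hw
    obtain ⟨h0, h1, h2, h3⟩ := roundDown_eq_zero_iff.1 (hbox a ha)
    rw [hn] at h0 h1 h2 h3 ⊢
    norm_cast at h0 h1 h2 h3
    obtain rfl | rfl : n = 0 ∨ n = 1 := by omega
    · have : c a := by
        by_contra h
        exact h3 h rfl
      simp [this]
    · have : ¬ c a := fun h => h2 h rfl
      simp [this]
      norm_num
  rw [Finset.sum_congr rfl hval, Finset.sum_const]
  split_ifs <;> simp

/-- The contributions of the facets of the cells of a triangulation add up to a nonnegative
number: all negative contributions cancel against those of adjacent cells. -/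
theorem IsGeneric.sum_facets_nonneg (hv : Submodule.span ℝ (Set.range (φ ∘ u)) = ⊤)
    {δ : E →ₗ[ℝ] ℝ} (hδ : ∀ i, δ ((φ ∘ u) i) = 1) {ω t : ι → ℝ} (hg : IsGeneric (φ ∘ u) ω t)
    (hfin : FiniteBoxes φ u) (R : Finset ι → Prop) :
    0 ≤ ∑ B ∈ Finset.univ.filter (IsCell (φ ∘ u) ω), ∑ a ∈ B.filter (fun a => R (B.erase a)),
      ∑ w ∈ box φ u B (fun b => 0 < coord (φ ∘ u) B (∑ i, t i • (φ ∘ u) i) b),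
        (1 - 2 * coord (φ ∘ u) B (φ w) a) := by
  set q := ∑ i, t i • (φ ∘ u) i with hq
  let S : Finset (Σ _ : Finset ι, ι) := (Finset.univ.filter (IsCell (φ ∘ u) ω)).sigma
    fun B => B.filter fun a => R (B.erase a)
  let N : (Σ _ : Finset ι, ι) → ℝ := fun x => ((faceBox φ u (x.1.erase x.2)).ncard : ℝ)
  let c : (Σ _ : Finset ι, ι) → Prop := fun x => 0 < coord (φ ∘ u) x.1 q x.2
  have hS : ∀ x ∈ S, IsCell (φ ∘ u) ω x.1 ∧ x.2 ∈ x.1 ∧ R (x.1.erase x.2) := fun x hx => by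
    simpa [S] using hx
  have hsum : ∑ B ∈ Finset.univ.filter (IsCell (φ ∘ u) ω),
      ∑ a ∈ B.filter (fun a => R (B.erase a)),
        ∑ w ∈ box φ u B (fun b => 0 < coord (φ ∘ u) B q b), (1 - 2 * coord (φ ∘ u) B (φ w) a)
      = ∑ x ∈ S, if c x then N x else -N x := by
    rw [Finset.sum_sigma]
    refine Finset.sum_congr rfl fun B hB => Finset.sum_congr rfl fun a ha => ?_
    exact sum_box_one_sub_two_mul_coord hfin (Finset.mem_filter.1 hB).2.1
      (Finset.mem_filter.1 ha).1
  rw [hsum, Finset.sum_ite, Finset.sum_neg_distrib, ← sub_eq_add_neg, sub_nonneg]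
  have hadj : ∀ x ∈ S.filter (fun x => ¬ c x), ∃ y ∈ S.filter c,
      y.1.erase y.2 = x.1.erase x.2 := by
    intro x hx
    obtain ⟨h1, h2, h3⟩ := hS x (Finset.mem_filter.1 hx).1
    obtain ⟨B', a', hB', ha', hpos, he⟩ := hg.exists_adjacent hv hδ h1 h2
    refine ⟨⟨B', a'⟩, ?_, he⟩
    simp only [S, Finset.mem_filter, Finset.mem_sigma, Finset.mem_univ, true_and]
    exact ⟨⟨hB', ha', he ▸ h3⟩, hpos⟩
  choose! ψ hψ hψe using hadj
  have hinj : Set.InjOn ψ (S.filter (fun x => ¬ c x) : Finset _) := by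
    intro x hx y hy hxy
    have he : x.1.erase x.2 = y.1.erase y.2 := by rw [← hψe x hx, ← hψe y hy, hxy]
    have hx := Finset.mem_filter.1 hx
    have hy := Finset.mem_filter.1 hy
    obtain ⟨hx1, hx2, -⟩ := hS x hx.1
    obtain ⟨hy1, hy2, -⟩ := hS y hy.1
    have ha : x.2 = y.2 := hx1.eq_of_erase_eq hy1 hx2 hy2 he
      (lt_of_le_of_ne (not_lt.1 hx.2) (hg.coord_ne _ hx1.1 _ hx2))
      (lt_of_le_of_ne (not_lt.1 hy.2) (hg.coord_ne _ hy1.1 _ hy2))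
    have hB : x.1 = y.1 := by
      rw [← Finset.insert_erase hx2, ← Finset.insert_erase hy2, he, ha]
    exact Sigma.ext hB (heq_of_eq ha)
  calc ∑ x ∈ S.filter (fun x => ¬ c x), N x
      = ∑ x ∈ S.filter (fun x => ¬ c x), N (ψ x) :=
        Finset.sum_congr rfl fun x hx => by simp only [N, hψe x hx]
    _ = ∑ y ∈ (S.filter (fun x => ¬ c x)).image ψ, N y := (Finset.sum_image hinj).symm
    _ ≤ ∑ y ∈ S.filter c, N y := by
        refine Finset.sum_le_sum_of_subset_of_nonneg ?_ fun y _ _ => Nat.cast_nonneg _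
        exact Finset.image_subset_iff.2 hψ

end Box

section Compositions

variable {ι : Type*}

/-- The families of natural numbers supported in `s` and with sum `m - e`. -/
noncomputable def compositions (s : Finset ι) (e : ℤ) (m : ℕ) : Finset (ι → ℕ) :=
  if e ≤ m then s.piAntidiag (m - e).toNat else ∅

theorem mem_compositions {s : Finset ι} {e : ℤ} {m : ℕ} {f : ι → ℕ} :
    f ∈ compositions s e m ↔ ∑ i ∈ s, (f i : ℤ) + e = m ∧ ∀ i ∉ s, f i = 0 := by
  have hs : ∑ i ∈ s, (f i : ℤ) = ((∑ i ∈ s, f i : ℕ) : ℤ) := by push_cast; rfl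
  rw [compositions, hs]
  split_ifs with h
  · rw [Finset.mem_piAntidiag]
    refine and_congr ?_ (forall_congr' fun i => not_imp_comm)
    change ∑ i ∈ s, f i = _ ↔ _
    generalize ∑ i ∈ s, f i = a
    omega
  · simp only [Finset.notMem_empty, false_iff, not_and]
    intro h1
    omega

theorem card_compositions {s : Finset ι} {r : ℕ} (hs : s.card = r + 1) {e : ℤ} {m : ℕ}
    (h : e ≤ m) : (compositions s e m).card = ((m - e).toNat + r).choose r := by
  have : (s.piAntidiag (m - e).toNat).card = (s.finsuppAntidiag (m - e).toNat).card := by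
    simp [Finset.finsuppAntidiag]
  rw [compositions, if_pos h, this, Finset.card_finsuppAntidiag_nat_eq_choose, hs,
    show r + 1 + (m - e).toNat - 1 = (m - e).toNat + r by omega, Nat.choose_symm_add]

theorem card_compositions_of_lt {s : Finset ι} {e : ℤ} {m : ℕ} (h : m < e) :
    (compositions s e m).card = 0 := by
  rw [compositions, if_neg (by omega), Finset.card_empty]

theorem card_compositions_sub_of_card_eq_one {s : Finset ι} (hs : s.card = 1) (n : ℕ) :
    ((compositions s 0 n).card : ℝ) - (compositions s 0 0).card = 0 := by
  rw [card_compositions (r := 0) hs (by simp), card_compositions (r := 0) hs (by simp)]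
  simp

theorem card_compositions_sub_of_card_eq_two {s : Finset ι} (hs : s.card = 2) {e : ℤ}
    (h0 : 0 ≤ e) (h1 : e < 2) (n : ℕ) :
    ((compositions s e n).card : ℝ) - (compositions s e 0).card = n := by
  obtain rfl | rfl : e = 0 ∨ e = 1 := by omega
  · rw [card_compositions (r := 1) hs (by simp), card_compositions (r := 1) hs (by simp)]
    simp
  · rw [card_compositions_of_lt (by simp : ((0 : ℕ) : ℤ) < 1)]
    rcases n with _ | n
    · rw [card_compositions_of_lt (by simp)]
      simp
    · rw [card_compositions (r := 1) hs (by simp)]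
      simp

theorem card_compositions_sub_of_card_eq_three {s : Finset ι} (hs : s.card = 3) {e : ℤ}
    (h0 : 0 ≤ e) (h1 : e < 3) (n : ℕ) :
    ((compositions s e n).card : ℝ) - (compositions s e 0).card = n * (n + (3 - 2 * e)) / 2 := by
  obtain rfl | rfl | rfl : e = 0 ∨ e = 1 ∨ e = 2 := by omega
  · rw [card_compositions (r := 2) hs (by simp), card_compositions (r := 2) hs (by simp),
      Nat.cast_choose_two, Nat.cast_choose_two]
    simp
    ring
  · rw [card_compositions_of_lt (by simp : ((0 : ℕ) : ℤ) < 1)]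
    rcases n with _ | n
    · rw [card_compositions_of_lt (by simp)]
      simp
    · rw [card_compositions (r := 2) hs (by simp), Nat.cast_choose_two]
      simp
      ring
  · rw [card_compositions_of_lt (by simp : ((0 : ℕ) : ℤ) < 2)]
    rcases n with _ | _ | n
    · rw [card_compositions_of_lt (by simp)]
      simp
    · rw [card_compositions_of_lt (by simp)]
      norm_num
    · rw [card_compositions (r := 2) hs (by push_cast; omega), Nat.cast_choose_two,
        show (((n + 1 + 1 : ℕ) : ℤ) - 2).toNat = n by omega]
      push_cast
      ring

end Compositions

section Cayley

variable {d k : ℕ} {ι : Type*}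

/-- The inclusion of the integer lattice into real space. -/
def latticeEmb (d k : ℕ) : (Fin d → ℤ) × (Fin k → ℤ) →+ (Fin d → ℝ) × (Fin k → ℝ) :=
  ((Int.castAddHom ℝ).compLeft (Fin d)).prodMap ((Int.castAddHom ℝ).compLeft (Fin k))

@[simp]
theorem latticeEmb_fst (w : (Fin d → ℤ) × (Fin k → ℤ)) (c : Fin d) :
    (latticeEmb d k w).1 c = w.1 c := rfl

@[simp]
theorem latticeEmb_snd (w : (Fin d → ℤ) × (Fin k → ℤ)) (j : Fin k) :
    (latticeEmb d k w).2 j = w.2 j := rfl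

/-- The lattice points `(p i, e_{g i})` of the Cayley configuration. -/
def cayley (p : ι → Fin d → ℤ) (g : ι → Fin k) (i : ι) : (Fin d → ℤ) × (Fin k → ℤ) :=
  (p i, Pi.single (g i) 1)

variable {p : ι → Fin d → ℤ} {g : ι → Fin k}

/-- The total degree on the Cayley configuration. -/
def totalDegree (d k : ℕ) : (Fin d → ℝ) × (Fin k → ℝ) →ₗ[ℝ] ℝ :=
  (∑ j, LinearMap.proj j) ∘ₗ LinearMap.snd ℝ _ _

theorem totalDegree_cayley (i : ι) : totalDegree d k ((latticeEmb d k ∘ cayley p g) i) = 1 := by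
  simp [totalDegree, cayley, Pi.single_apply]

variable [Fintype ι]

theorem sum_smul_cayley_snd (μ : ι → ℝ) (j : Fin k) :
    (∑ i, μ i • (latticeEmb d k ∘ cayley p g) i).2 j
      = ∑ i ∈ Finset.univ.filter (fun i => g i = j), μ i := by
  simp [Prod.snd_sum, Finset.sum_apply, cayley, Pi.single_apply, Finset.sum_filter, eq_comm]

theorem IsBasisOn.snd_eq {B : Finset ι} (hB : IsBasisOn (latticeEmb d k ∘ cayley p g) B)
    (x : (Fin d → ℝ) × (Fin k → ℝ)) (j : Fin k) :
    x.2 j = ∑ i ∈ B.filter (fun i => g i = j), coord (latticeEmb d k ∘ cayley p g) B x i := by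
  conv_lhs => rw [← hB.sum_coord x]
  rw [sum_smul_cayley_snd]
  refine (Finset.sum_subset (Finset.filter_subset_filter _ (Finset.subset_univ B)) ?_).symm
  intro i hi hi'
  exact hB.coord_eq_zero _ fun h => hi' (Finset.mem_filter.2 ⟨h, (Finset.mem_filter.1 hi).2⟩)

theorem finiteBoxes_cayley : FiniteBoxes (latticeEmb d k) (cayley p g) := by
  intro B hB
  refine (Set.finite_Icc
    ((fun c => -∑ i, |(cayley p g i).1 c|, fun j => -∑ i, |(cayley p g i).2 j|) :
      (Fin d → ℤ) × (Fin k → ℤ))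
    (fun c => ∑ i, |(cayley p g i).1 c|, fun j => ∑ i, |(cayley p g i).2 j|)).subset ?_
  intro w hw
  have hco : ∀ i, |coord (latticeEmb d k ∘ cayley p g) B (latticeEmb d k w) i| ≤ 1 := fun i => by
    by_cases hi : i ∈ B
    · rw [abs_of_nonneg (hw i hi).1]
      exact (hw i hi).2
    · rw [hB.coord_eq_zero _ hi]
      norm_num
  have hsum := hB.sum_coord (latticeEmb d k w)
  have h1 : ∀ c, |w.1 c| ≤ ∑ i, |(cayley p g i).1 c| := fun c => by
    have := congrFun (congrArg Prod.fst hsum) c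
    rw [latticeEmb_fst, Prod.fst_sum, Finset.sum_apply] at this
    have h : |(w.1 c : ℝ)| ≤ ∑ i, |((cayley p g i).1 c : ℝ)| := by
      rw [← this]
      refine (Finset.abs_sum_le_sum_abs _ _).trans (Finset.sum_le_sum fun i _ => ?_)
      simpa [abs_mul] using mul_le_mul_of_nonneg_right (hco i) (abs_nonneg ((cayley p g i).1 c : ℝ))
    exact_mod_cast h
  have h2 : ∀ c, |w.2 c| ≤ ∑ i, |(cayley p g i).2 c| := fun c => by
    have := congrFun (congrArg Prod.snd hsum) c
    rw [latticeEmb_snd, Prod.snd_sum, Finset.sum_apply] at this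
    have h : |(w.2 c : ℝ)| ≤ ∑ i, |((cayley p g i).2 c : ℝ)| := by
      rw [← this]
      refine (Finset.abs_sum_le_sum_abs _ _).trans (Finset.sum_le_sum fun i _ => ?_)
      simpa [abs_mul] using mul_le_mul_of_nonneg_right (hco i) (abs_nonneg ((cayley p g i).2 c : ℝ))
    exact_mod_cast h
  exact ⟨⟨fun c => (abs_le.1 (h1 c)).1, fun c => (abs_le.1 (h2 c)).1⟩,
    ⟨fun c => (abs_le.1 (h1 c)).2, fun c => (abs_le.1 (h2 c)).2⟩⟩

/-- The lattice points of the Cayley cone in a given multidegree, counted cell by cell. -/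
theorem IsGeneric.ncard_slice
    (hv : Submodule.span ℝ (Set.range (latticeEmb d k ∘ cayley p g)) = ⊤) {ω t : ι → ℝ}
    (hg : IsGeneric (latticeEmb d k ∘ cayley p g) ω t) (m : Fin k → ℕ) :
    {z : Fin d → ℤ | ∃ μ : ι → ℝ, (∀ i, 0 ≤ μ i) ∧
      ∑ i, μ i • (latticeEmb d k ∘ cayley p g) i = latticeEmb d k (z, fun j => (m j : ℤ))}.ncard
    = ∑ B ∈ Finset.univ.filter (IsCell (latticeEmb d k ∘ cayley p g) ω),
      ∑ w ∈ box (latticeEmb d k) (cayley p g) B (fun b => 0 < coord (latticeEmb d k ∘ cayley p g) B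
        (∑ i, t i • (latticeEmb d k ∘ cayley p g) i) b),
      ∏ j, (compositions (B.filter fun i => g i = j) (w.2 j) (m j)).card := by
  set φ := latticeEmb d k
  set u := cayley p g
  set q := ∑ i, t i • (φ ∘ u) i
  let c : Finset ι → ι → Prop := fun B b => 0 < coord (φ ∘ u) B q b
  let S : Finset (Σ _ : Finset ι, ((Fin d → ℤ) × (Fin k → ℤ)) × (Fin k → ι → ℕ)) :=
    (Finset.univ.filter (IsCell (φ ∘ u) ω)).sigma fun B =>
      (box φ u B (c B)).sigma (fun w => Fintype.piFinset fun j =>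
        compositions (B.filter fun i => g i = j) (w.2 j) (m j)) |>.map
          (Equiv.sigmaEquivProd _ _).toEmbedding
  let Ψ : (Σ _ : Finset ι, ((Fin d → ℤ) × (Fin k → ℤ)) × (Fin k → ι → ℕ)) →
      (Fin d → ℤ) × (Fin k → ℤ) := fun x =>
    x.2.1 + ∑ i ∈ x.1, (x.2.2 (g i) i : ℤ) • u i
  have hfin : FiniteBoxes φ u := finiteBoxes_cayley
  have hS : ∀ x, x ∈ S ↔ IsCell (φ ∘ u) ω x.1 ∧ IsBox φ u x.1 (c x.1) x.2.1 ∧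
      ∀ j, ∑ i ∈ x.1.filter (fun i => g i = j), (x.2.2 j i : ℤ) + x.2.1.2 j = m j ∧
        ∀ i ∉ x.1.filter (fun i => g i = j), x.2.2 j i = 0 := by
    rintro ⟨B, w, F⟩
    simp only [S, Finset.mem_sigma, Finset.mem_filter, Finset.mem_univ, true_and,
      Finset.mem_map_equiv, Equiv.sigmaEquivProd_symm_apply, Fintype.mem_piFinset,
      mem_compositions]
    refine and_congr_right fun hB => and_congr_left fun _ => hfin.mem_box hB.1
  have hsnd : ∀ (B : Finset ι) (w : (Fin d → ℤ) × (Fin k → ℤ)) (N : ι → ℤ) (j : Fin k),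
      (w + ∑ i ∈ B, N i • u i).2 j = ∑ i ∈ B.filter (fun i => g i = j), N i + w.2 j := by
    intro B w N j
    simp [Prod.snd_sum, Finset.sum_apply, u, cayley, Pi.single_apply, Finset.sum_filter, eq_comm,
      add_comm]
  have hΨdeg : ∀ x ∈ S, (Ψ x).2 = fun j => (m j : ℤ) := by
    intro x hx
    funext j
    rw [hsnd, ← (((hS x).1 hx).2.2 j).1]
    congr 1
    refine Finset.sum_congr rfl fun i hi => ?_
    rw [(Finset.mem_filter.1 hi).2]
  have hround : ∀ x ∈ S, ∀ b ∈ x.1,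
      roundDown (c x.1 b) (coord (φ ∘ u) x.1 (φ (Ψ x)) b) = x.2.2 (g b) b := by
    intro x hx b hb
    obtain ⟨hB, hbox, -⟩ := (hS x).1 hx
    rw [coord_add_sum_smul hB.1 _ (fun i => (x.2.2 (g i) i : ℤ)) hb, roundDown_add_intCast,
      hbox b hb, zero_add]
  have hlex : ∀ x ∈ S, LexPos (φ ∘ u) q x.1 (φ (Ψ x)) := by
    intro x hx b hb
    rw [← roundDown_nonneg_iff]
    have := hround x hx b hb
    simp only [c] at this
    rw [this]
    positivity
  have hinj : Set.InjOn (fun x => (Ψ x).1) (S : Set _) := by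
    intro x hx y hy hxy
    have hΨ : Ψ x = Ψ y := Prod.ext hxy (by rw [hΨdeg x hx, hΨdeg y hy])
    obtain ⟨hBx, hbx, hFx⟩ := (hS x).1 hx
    obtain ⟨hBy, hby, hFy⟩ := (hS y).1 hy
    have hB : x.1 = y.1 := hBx.eq_of_lexPos hBy (hlex x hx) (hΨ ▸ hlex y hy)
    have hrx := hround x hx
    have hry := hround y hy
    have hwx := (boxRep_add_sum_smul (c := c x.1) hBx.1 x.2.1
      (fun i => (x.2.2 (g i) i : ℤ))).trans hbx.boxRep_eq
    have hwy := (boxRep_add_sum_smul (c := c y.1) hBy.1 y.2.1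
      (fun i => (y.2.2 (g i) i : ℤ))).trans hby.boxRep_eq
    change boxRep φ u x.1 (c x.1) (Ψ x) = _ at hwx
    change boxRep φ u y.1 (c y.1) (Ψ y) = _ at hwy
    obtain ⟨B, w, F⟩ := x
    obtain ⟨B', w', F'⟩ := y
    dsimp only at hB hrx hry hwx hwy hFx hFy
    subst hB
    rw [← hΨ, hwx] at hwy
    subst hwy
    have hF : F = F' := by
      funext j i
      by_cases hi : i ∈ B.filter fun i => g i = j
      · obtain ⟨hiB, rfl⟩ := Finset.mem_filter.1 hi
        have := hrx i hiB
        rw [hΨ, hry i hiB] at this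
        exact_mod_cast this.symm
      · rw [(hFx j).2 i hi, (hFy j).2 i hi]
    rw [hF]
  have himage : {z : Fin d → ℤ | ∃ μ : ι → ℝ, (∀ i, 0 ≤ μ i) ∧
      ∑ i, μ i • (φ ∘ u) i = φ (z, fun j => (m j : ℤ))} = S.image fun x => (Ψ x).1 := by
    ext z
    simp only [Set.mem_ofPred_eq, Finset.coe_image, Set.mem_image, Finset.mem_coe]
    constructor
    · rintro ⟨μ, hμ, hz⟩
      obtain ⟨B, hB, hx⟩ := hg.exists_lexPos hv totalDegree_cayley hμ
      rw [hz] at hx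
      set y : (Fin d → ℤ) × (Fin k → ℤ) := (z, fun j => (m j : ℤ)) with hy
      let N : ι → ℤ := fun i => roundDown (c B i) (coord (φ ∘ u) B (φ y) i)
      have hN : ∀ i ∈ B, ((N i).toNat : ℤ) = N i := fun i hi =>
        Int.toNat_of_nonneg (roundDown_nonneg_iff.2 (hx i hi))
      have hyN : boxRep φ u B (c B) y + ∑ i ∈ B, N i • u i = y := sub_add_cancel _ _
      refine ⟨⟨B, boxRep φ u B (c B) y,
        fun j i => if i ∈ B ∧ g i = j then (N i).toNat else 0⟩, (hS _).2 ⟨hB, isBox_boxRep hB.1 _,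
        fun j => ⟨?_, fun i hi => if_neg fun h => hi (Finset.mem_filter.2 h)⟩⟩, ?_⟩
      · have h := hsnd B (boxRep φ u B (c B) y) N j
        rw [hyN] at h
        rw [show (m j : ℤ) = y.2 j from rfl, h]
        dsimp only
        congr 1
        refine Finset.sum_congr rfl fun i hi => ?_
        rw [if_pos (Finset.mem_filter.1 hi), hN i (Finset.mem_filter.1 hi).1]
      · refine Eq.trans ?_ (congrArg Prod.fst hyN)
        refine congrArg (fun s => (boxRep φ u B (c B) y + s).1) (Finset.sum_congr rfl fun i hi => ?_)
        dsimp only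
        rw [if_pos ⟨hi, rfl⟩, hN i hi]
    · rintro ⟨x, hx, rfl⟩
      have hB := ((hS x).1 hx).1.1
      refine ⟨coord (φ ∘ u) x.1 (φ (Ψ x)), fun i => ?_, ?_⟩
      · by_cases hi : i ∈ x.1
        · exact (hlex x hx i hi).1
        · rw [hB.coord_eq_zero _ hi]
      · rw [hB.sum_coord, ← hΨdeg x hx]
  rw [himage, Set.ncard_coe_finset, Finset.card_image_of_injOn hinj]
  simp only [S, Finset.card_sigma, Finset.card_map, Fintype.card_piFinset]
  rfl

end Cayley

theorem exists_eq_three_of_sum_eq {k : ℕ} {s : Fin k → ℕ} (hs : ∀ j, 2 ≤ s j)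
    (hsum : ∑ j, s j = 2 * k + 1) : ∃ i, s i = 3 ∧ ∀ j ≠ i, s j = 2 := by
  obtain ⟨r, hr⟩ : ∃ r : Fin k → ℕ, ∀ j, s j = r j + 2 :=
    ⟨fun j => s j - 2, fun j => (Nat.sub_add_cancel (hs j)).symm⟩
  have h1 : ∑ j, r j = 1 := by
    simp only [hr, Finset.sum_add_distrib, Finset.sum_const, Finset.card_univ, Fintype.card_fin,
      smul_eq_mul] at hsum
    omega
  obtain ⟨i, -, hi⟩ : ∃ i ∈ Finset.univ, r i ≠ 0 :=
    Finset.exists_ne_zero_of_sum_ne_zero (by rw [h1]; exact one_ne_zero)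
  have h2 := Finset.add_sum_erase Finset.univ r (Finset.mem_univ i)
  have h3 : ∑ j ∈ Finset.univ.erase i, r j = 0 := by omega
  refine ⟨i, by rw [hr]; omega, fun j hj => ?_⟩
  rw [hr, Finset.sum_eq_zero_iff.1 h3 j (Finset.mem_erase.2 ⟨hj, Finset.mem_univ j⟩)]

theorem sum_neg_one_pow_mul_prod {k : ℕ} (F : Fin k → ℕ → ℝ) (n : ℕ) :
    ∑ J : Finset (Fin k), (-1) ^ (k - J.card) * ∏ j, F j (if j ∈ J then n else 0)
      = ∏ j, (F j n - F j 0) := by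
  simp only [sub_eq_add_neg, Fintype.prod_add]
  refine Finset.sum_congr rfl fun J _ => ?_
  rw [← Finset.prod_mul_prod_compl J, Finset.prod_neg, Finset.card_compl, Fintype.card_fin,
    Finset.prod_congr rfl fun j hj => by rw [if_pos hj],
    Finset.prod_congr (s₁ := Jᶜ) rfl fun j hj => by rw [if_neg (Finset.mem_compl.1 hj)]]
  ring

theorem sum_neg_one_pow_mul_sum_prod {k : ℕ} {β γ ι : Type*} (S : Finset β) (bx : β → Finset γ)
    (T : β → Finset ι) (F : β → γ → Fin k → ℕ → ℕ) (α : β → ℝ) (c : β → γ → ι → ℝ) (n : ℕ)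
    (h : ∀ B ∈ S, ∀ w ∈ bx B, ∏ j, ((F B w j n : ℝ) - F B w j 0)
      = n ^ k * (n * α B + 1 / 2 * ∑ a ∈ T B, c B w a)) :
    ∑ J : Finset (Fin k), (-1) ^ (k - J.card) *
      ((∑ B ∈ S, ∑ w ∈ bx B, ∏ j, F B w j (if j ∈ J then n else 0) : ℕ) : ℝ)
    = (∑ B ∈ S, ∑ _w ∈ bx B, α B) * n ^ (k + 1)
      + (1 / 2 * ∑ B ∈ S, ∑ a ∈ T B, ∑ w ∈ bx B, c B w a) * n ^ k := by
  simp only [Nat.cast_sum, Nat.cast_prod, Finset.mul_sum]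
  rw [Finset.sum_comm, Finset.sum_congr rfl fun B hB => Finset.sum_comm.trans
    (Finset.sum_congr rfl fun w hw => (sum_neg_one_pow_mul_prod (fun j m =>
      (F B w j m : ℝ)) n).trans (h B hB w hw))]
  simp only [Finset.sum_mul, ← Finset.sum_add_distrib]
  refine Finset.sum_congr rfl fun B hB => ?_
  rw [Finset.sum_comm (s := T B), ← Finset.sum_add_distrib]
  refine Finset.sum_congr rfl fun w hw => ?_
  rw [← Finset.sum_mul, ← Finset.mul_sum]
  ring

section CellContribution

variable {d k : ℕ} {ι : Type*} {p : ι → Fin d → ℤ} {g : ι → Fin k}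

/-- A set of two lattice points from each colour class. -/
def IsBalanced (g : ι → Fin k) (W : Finset ι) : Prop :=
  ∀ j, (W.filter fun i => g i = j).card = 2

theorem isBalanced_erase_iff {B : Finset ι} {a : ι} (ha : a ∈ B) :
    IsBalanced g (B.erase a) ↔
      ∀ j, (B.filter fun i => g i = j).card = 2 + if g a = j then 1 else 0 := by
  refine forall_congr' fun j => ?_
  rw [Finset.filter_erase]
  split_ifs with h
  · have hmem : a ∈ B.filter fun i => g i = j := Finset.mem_filter.2 ⟨ha, h⟩
    have := Finset.card_erase_add_one hmem
    omega
  · rw [Finset.erase_eq_of_notMem (by simp [h]), add_zero]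

theorem IsBasisOn.sum_card (hkd : k + 1 = d) {B : Finset ι}
    (hB : IsBasisOn (latticeEmb d k ∘ cayley p g) B) :
    ∑ j, (B.filter fun i => g i = j).card = 2 * k + 1 := by
  rw [← Finset.card_eq_sum_card_fiberwise (fun i _ => Finset.mem_coe.2 (Finset.mem_univ (g i))),
    hB.card_eq]
  simp
  omega

variable [Fintype ι]

/-- The second difference contributed by a single lattice point of a half-open cell. -/
theorem IsBasisOn.prod_card_compositions_sub (hkd : k + 1 = d) {B : Finset ι}
    (hB : IsBasisOn (latticeEmb d k ∘ cayley p g) B) {q : (Fin d → ℝ) × (Fin k → ℝ)}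
    (hq : ∀ j, 0 < q.2 j) {w : (Fin d → ℤ) × (Fin k → ℤ)}
    (hw : IsBox (latticeEmb d k) (cayley p g) B
      (fun b => 0 < coord (latticeEmb d k ∘ cayley p g) B q b) w) (n : ℕ) :
    ∏ j, (((compositions (B.filter fun i => g i = j) (w.2 j) n).card : ℝ)
      - (compositions (B.filter fun i => g i = j) (w.2 j) 0).card)
    = n ^ k * (n * (if (B.filter fun a => IsBalanced g (B.erase a)).Nonempty then 1 / 2 else 0)
      + 1 / 2 * ∑ a ∈ B.filter fun a => IsBalanced g (B.erase a),
        (1 - 2 * coord (latticeEmb d k ∘ cayley p g) B (latticeEmb d k w) a)) := by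
  have hbox : ∀ b ∈ B, _ := fun b hb => roundDown_eq_zero_iff.1 (hw b hb)
  have hsnd : ∀ j, (w.2 j : ℝ) = _ := fun j => hB.snd_eq (latticeEmb d k w) j
  have hpos : ∀ j, ∃ b ∈ B.filter fun i => g i = j,
      0 < coord (latticeEmb d k ∘ cayley p g) B q b := fun j =>
    Finset.exists_lt_of_sum_lt (f := fun _ => (0 : ℝ)) (by
      rw [Finset.sum_const_zero, ← hB.snd_eq q j]
      exact hq j)
  have he0 : ∀ j, 0 ≤ w.2 j := fun j => by
    have : (0 : ℝ) ≤ w.2 j := by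
      rw [hsnd]
      exact Finset.sum_nonneg fun b hb => (hbox b (Finset.mem_filter.1 hb).1).1
    exact_mod_cast this
  have he1 : ∀ j, w.2 j < (B.filter fun i => g i = j).card := fun j => by
    have : (w.2 j : ℝ) < (B.filter fun i => g i = j).card := by
      rw [hsnd, Finset.card_eq_sum_ones, Nat.cast_sum]
      obtain ⟨b, hb, hb0⟩ := hpos j
      refine Finset.sum_lt_sum (fun b hb => ?_) ⟨b, hb, ?_⟩
      · simpa using (hbox b (Finset.mem_filter.1 hb).1).2.1
      · have := hbox b (Finset.mem_filter.1 hb).1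
        simpa using lt_of_le_of_ne this.2.1 (this.2.2.1 hb0)
    exact_mod_cast this
  by_cases h1 : ∃ j, (B.filter fun i => g i = j).card = 1
  · obtain ⟨j, hj⟩ := h1
    have hempty : (B.filter fun a => IsBalanced g (B.erase a)) = ∅ := by
      refine Finset.filter_eq_empty_iff.2 fun a ha h => ?_
      have := (isBalanced_erase_iff ha).1 h j
      omega
    have hj0 : w.2 j = 0 := by
      have h0 := he0 j
      have h1 := he1 j
      rw [hj] at h1
      omega
    rw [hempty, Finset.prod_eq_zero (Finset.mem_univ j)]
    · simp
    · rw [hj0, card_compositions_sub_of_card_eq_one hj]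
  · push Not at h1
    obtain ⟨i, hi, hj⟩ := exists_eq_three_of_sum_eq (fun j => by
      have h0 : 0 < (B.filter fun i => g i = j).card :=
        Finset.card_pos.2 ((hpos j).imp fun b hb => hb.1)
      have := h1 j
      omega) (hB.sum_card hkd)
    have hfilter : (B.filter fun a => IsBalanced g (B.erase a)) = B.filter fun a => g a = i := by
      refine Finset.filter_congr fun a ha => ?_
      rw [isBalanced_erase_iff ha]
      constructor
      · intro h
        by_contra hne
        have := h i
        rw [if_neg hne] at this
        omega
      · rintro rfl j
        split_ifs with h
        · rw [← h, hi]
        · rw [hj j (Ne.symm h)]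
    have hne : (B.filter fun a => g a = i).Nonempty := Finset.card_pos.1 (by omega)
    rw [hfilter, if_pos hne, Finset.sum_sub_distrib, ← Finset.mul_sum, ← hsnd i, Finset.sum_const,
      hi, ← Finset.mul_prod_erase Finset.univ _ (Finset.mem_univ i),
      card_compositions_sub_of_card_eq_three hi (he0 i) (by simpa [hi] using he1 i),
      Finset.prod_congr rfl fun j hj' => card_compositions_sub_of_card_eq_two
        (hj j (Finset.ne_of_mem_erase hj')) (he0 j)
        (by simpa [hj j (Finset.ne_of_mem_erase hj')] using he1 j) n,
      Finset.prod_const, Finset.card_erase_of_mem (Finset.mem_univ i), Finset.card_univ,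
      Fintype.card_fin, ← mul_pow_sub_one (Fin.pos i).ne' (n : ℝ)]
    simp
    ring

/-- The alternating sum of the sizes of the slices of the Cayley cone. -/
theorem exists_alternating_sum_ncard_slice (hkd : k + 1 = d) (hgs : Function.Surjective g)
    (hv : Submodule.span ℝ (Set.range (latticeEmb d k ∘ cayley p g)) = ⊤) :
    ∃ A C : ℝ, 0 ≤ A ∧ 0 ≤ C ∧ ∀ n : ℕ, ∑ J : Finset (Fin k), (-1) ^ (k - J.card) *
      ({z : Fin d → ℤ | ∃ μ : ι → ℝ, (∀ i, 0 ≤ μ i) ∧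
        ∑ i, μ i • (latticeEmb d k ∘ cayley p g) i = latticeEmb d k
          (z, fun j => ((if j ∈ J then n else 0 : ℕ) : ℤ))}.ncard : ℝ)
      = A * n ^ (k + 1) + C * n ^ k := by
  obtain ⟨ω, t, hg⟩ := exists_isGeneric (latticeEmb d k ∘ cayley p g)
  have hfin : FiniteBoxes (latticeEmb d k) (cayley p g) := finiteBoxes_cayley
  have hC := hg.sum_facets_nonneg hv totalDegree_cayley hfin (IsBalanced g)
  have hslice := fun m => hg.ncard_slice hv m
  have hq : ∀ j, 0 < (∑ i, t i • (latticeEmb d k ∘ cayley p g) i).2 j := fun j => by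
    rw [sum_smul_cayley_snd]
    obtain ⟨i, hi⟩ := hgs j
    exact Finset.sum_pos (fun i _ => hg.pos i) ⟨i, by simp [hi]⟩
  let S : Finset (Finset ι) := Finset.univ.filter (IsCell (latticeEmb d k ∘ cayley p g) ω)
  let bx : Finset ι → Finset ((Fin d → ℤ) × (Fin k → ℤ)) := fun B =>
    box (latticeEmb d k) (cayley p g) B (fun b => 0 < coord (latticeEmb d k ∘ cayley p g) B
      (∑ i, t i • (latticeEmb d k ∘ cayley p g) i) b)
  let T : Finset ι → Finset ι := fun B => B.filter fun a => IsBalanced g (B.erase a)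
  have hsum := fun n => sum_neg_one_pow_mul_sum_prod S bx T
    (fun B w j m => (compositions (B.filter fun i => g i = j) (w.2 j) m).card)
    (fun B => if (T B).Nonempty then 1 / 2 else 0)
    (fun B w a => 1 - 2 * coord (latticeEmb d k ∘ cayley p g) B (latticeEmb d k w) a) n
    fun B hB w hw => ((Finset.mem_filter.1 hB).2.1).prod_card_compositions_sub hkd hq
        ((hfin.mem_box (Finset.mem_filter.1 hB).2.1).1 hw) n
  refine ⟨_, _, ?_, ?_, fun n => Eq.trans (Finset.sum_congr rfl fun J _ => ?_) (hsum n)⟩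
  · exact Finset.sum_nonneg fun B _ => Finset.sum_nonneg fun w _ => by split_ifs <;> norm_num
  · exact mul_nonneg (by norm_num) hC
  · rw [hslice]

end CellContribution

section Polytopes

variable {d k : ℕ}

theorem mem_smul_convexHull_iff {V : Finset (Fin d → ℤ)} (hV : V.Nonempty) (n : ℕ)
    (x : Fin d → ℝ) :
    x ∈ (n : ℝ) • convexHull ℝ ((fun z : Fin d → ℤ => fun i => (z i : ℝ)) '' ↑V) ↔
      ∃ μ : V → ℝ, (∀ y, 0 ≤ μ y) ∧ ∑ y, μ y = n ∧
        ∑ y, μ y • (fun i => (y.1 i : ℝ)) = x := by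
  have hinj : Function.Injective (fun z : Fin d → ℤ => fun i => (z i : ℝ)) := fun a b h =>
    funext fun i => Int.cast_injective (congrFun h i)
  constructor
  · intro hx
    obtain ⟨y, hy, rfl⟩ := Set.mem_smul_set.1 hx
    rw [← Finset.coe_image, Finset.mem_convexHull'] at hy
    obtain ⟨w, hw0, hw1, rfl⟩ := hy
    refine ⟨fun y => n * w (fun i => (y.1 i : ℝ)), fun y => mul_nonneg n.cast_nonneg
      (hw0 _ (Finset.mem_image_of_mem _ y.2)), ?_, ?_⟩
    · rw [← Finset.mul_sum, Finset.sum_coe_sort V (fun y => w fun i => (y i : ℝ)),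
        ← Finset.sum_image (g := fun z : Fin d → ℤ => fun i => (z i : ℝ)) hinj.injOn, hw1, mul_one]
    · simp only [mul_smul]
      rw [← Finset.smul_sum,
        Finset.sum_coe_sort V (fun y => w (fun i => (y i : ℝ)) • fun i => (y i : ℝ)),
        ← Finset.sum_image (f := fun y => w y • y) hinj.injOn]
  · rintro ⟨μ, hμ, hsum, rfl⟩
    rcases n.eq_zero_or_pos with rfl | hn
    · have h0 : ∀ y, μ y = 0 := fun y => by
        rw [Nat.cast_zero] at hsum
        exact (Finset.sum_eq_zero_iff_of_nonneg fun y _ => hμ y).1 hsum y (Finset.mem_univ y)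
      rw [Nat.cast_zero, Set.zero_smul_set (hV.to_set.image _ |>.convexHull)]
      simp [h0]
    · have hn' : (n : ℝ) ≠ 0 := by positivity
      refine Set.mem_smul_set.2 ⟨∑ y, ((n : ℝ)⁻¹ * μ y) • (fun i => (y.1 i : ℝ)), ?_, ?_⟩
      · exact mem_convexHull_of_exists_fintype (fun y => (n : ℝ)⁻¹ * μ y) _
          (fun y => mul_nonneg (by positivity) (hμ y))
          (by rw [← Finset.mul_sum, hsum, inv_mul_cancel₀ hn'])
          (fun y => Set.mem_image_of_mem _ y.2) rfl
      · simp only [mul_smul]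
        rw [← Finset.smul_sum, smul_inv_smul₀ hn']

variable (V : Fin k → Finset (Fin d → ℤ))

/-- All the given lattice points of a family of polytopes. -/
def allPoints (x : Σ j, V j) : Fin d → ℤ := x.2.1

variable {V}

theorem mem_sum_smul_iff (hV : ∀ j, (V j).Nonempty) (J : Finset (Fin k)) (n : ℕ)
    (z : Fin d → ℤ) :
    (fun i => (z i : ℝ)) ∈ ∑ j ∈ J,
      (n : ℝ) • convexHull ℝ ((fun z : Fin d → ℤ => fun i => (z i : ℝ)) '' ↑(V j)) ↔
    ∃ μ : (Σ j, V j) → ℝ, (∀ i, 0 ≤ μ i) ∧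
      ∑ i, μ i • (latticeEmb d k ∘ cayley (allPoints V) Sigma.fst) i
        = latticeEmb d k (z, fun j => ((if j ∈ J then n else 0 : ℕ) : ℤ)) := by
  set P : Fin k → Set (Fin d → ℝ) := fun j =>
    convexHull ℝ ((fun z : Fin d → ℤ => fun i => (z i : ℝ)) '' ↑(V j)) with hP
  have hJ : ∑ j ∈ J, (n : ℝ) • P j = ∑ j, ((if j ∈ J then n else 0 : ℕ) : ℝ) • P j := by
    rw [← Finset.sum_filter_add_sum_filter_not Finset.univ (· ∈ J)]
    rw [Finset.sum_eq_zero (s := Finset.univ.filter (· ∉ J)), add_zero]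
    · simp only [Finset.filter_univ_mem]
      exact Finset.sum_congr rfl fun j hj => by rw [if_pos hj]
    · intro j hj
      rw [if_neg (Finset.mem_filter.1 hj).2, Nat.cast_zero,
        Set.zero_smul_set ((hV j).to_set.image _ |>.convexHull)]
  rw [hJ, Set.mem_finsetSum]
  have hmem := fun j x => mem_smul_convexHull_iff (hV j) (if j ∈ J then n else 0) x
  have hfst : ∀ μ : (Σ j, V j) → ℝ,
      (∑ i, μ i • (latticeEmb d k ∘ cayley (allPoints V) Sigma.fst) i).1
        = ∑ j, ∑ y, μ ⟨j, y⟩ • fun i => (y.1 i : ℝ) := fun μ => by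
    rw [Prod.fst_sum, Fintype.sum_sigma]
    rfl
  have hsnd : ∀ (μ : (Σ j, V j) → ℝ) j,
      (∑ i, μ i • (latticeEmb d k ∘ cayley (allPoints V) Sigma.fst) i).2 j
        = ∑ y, μ ⟨j, y⟩ := fun μ j => by
    rw [sum_smul_cayley_snd, Finset.sum_filter, Fintype.sum_sigma,
      Finset.sum_eq_single j (fun i _ hi => by simp [hi]) (by simp)]
    simp
  constructor
  · rintro ⟨x, hx, hxz⟩
    choose μ hμ0 hμ1 hμx using fun j => (hmem j (x j)).1 (hx (Finset.mem_univ j))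
    refine ⟨fun i => μ i.1 i.2, fun i => hμ0 _ _, Prod.ext ?_ (funext fun j => ?_)⟩
    · rw [hfst]
      simp only [hμx]
      rw [hxz]
      rfl
    · rw [hsnd, latticeEmb_snd, hμ1]
      simp
  · rintro ⟨μ, hμ0, hμ⟩
    refine ⟨fun j => ∑ y, μ ⟨j, y⟩ • fun i => (y.1 i : ℝ), fun {j} _ =>
      (hmem j _).2 ⟨fun y => μ ⟨j, y⟩, fun y => hμ0 _, ?_, rfl⟩, ?_⟩
    · rw [← hsnd, hμ, latticeEmb_snd]
      simp
    · rw [← hfst, hμ]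
      rfl

theorem span_cayley_eq_top (hV : ∀ j, (V j).Nonempty)
    (hdim : ∃ j, polytopeDim
      (convexHull ℝ ((fun z : Fin d → ℤ => fun i => (z i : ℝ)) '' ↑(V j))) = d) :
    Submodule.span ℝ (Set.range (latticeEmb d k ∘ cayley (allPoints V) Sigma.fst)) = ⊤ := by
  set S := Submodule.span ℝ (Set.range (latticeEmb d k ∘ cayley (allPoints V) Sigma.fst))
  have hmem : ∀ i, (latticeEmb d k ∘ cayley (allPoints V) Sigma.fst) i ∈ S := fun i =>
    Submodule.subset_span ⟨i, rfl⟩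
  obtain ⟨j₀, hj₀⟩ := hdim
  rw [polytopeDim, affineSpan_convexHull, direction_affineSpan] at hj₀
  have htop := Submodule.eq_top_of_finrank_eq (hj₀.trans (Module.finrank_fin_fun ℝ).symm)
  have hfst : ∀ x : Fin d → ℝ, (x, (0 : Fin k → ℝ)) ∈ S := by
    have h : (⊤ : Submodule ℝ (Fin d → ℝ)) ≤ S.comap (LinearMap.inl ℝ _ _) := by
      rw [← htop, vectorSpan_def, Submodule.span_le]
      rintro _ ⟨_, ⟨a, ha, rfl⟩, _, ⟨b, hb, rfl⟩, rfl⟩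
      have := S.sub_mem (hmem ⟨j₀, a, ha⟩) (hmem ⟨j₀, b, hb⟩)
      rw [SetLike.mem_coe, Submodule.mem_comap]
      convert this using 1
      refine Prod.ext rfl ?_
      simp [cayley, latticeEmb]
    exact fun x => h (Submodule.mem_top (x := x))
  have hsnd : ∀ j, ((0 : Fin d → ℝ), Pi.single j (1 : ℝ)) ∈ S := fun j => by
    obtain ⟨a, ha⟩ := hV j
    have := S.sub_mem (hmem ⟨j, a, ha⟩) (hfst fun i => (a i : ℝ))
    convert this using 1
    refine Prod.ext (by ext; simp [cayley, allPoints]) ?_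
    ext i
    simp [cayley, Pi.single_apply]
  refine (Submodule.eq_top_iff').2 fun x => ?_
  have hx : x = (x.1, 0) + ∑ j, x.2 j • ((0 : Fin d → ℝ), Pi.single j (1 : ℝ)) := by
    refine Prod.ext ?_ ?_
    · simp [Prod.fst_sum]
    · ext j
      simp [Prod.snd_sum, Finset.sum_apply, Pi.single_apply]
  rw [hx]
  exact S.add_mem (hfst _) (S.sum_mem fun j _ => S.smul_mem _ (hsnd j))

/-- The discrete mixed volume of the dilates of `d - 1` full-dimensional lattice polytopes. -/
theorem exists_DMV_smul_eq (hkd : k + 1 = d) (P : Fin k → Set (Fin d → ℝ))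
    (hP : ∀ i, IsLatticePolytope (P i)) (hPdim : ∀ i, polytopeDim (P i) = d) :
    ∃ A C : ℝ, 0 ≤ A ∧ 0 ≤ C ∧
      ∀ n : ℕ, (DMV (fun i => (n : ℝ) • P i) : ℝ) = A * n ^ (k + 1) + C * n ^ k := by
  choose V hV hPV using hP
  obtain rfl : P = _ := funext hPV
  rcases k.eq_zero_or_pos with rfl | hk
  · refine ⟨0, 1, le_rfl, zero_le_one, fun n => ?_⟩
    have h : {z : Fin d → ℤ | (fun i => (z i : ℝ)) ∈ (0 : Set (Fin d → ℝ))} = {0} := by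
      ext z
      simp [funext_iff]
    simp [DMV, latticePointCount, Finset.univ_unique,
      Subsingleton.elim (default : Finset (Fin 0)) ∅]
    exact ⟨0, h⟩
  · obtain ⟨A, C, hA, hC, h⟩ := exists_alternating_sum_ncard_slice hkd
      (p := allPoints V) (g := Sigma.fst) (fun j => ⟨⟨j, _, (hV j).choose_spec⟩, rfl⟩)
      (span_cayley_eq_top hV ⟨⟨0, hk⟩, hPdim _⟩)
    refine ⟨A, C, hA, hC, fun n => (Eq.trans ?_ (h n))⟩
    simp only [DMV, latticePointCount, mem_sum_smul_iff hV]
    push_cast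
    rfl

end Polytopes

end MixedEhrhart

/-- **Non-negativity of the mixed Ehrhart polynomial for `k = d - 1`.**
For a collection of `k = d - 1` full-dimensional lattice polytopes in `ℝ^d`, the mixed
Ehrhart polynomial has the form `me_d n^d + me_{d-1} n^{d-1}` with `me_d, me_{d-1} ≥ 0`;
in particular it is non-negative at every integer `n ≥ 0`. -/
theorem mixed_ehrhart_nonneg_of_k_eq_d_sub_one
    {d k : ℕ} (hkd : k + 1 = d) (P : Fin k → Set (Fin d → ℝ))
    (hP : ∀ i, IsLatticePolytope (P i))
    (hPdim : ∀ i, polytopeDim (P i) = d)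
    (M : Polynomial ℝ) (hMdeg : M.natDegree ≤ d)
    (hM : ∀ n : ℕ, M.eval (n : ℝ) = (DMV (fun i => (n : ℝ) • P i) : ℝ)) :
    (∀ i : ℕ, i ≠ d → i ≠ d - 1 → M.coeff i = 0) ∧
    0 ≤ M.coeff d ∧ 0 ≤ M.coeff (d - 1) ∧
    ∀ n : ℕ, 0 ≤ M.eval (n : ℝ) := by
  obtain ⟨A, C, hA, hC, h⟩ := MixedEhrhart.exists_DMV_smul_eq hkd P hP hPdim
  have hMeq : M = Polynomial.C A * Polynomial.X ^ (k + 1) + Polynomial.C C * Polynomial.X ^ k := by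
    refine Polynomial.eq_of_infinite_eval_eq _ _
      (Set.infinite_of_injective_forall_mem (f := fun n : ℕ => (n : ℝ)) Nat.cast_injective
        fun n => ?_)
    rw [Set.mem_ofPred_eq, hM, h]
    simp
  subst hkd
  rw [Nat.add_sub_cancel]
  refine ⟨fun i h1 h2 => ?_, ?_, ?_, fun n => ?_⟩
  · simp [hMeq, Polynomial.coeff_X_pow, h1, h2]
  · simpa [hMeq, Polynomial.coeff_X_pow] using hA
  · simpa [hMeq, Polynomial.coeff_X_pow] using hC
  · rw [hM, h]
    positivity
end

section
/- Let P ⊆ ℝ^d be a d-dimensional lattice polytope and let k ≥ 1. Then the discrete mixed volume of k copies of P is non-negative: DMV(P,…,P) ≥ 0, and more generally ME_{(P,…,P)}(n) ≥ 0 for all integers n ≥ 0. -/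
open Pointwise MeasureTheory Filter
open scoped Classical

namespace DiscreteMixedVolume

open Finset Module

section Ratio

variable {ι E : Type*} [AddCommGroup E] [Module ℝ E]

/-- The ratio test of the simplex method. -/
lemma exists_ratio_test {S : Finset ι} (a g : ι → ℝ) (hg : ∃ i ∈ S, 0 < g i) :
    ∃ i₀ ∈ S, 0 < g i₀ ∧ ((∀ i ∈ S, 0 ≤ a i) → ∀ i ∈ S, 0 ≤ a i - a i₀ / g i₀ * g i) := by
  obtain ⟨i₀, hi₀, hmin⟩ := (S.filter fun i => 0 < g i).exists_min_image (fun i => a i / g i)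
    (by obtain ⟨i, hi, hi'⟩ := hg; exact ⟨i, by simp [hi, hi']⟩)
  simp only [mem_filter, and_imp] at hi₀ hmin
  refine ⟨i₀, hi₀.1, hi₀.2, fun ha i hi => ?_⟩
  have hr : 0 ≤ a i₀ / g i₀ := div_nonneg (ha i₀ hi₀.1) hi₀.2.le
  rcases lt_or_ge 0 (g i) with h | h
  · have := hmin i hi h
    rw [le_div_iff₀ h] at this
    linarith
  · nlinarith [ha i hi, mul_nonneg hr (neg_nonneg.2 h)]

/-- Carathéodory's theorem for cones generated by vectors of height one. -/
lemma exists_linearIndepOn_conic_combination [Fintype ι] {v : ι → E} (ht : E →ₗ[ℝ] ℝ)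
    (hv : ∀ i, ht (v i) = 1) {x : E} {a : ι → ℝ} (ha : ∀ i, 0 ≤ a i)
    (hx : ∑ i, a i • v i = x) :
    ∃ S : Finset ι, LinearIndepOn ℝ v (S : Set ι) ∧
      ∃ b : ι → ℝ, (∀ i ∈ S, 0 ≤ b i) ∧ ∑ i ∈ S, b i • v i = x := by
  obtain ⟨S, ⟨b, hb, hbx⟩, hmin⟩ := exists_minimal_of_wellFoundedLT
    (fun S : Finset ι => ∃ b : ι → ℝ, (∀ i ∈ S, 0 ≤ b i) ∧ ∑ i ∈ S, b i • v i = x)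
    ⟨univ, a, fun i _ => ha i, hx⟩
  refine ⟨S, ?_, b, hb, hbx⟩
  by_contra hdep
  rw [linearIndepOn_finset_iff] at hdep
  push Not at hdep
  obtain ⟨g, hg, i, hi, hgi⟩ := hdep
  have hsum : ∑ i ∈ S, g i = 0 := by simpa [map_sum, hv] using congrArg ht hg
  obtain ⟨i₀, hi₀, hg₀, hr⟩ :=
    exists_ratio_test b g (exists_pos_of_sum_zero_of_exists_nonzero g hsum ⟨i, hi, hgi⟩)
  have hle := hmin (y := S.erase i₀) ⟨fun i => b i - b i₀ / g i₀ * g i,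
    fun i hi => hr hb i (mem_of_mem_erase hi), ?_⟩ (erase_subset _ _)
  · exact notMem_erase i₀ S (hle hi₀)
  · rw [← sum_erase_add _ _ hi₀] at hbx hg
    have h₁ : ∑ i ∈ S.erase i₀, g i • v i = -(g i₀ • v i₀) := eq_neg_of_add_eq_zero_left hg
    simp only [sub_smul, sum_sub_distrib, mul_smul, ← smul_sum, h₁]
    rw [← hbx, smul_neg, sub_neg_eq_add, smul_smul, div_mul_cancel₀ _ hg₀.ne']

end Ratio

section Base

variable {ι E : Type*} [AddCommGroup E] [Module ℝ E]

/-- The vectors `v i`, `i ∈ B`, form a basis of the ambient space. -/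
def IsBase (v : ι → E) (B : Finset ι) : Prop :=
  LinearIndepOn ℝ v (B : Set ι) ∧ B.card = finrank ℝ E

lemma exists_isBase_superset [Fintype ι] {v : ι → E} (hspan : Submodule.span ℝ (Set.range v) = ⊤)
    {S : Finset ι} (hS : LinearIndepOn ℝ v (S : Set ι)) : ∃ B, S ⊆ B ∧ IsBase v B := by
  obtain ⟨b, -, hSb, hsp, hb⟩ := exists_linearIndepOn_extension hS (Set.subset_univ _)
  refine ⟨b.toFinset, by simpa using hSb, by simpa using hb, ?_⟩
  have htop : ⊤ ≤ Submodule.span ℝ (Set.range fun i : b => v i) := by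
    rw [← hspan, Submodule.span_le, ← Set.image_univ]
    convert hsp using 2
    rw [Set.image_eq_range]
  rw [finrank_eq_card_basis (Basis.mk hb htop), Set.toFinset_card]

variable [FiniteDimensional ℝ E]

lemma IsBase.exists_coord {v : ι → E} {B : Finset ι} (hB : IsBase v B) :
    ∃ c : E →ₗ[ℝ] ι → ℝ, ∀ x, ∑ i ∈ B, c x i • v i = x := by
  let f : (ι → ℝ) →ₗ[ℝ] E := ∑ i ∈ B, (LinearMap.proj i : (ι → ℝ) →ₗ[ℝ] ℝ).smulRight (v i)
  have hf : ∀ a, f a = ∑ i ∈ B, a i • v i := fun a => by simp [f]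
  have hspan : Submodule.span ℝ (Set.range fun i : B => v i) = ⊤ :=
    LinearIndependent.span_eq_top_of_card_eq_finrank' hB.1 (by simpa using hB.2)
  have hsurj : LinearMap.range f = ⊤ := by
    rw [eq_top_iff, ← hspan, Submodule.span_le]
    rintro _ ⟨i, rfl⟩
    refine ⟨Pi.single (i : ι) 1, ?_⟩
    rw [hf, sum_eq_single (i : ι)]
    · simp
    · intro j _ hj
      simp [hj]
    · simp
  obtain ⟨c, hc⟩ := f.exists_rightInverse_of_surjective hsurj
  exact ⟨c, fun x => by rw [← hf]; exact LinearMap.congr_fun hc x⟩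

/-- The coordinates of a vector with respect to a basis `v i`, `i ∈ B`. -/
noncomputable def coord (v : ι → E) (B : Finset ι) : E →ₗ[ℝ] ι → ℝ :=
  if h : ∃ c : E →ₗ[ℝ] ι → ℝ, ∀ x, ∑ i ∈ B, c x i • v i = x then h.choose else 0

variable {v : ι → E} {B : Finset ι}

lemma IsBase.sum_coord (hB : IsBase v B) (x : E) : ∑ i ∈ B, coord v B x i • v i = x := by
  rw [coord, dif_pos hB.exists_coord]
  exact hB.exists_coord.choose_spec x

lemma IsBase.coord_eq (hB : IsBase v B) {x : E} {a : ι → ℝ} (h : ∑ i ∈ B, a i • v i = x)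
    {i : ι} (hi : i ∈ B) : coord v B x i = a i := by
  have := linearIndepOn_finset_iff.1 hB.1 (fun i => coord v B x i - a i)
    (by simp [sub_smul, h, hB.sum_coord]) i hi
  exact sub_eq_zero.1 this

lemma IsBase.coord_self (hB : IsBase v B) {i j : ι} (hi : i ∈ B) (hj : j ∈ B) :
    coord v B (v j) i = if i = j then 1 else 0 :=
  hB.coord_eq (a := fun i => if i = j then 1 else 0) (by simp [hj]) hi

lemma IsBase.sum_coord_height (hB : IsBase v B) {ht : E →ₗ[ℝ] ℝ} (hv : ∀ i, ht (v i) = 1)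
    (x : E) : ∑ i ∈ B, coord v B x i = ht x := by
  simpa [map_sum, hv] using congrArg ht (hB.sum_coord x)

lemma IsBase.pivot (hB : IsBase v B) {i j : ι} (hi : i ∈ B) (hj : j ∉ B)
    (h : coord v B (v j) i ≠ 0) : IsBase v (insert j (B.erase i)) := by
  have hj' : j ∉ B.erase i := fun h => hj (mem_of_mem_erase h)
  refine ⟨?_, ?_⟩
  · rw [coe_insert]
    refine (hB.1.mono (coe_subset.2 (erase_subset i B))).insert fun hmem => h ?_
    obtain ⟨a, ha⟩ := (Submodule.mem_span_image_finset_iff_exists_fun ℝ).1 hmem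
    have := hB.coord_eq (x := v j)
      (a := fun k => if hk : k ∈ B.erase i then a ⟨k, hk⟩ else 0) (by
        rw [← sum_erase_add _ _ hi, ← ha, ← sum_attach]
        simp [-mem_erase, notMem_erase]) hi
    simpa using this
  · rw [card_insert_of_notMem hj', card_erase_add_one hi, hB.2]

end Base

section Cells

lemma exists_pos_sum_mul_ne_zero {ι : Type*} [Fintype ι] {F : Set (ι → ℝ)} (hF : F.Finite) :
    ∃ c : ι → ℝ, (∀ i, 0 < c i) ∧ ∀ a ∈ F, a ≠ 0 → ∑ i, a i * c i ≠ 0 := by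
  let e := Fintype.equivFin ι
  let p : (ι → ℝ) → Polynomial ℝ := fun a =>
    ∑ i, Polynomial.C (a i) * Polynomial.X ^ (e i : ℕ)
  have hp : ∀ a, a ≠ 0 → p a ≠ 0 := by
    intro a ha h
    apply ha
    funext j
    have := congrArg (fun q : Polynomial ℝ => q.coeff (e j)) h
    simpa [p, Polynomial.finsetSum_coeff, Polynomial.coeff_C_mul, Polynomial.coeff_X_pow,
      Fin.val_inj] using this
  have hfin : (⋃ a ∈ F, {t : ℝ | a ≠ 0 ∧ (p a).IsRoot t}).Finite := by
    refine hF.biUnion fun a _ => ?_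
    by_cases ha : a = 0
    · simp [ha]
    · exact (Polynomial.finite_setOfPred_isRoot (hp a ha)).subset fun t ht => ht.2
  obtain ⟨t, ht, htn⟩ := (Set.Ioi_infinite (0 : ℝ)).exists_notMem_finite hfin
  refine ⟨fun i => t ^ (e i : ℕ), fun i => pow_pos ht _, fun a ha ha0 h => htn ?_⟩
  simp only [Set.mem_iUnion]
  refine ⟨a, ha, ha0, ?_⟩
  simpa [p, Polynomial.IsRoot, Polynomial.eval_finsetSum] using h

lemma eventually_add_mul_pos_iff (a : ℝ) {b : ℝ} (hb : b ≠ 0) :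
    ∀ᶠ ε in nhdsWithin (0 : ℝ) (Set.Ioi 0),
      a + ε * b ≠ 0 ∧ (0 < a + ε * b ↔ 0 ≤ a ∧ (b < 0 → 0 < a)) := by
  have hlim : Tendsto (fun ε : ℝ => a + ε * b) (nhdsWithin 0 (Set.Ioi 0)) (nhds a) := by
    have : Continuous fun ε : ℝ => a + ε * b := by fun_prop
    simpa using (this.tendsto 0).mono_left nhdsWithin_le_nhds
  rcases lt_trichotomy a 0 with ha | rfl | ha
  · filter_upwards [hlim.eventually_lt_const ha] with ε hε
    exact ⟨hε.ne, by constructor <;> intro h <;> linarith [h]⟩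
  · filter_upwards [self_mem_nhdsWithin] with ε (hε : 0 < ε)
    rw [zero_add]
    refine ⟨mul_ne_zero hε.ne' hb, ?_⟩
    rw [mul_pos_iff_of_pos_left hε]
    simp only [le_refl, lt_irrefl, imp_false, true_and, not_lt]
    exact ⟨le_of_lt, fun h => lt_of_le_of_ne h hb.symm⟩
  · filter_upwards [hlim.eventually_const_lt ha] with ε hε
    exact ⟨hε.ne', by simp [hε, ha, ha.le]⟩

variable {ι E : Type*} [AddCommGroup E] [Module ℝ E] [FiniteDimensional ℝ E]

/-- `B` indexes a maximal cell of the regular subdivision induced by the heights `c`. -/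
def IsCell (v : ι → E) (c : ι → ℝ) (B : Finset ι) : Prop :=
  IsBase v B ∧ ∀ j ∉ B, ∑ i ∈ B, coord v B (v j) i * c i < c j

/-- The half-open simplicial cone over `B`: the facets that are visible from `w` are removed. -/
def halfOpenCone (v : ι → E) (w : E) (B : Finset ι) : Set E :=
  {x | ∀ i ∈ B, 0 ≤ coord v B x i ∧ (coord v B w i < 0 → 0 < coord v B x i)}

variable {v : ι → E}

lemma IsCell.cost_le {c : ι → ℝ} {B B' : Finset ι} (hB : IsCell v c B) (hB' : IsBase v B')
    {x : E} (hx : ∀ i ∈ B', 0 < coord v B' x i) :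
    ∑ i ∈ B, coord v B x i * c i ≤ ∑ j ∈ B', coord v B' x j * c j ∧
      (∑ i ∈ B, coord v B x i * c i = ∑ j ∈ B', coord v B' x j * c j → B' ⊆ B) := by
  have hexp : ∑ i ∈ B, coord v B x i * c i =
      ∑ j ∈ B', coord v B' x j * ∑ i ∈ B, coord v B (v j) i * c i := by
    conv_lhs => rw [← hB'.sum_coord x]
    simp only [map_sum, map_smul, Finset.sum_apply, Pi.smul_apply, smul_eq_mul, sum_mul, mul_sum]
    rw [sum_comm]
    exact sum_congr rfl fun j _ => sum_congr rfl fun i _ => by ring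
  have hle : ∀ j ∈ B', coord v B' x j * ∑ i ∈ B, coord v B (v j) i * c i ≤
      coord v B' x j * c j := by
    intro j hj
    refine mul_le_mul_of_nonneg_left ?_ (hx j hj).le
    by_cases hjB : j ∈ B
    · rw [sum_congr rfl fun i hi => by rw [hB.1.coord_self hi hjB]]
      simp [hjB]
    · exact (hB.2 j hjB).le
  refine ⟨hexp ▸ sum_le_sum hle, fun heq j hj => ?_⟩
  by_contra hjB
  have := (sum_eq_sum_iff_of_le hle).1 (hexp ▸ heq) j hj
  exact (hB.2 j hjB).ne (mul_left_cancel₀ (hx j hj).ne' this)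

variable [Fintype ι]

/-- The cone generated by the vectors `v i`. -/
def cone {ι E : Type*} [Fintype ι] [AddCommGroup E] [Module ℝ E] (v : ι → E) : Set E := {x | ∃ a : ι → ℝ, (∀ i, 0 ≤ a i) ∧ ∑ i, a i • v i = x}

lemma IsBase.mem_cone {B : Finset ι} (hB : IsBase v B) {x : E}
    (hx : ∀ i ∈ B, 0 ≤ coord v B x i) : x ∈ cone v := by
  refine ⟨fun i => if i ∈ B then coord v B x i else 0, fun i => ?_, ?_⟩
  · dsimp only
    split_ifs with h
    exacts [hx i h, le_rfl]
  · simpa [ite_smul] using hB.sum_coord x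

lemma existsUnique_isCell {ht : E →ₗ[ℝ] ℝ} (hv : ∀ i, ht (v i) = 1)
    (hspan : Submodule.span ℝ (Set.range v) = ⊤) {c : ι → ℝ}
    (hc : ∀ B, IsBase v B → ∀ j ∉ B, ∑ i ∈ B, coord v B (v j) i * c i ≠ c j)
    {x : E} (hx : x ∈ cone v) (hgen : ∀ B, IsBase v B → ∀ i ∈ B, coord v B x i ≠ 0) :
    ∃! B, IsCell v c B ∧ ∀ i ∈ B, 0 < coord v B x i := by
  have hne : (univ.filter fun B => IsBase v B ∧ ∀ i ∈ B, 0 < coord v B x i).Nonempty := by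
    obtain ⟨a, ha, hax⟩ := hx
    obtain ⟨S, hS, b, hb, hbx⟩ := exists_linearIndepOn_conic_combination ht hv ha hax
    obtain ⟨B, hSB, hB⟩ := exists_isBase_superset hspan hS
    refine ⟨B, ?_⟩
    simp only [mem_filter, mem_univ, true_and]
    refine ⟨hB, fun i hi => lt_of_le_of_ne ?_ (hgen B hB i hi).symm⟩
    rw [hB.coord_eq (a := fun i => if i ∈ S then b i else 0) ?_ hi]
    · split_ifs with h
      exacts [hb i h, le_rfl]
    · simpa [ite_smul, ← sum_filter, filter_mem_eq_inter, inter_eq_right.2 hSB] using hbx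
  obtain ⟨B, hBmem, hmin⟩ := exists_min_image _ (fun B => ∑ i ∈ B, coord v B x i * c i) hne
  simp only [mem_filter, mem_univ, true_and, and_imp] at hBmem hmin
  obtain ⟨hB, hpos⟩ := hBmem
  have hcell : IsCell v c B := by
    refine ⟨hB, fun j hj => lt_of_le_of_ne ?_ (hc B hB j hj)⟩
    by_contra! hlt
    obtain ⟨k, hk, hk'⟩ : ∃ i ∈ B, 0 < coord v B (v j) i := by
      by_contra! h
      have := sum_nonpos h
      rw [hB.sum_coord_height hv, hv] at this
      linarith
    obtain ⟨i₀, hi₀, hg₀, hr⟩ := exists_ratio_test (coord v B x) (coord v B (v j)) ⟨k, hk, hk'⟩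
    have hr := hr fun i hi => (hpos i hi).le
    set s := coord v B x i₀ / coord v B (v j) i₀ with hs
    have hs0 : 0 < s := div_pos (hpos i₀ hi₀) hg₀
    have hB' := hB.pivot hi₀ hj hg₀.ne'
    have hj' : j ∉ B.erase i₀ := fun h => hj (mem_of_mem_erase h)
    have hzero : coord v B x i₀ - s * coord v B (v j) i₀ = 0 := by
      rw [hs, div_mul_cancel₀ _ hg₀.ne', sub_self]
    have hcoord : ∀ i ∈ insert j (B.erase i₀), coord v (insert j (B.erase i₀)) x i =
        if i = j then s else coord v B x i - s * coord v B (v j) i := by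
      intro i hi
      refine hB'.coord_eq
        (a := fun i => if i = j then s else coord v B x i - s * coord v B (v j) i) ?_ hi
      rw [sum_insert hj', if_pos rfl, sum_congr rfl fun i hi => by
        rw [if_neg fun h : i = j => hj' (h ▸ hi)]]
      rw [sum_erase _ (by rw [hzero, zero_smul])]
      simp only [sub_smul, sum_sub_distrib, mul_smul, ← smul_sum, hB.sum_coord]
      abel
    have hle := hmin (insert j (B.erase i₀)) hB' fun i hi =>
      lt_of_le_of_ne (by
        rw [hcoord i hi]
        split_ifs with h
        · exact hs0.le
        · exact hr i (mem_of_mem_erase (mem_of_mem_insert_of_ne hi h))) (hgen _ hB' i hi).symm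
    rw [sum_insert hj', hcoord j (mem_insert_self _ _), if_pos rfl,
      sum_congr (s₁ := B.erase i₀)
        (g := fun i => (coord v B x i - s * coord v B (v j) i) * c i) rfl fun i hi => by
        rw [hcoord i (mem_insert_of_mem hi), if_neg fun h : i = j => hj' (h ▸ hi)],
      sum_erase _ (by rw [hzero, zero_mul])] at hle
    simp only [sub_mul, sum_sub_distrib, mul_assoc, ← mul_sum] at hle
    nlinarith
  refine ⟨B, ⟨hcell, hpos⟩, ?_⟩
  rintro B' ⟨hcell', hpos'⟩
  have h₁ := hcell.cost_le hcell'.1 hpos'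
  have h₂ := hcell'.cost_le hcell.1 hpos
  have heq := le_antisymm h₁.1 h₂.1
  exact (h₁.2 heq).antisymm (h₂.2 heq.symm)

lemma existsUnique_mem_halfOpenCone {ht : E →ₗ[ℝ] ℝ} (hv : ∀ i, ht (v i) = 1)
    (hspan : Submodule.span ℝ (Set.range v) = ⊤) {c : ι → ℝ}
    (hc : ∀ B, IsBase v B → ∀ j ∉ B, ∑ i ∈ B, coord v B (v j) i * c i ≠ c j)
    {w : E} (hw : w ∈ cone v) (hgen : ∀ B, IsBase v B → ∀ i ∈ B, coord v B w i ≠ 0)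
    {x : E} (hx : x ∈ cone v) : ∃! B, IsCell v c B ∧ x ∈ halfOpenCone v w B := by
  have hev : ∀ᶠ ε in nhdsWithin (0 : ℝ) (Set.Ioi 0), ∀ B i, IsBase v B → i ∈ B →
      coord v B x i + ε * coord v B w i ≠ 0 ∧ (0 < coord v B x i + ε * coord v B w i ↔
        0 ≤ coord v B x i ∧ (coord v B w i < 0 → 0 < coord v B x i)) := by
    simp only [eventually_all]
    exact fun B i hB hi => eventually_add_mul_pos_iff _ (hgen B hB i hi)
  obtain ⟨ε, hε, hε0 : 0 < ε⟩ := (hev.and self_mem_nhdsWithin).exists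
  have hcone : x + ε • w ∈ cone v := by
    obtain ⟨a, ha, rfl⟩ := hx
    obtain ⟨b, hb, rfl⟩ := hw
    exact ⟨fun i => a i + ε * b i, fun i => add_nonneg (ha i) (mul_nonneg hε0.le (hb i)), by
      simp only [add_smul, mul_smul, sum_add_distrib, smul_sum]⟩
  have := existsUnique_isCell hv hspan hc hcone fun B hB i hi => by
    simpa using (hε B i hB hi).1
  refine (existsUnique_congr fun B => and_congr_right fun hB => ?_).1 this
  refine forall₂_congr fun i hi => ?_
  simpa using (hε B i hB.1 hi).2

lemma exists_generic_weights (v : ι → E) : ∃ c : ι → ℝ, (∀ i, 0 < c i) ∧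
    (∀ B, IsBase v B → ∀ j ∉ B, ∑ i ∈ B, coord v B (v j) i * c i ≠ c j) ∧
    ∀ B, IsBase v B → ∀ i ∈ B, coord v B (∑ j, c j • v j) i ≠ 0 := by
  let f : Finset ι × ι → ι → ℝ := fun p i =>
    (if i ∈ p.1 then coord v p.1 (v p.2) i else 0) - if i = p.2 then 1 else 0
  let g : Finset ι × ι → ι → ℝ := fun p j => coord v p.1 (v j) p.2
  obtain ⟨c, hc, hF⟩ := exists_pos_sum_mul_ne_zero
    ((Set.finite_range f).union (Set.finite_range g))
  refine ⟨c, hc, fun B hB j hj h => ?_, fun B hB i hi h => ?_⟩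
  · refine hF (f (B, j)) (Or.inl ⟨_, rfl⟩) (fun h => ?_) ?_
    · simpa [f, hj] using congrFun h j
    · simp [f, sub_mul, h]
  · refine hF (g (B, i)) (Or.inr ⟨_, rfl⟩) (fun h => ?_) ?_
    · simpa [g, hB.coord_self hi hi] using congrFun h i
    · simpa [g, mul_comm] using h

end Cells

section Counting

/-- `x` lies in the half-open unit interval `[0, 1)`, or in `(0, 1]` when `s` is negative. -/
def InUnit (s x : ℝ) : Prop := (0 ≤ s ∧ 0 ≤ x ∧ x < 1) ∨ (s < 0 ∧ 0 < x ∧ x ≤ 1)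

lemma exists_inUnit_sub {s x : ℝ} (h : 0 ≤ x ∧ (s < 0 → 0 < x)) : ∃ n : ℕ, InUnit s (x - n) := by
  rcases lt_or_ge s 0 with hs | hs
  · have hx := h.2 hs
    obtain ⟨n, hn⟩ := Nat.exists_eq_succ_of_ne_zero (Nat.ceil_pos.2 hx).ne'
    have h₁ := Nat.le_ceil x
    have h₂ := Nat.ceil_lt_add_one h.1
    rw [hn] at h₁ h₂
    push_cast at h₁ h₂
    exact ⟨n, Or.inr ⟨hs, by linarith, by linarith⟩⟩
  · exact ⟨⌊x⌋₊, Or.inl ⟨hs, by linarith [Nat.floor_le h.1], by linarith [Nat.lt_floor_add_one x]⟩⟩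

lemma InUnit.nonneg {s x : ℝ} (h : InUnit s x) : 0 ≤ x := by
  rcases h with h | h <;> linarith [h.2.1]

lemma InUnit.le_one {s x : ℝ} (h : InUnit s x) : x ≤ 1 := by
  rcases h with h | h <;> linarith [h.2.2]

lemma InUnit.add_natCast {s x : ℝ} (h : InUnit s x) (n : ℕ) :
    0 ≤ x + n ∧ (s < 0 → 0 < x + n) := by
  have hn : (0 : ℝ) ≤ n := n.cast_nonneg
  refine ⟨by linarith [h.nonneg], fun hs => ?_⟩
  rcases h with h | h <;> linarith [h.1, h.2.1]

lemma InUnit.natCast_unique {s x y : ℝ} (hx : InUnit s x) (hy : InUnit s y) {m n : ℕ}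
    (h : x + m = y + n) : m = n := by
  have h₁ : (m : ℝ) < n + 1 := by rcases hx with hx | hx <;> rcases hy with hy | hy <;> linarith
  have h₂ : (n : ℝ) < m + 1 := by rcases hx with hx | hx <;> rcases hy with hy | hy <;> linarith
  norm_cast at h₁ h₂
  omega

variable {ι E : Type*} [AddCommGroup E] [Module ℝ E] [FiniteDimensional ℝ E]

/-- The pairs of a maximal cell and a lattice point in its half-open fundamental
parallelepiped. -/
def boxes (v : ι → E) (c : ι → ℝ) (w : E) (Λ : AddSubgroup E) : Set (Finset ι × E) :=
  {p | IsCell v c p.1 ∧ p.2 ∈ Λ ∧ ∀ i ∈ p.1, InUnit (coord v p.1 w i) (coord v p.1 p.2 i)}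

variable {v : ι → E}

lemma IsBase.coord_add_sum {B : Finset ι} (hB : IsBase v B) (x : E) (n : ι → ℕ)
    {i : ι} (hi : i ∈ B) :
    coord v B (x + ∑ j ∈ B, (n j : ℝ) • v j) i = coord v B x i + n i := by
  rw [map_add, Pi.add_apply, hB.coord_eq (a := fun j => (n j : ℝ)) rfl hi]

lemma height_box {ht : E →ₗ[ℝ] ℝ} (hv : ∀ i, ht (v i) = 1) {D : ℕ} (hD : finrank ℝ E = D + 1)
    {Λ : AddSubgroup E} (hint : ∀ x ∈ Λ, ∃ n : ℤ, ht x = n) {c : ι → ℝ} {w : E}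
    (hw : 0 < ht w) {p : Finset ι × E} (hp : p ∈ boxes v c w Λ) :
    ht p.2 = ⌊ht p.2⌋₊ ∧ ⌊ht p.2⌋₊ ≤ D := by
  obtain ⟨hcell, hΛ, hunit⟩ := hp
  obtain ⟨n, hn⟩ := hint _ hΛ
  have hsum := hcell.1.sum_coord_height hv p.2
  have h0 : 0 ≤ ht p.2 := hsum ▸ sum_nonneg fun i hi => (hunit i hi).nonneg
  have hlt : ht p.2 < D + 1 := by
    obtain ⟨i, hi, hiw⟩ : ∃ i ∈ p.1, 0 < coord v p.1 w i := by
      by_contra! h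
      linarith [sum_nonpos h, hcell.1.sum_coord_height hv w]
    have : ∑ i ∈ p.1, coord v p.1 p.2 i < ∑ i ∈ p.1, (1 : ℝ) := by
      refine sum_lt_sum (fun i hi => (hunit i hi).le_one) ⟨i, hi, ?_⟩
      rcases hunit i hi with h | h
      · exact h.2.2
      · linarith [h.1]
    rw [hsum] at this
    simpa [hcell.1.2, hD] using this
  rw [hn] at h0 hlt ⊢
  norm_cast at h0 hlt
  lift n to ℕ using h0
  norm_cast at hlt
  simp only [Int.cast_natCast, Nat.floor_natCast, true_and]
  omega

variable [Fintype ι]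

lemma finite_boxes {ht : E →ₗ[ℝ] ℝ} (hv : ∀ i, ht (v i) = 1) {D : ℕ}
    (hD : finrank ℝ E = D + 1) {Λ : AddSubgroup E} (hint : ∀ x ∈ Λ, ∃ n : ℤ, ht x = n)
    (hfin : ∀ t : ℕ, {x | x ∈ Λ ∧ x ∈ cone v ∧ ht x = t}.Finite) {c : ι → ℝ} {w : E}
    (hw : 0 < ht w) : (boxes v c w Λ).Finite := by
  refine ((Set.finite_univ (α := Finset ι)).prod
    ((Set.finite_Iic D).biUnion fun t _ => hfin t)).subset fun p hp => ?_
  have h := height_box hv hD hint hw hp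
  refine ⟨Set.mem_univ _, Set.mem_biUnion (x := ⌊ht p.2⌋₊) h.2 ⟨hp.2.1, ?_, h.1⟩⟩
  exact hp.1.1.mem_cone fun i hi => (hp.2.2 i hi).nonneg

/-- The number of lattice points at height `t` in a cone generated by lattice vectors of height
one is a sum of binomial coefficients `(t + D - h).choose D` with `h ≤ D`. -/
theorem exists_ncard_eq_sum_choose {ht : E →ₗ[ℝ] ℝ} (hv : ∀ i, ht (v i) = 1)
    (hspan : Submodule.span ℝ (Set.range v) = ⊤) {D : ℕ} (hD : finrank ℝ E = D + 1)
    {Λ : AddSubgroup E} (hvΛ : ∀ i, v i ∈ Λ) (hint : ∀ x ∈ Λ, ∃ n : ℤ, ht x = n)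
    (hfin : ∀ t : ℕ, {x | x ∈ Λ ∧ x ∈ cone v ∧ ht x = t}.Finite) :
    ∃ (S : Finset (Finset ι × E)) (m : Finset ι × E → ℕ),
      ∀ t : ℕ, {x | x ∈ Λ ∧ x ∈ cone v ∧ ht x = t}.ncard = ∑ p ∈ S, (t + m p).choose D := by
  obtain ⟨c, hc, hcell, hgen⟩ := exists_generic_weights v
  set w := ∑ j, c j • v j with hwdef
  have hwC : w ∈ cone v := ⟨c, fun i => (hc i).le, rfl⟩
  have hne : Nonempty ι := by
    by_contra h
    rw [not_nonempty_iff] at h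
    rw [Set.range_eq_empty, Submodule.span_empty] at hspan
    have := finrank_top ℝ E
    rw [← hspan, finrank_bot] at this
    omega
  have hw : 0 < ht w := by
    simpa [hwdef, hv] using sum_pos (fun i _ => hc i) univ_nonempty
  have hfb := finite_boxes hv hD hint hfin (c := c) hw
  have hmem : ∀ {p}, p ∈ hfb.toFinset → p ∈ boxes v c w Λ := fun h => hfb.mem_toFinset.1 h
  refine ⟨hfb.toFinset, fun p => D - ⌊ht p.2⌋₊, fun t => ?_⟩
  let N : Finset ι × E → Finset (ι →₀ ℕ) := fun p =>
    if ⌊ht p.2⌋₊ ≤ t then p.1.finsuppAntidiag (t - ⌊ht p.2⌋₊) else ∅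
  have hN : ∀ p ∈ hfb.toFinset, (t + (D - ⌊ht p.2⌋₊)).choose D = (N p).card := by
    intro p hp
    have h := (height_box hv hD hint hw (hmem hp)).2
    simp only [N]
    split_ifs with hle
    · rw [card_finsuppAntidiag_nat_eq_choose, (hmem hp).1.1.2, hD,
        show D + 1 + (t - ⌊ht p.2⌋₊) - 1 = D + (t - ⌊ht p.2⌋₊) by omega,
        show t + (D - ⌊ht p.2⌋₊) = D + (t - ⌊ht p.2⌋₊) by omega]
      exact Nat.choose_symm_add
    · rw [card_empty]
      exact Nat.choose_eq_zero_of_lt (by omega)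
  rw [sum_congr rfl hN, ← card_sigma, Set.ncard_eq_toFinset_card _ (hfin t)]
  symm
  have hunit : ∀ {q : (_ : Finset ι × E) × (ι →₀ ℕ)}, q.1 ∈ boxes v c w Λ →
      q.1.2 + ∑ i ∈ q.1.1, (q.2 i : ℝ) • v i ∈ halfOpenCone v w q.1.1 := by
    intro q hq i hi
    rw [hq.1.1.coord_add_sum _ _ hi]
    exact (hq.2.2 i hi).add_natCast _
  have hq : ∀ {q : (_ : Finset ι × E) × (ι →₀ ℕ)}, q ∈ hfb.toFinset.sigma N →
      q.1 ∈ boxes v c w Λ ∧ q.2.support ⊆ q.1.1 ∧ ∑ i ∈ q.1.1, q.2 i + ⌊ht q.1.2⌋₊ = t := by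
    intro q hq
    rw [mem_sigma] at hq
    refine ⟨hmem hq.1, ?_⟩
    have := hq.2
    simp only [N] at this
    split_ifs at this with hle
    · rw [mem_finsuppAntidiag] at this
      exact ⟨this.2, by rw [this.1]; omega⟩
    · simp at this
  refine card_bij (fun q _ => q.1.2 + ∑ i ∈ q.1.1, (q.2 i : ℝ) • v i) ?_ ?_ ?_
  · intro q hmemq
    obtain ⟨hbox, hsupp, hsum⟩ := hq hmemq
    rw [Set.Finite.mem_toFinset]
    refine ⟨Λ.add_mem hbox.2.1 (Λ.sum_mem fun i _ => ?_),
      hbox.1.1.mem_cone fun i hi => (hunit hbox i hi).1, ?_⟩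
    · rw [Nat.cast_smul_eq_nsmul]
      exact Λ.nsmul_mem (hvΛ i) _
    · rw [map_add, (height_box hv hD hint hw hbox).1, ← hsum]
      simp [hv, add_comm]
  · rintro ⟨⟨B, b⟩, n⟩ h₁ ⟨⟨B', b'⟩, n'⟩ h₂ heq
    obtain ⟨hbox, hsupp, -⟩ := hq h₁
    obtain ⟨hbox', hsupp', -⟩ := hq h₂
    have hu := hunit (q := ⟨(B, b), n⟩) hbox
    have hu' := hunit (q := ⟨(B', b'), n'⟩) hbox'
    dsimp only at heq hu hu' hsupp hsupp'
    obtain rfl : B = B' := (existsUnique_mem_halfOpenCone hv hspan hcell hwC hgen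
      (hbox.1.1.mem_cone fun i hi => (hu i hi).1)).unique ⟨hbox.1, hu⟩ ⟨hbox'.1, heq ▸ hu'⟩
    obtain rfl : n = n' := by
      ext i
      by_cases hi : i ∈ B
      · have := congrFun (congrArg (coord v B) heq) i
        rw [hbox.1.1.coord_add_sum _ _ hi, hbox.1.1.coord_add_sum _ _ hi] at this
        exact (hbox.2.2 i hi).natCast_unique (hbox'.2.2 i hi) this
      · rw [Finsupp.notMem_support_iff.1 fun h => hi (hsupp h),
          Finsupp.notMem_support_iff.1 fun h => hi (hsupp' h)]
    obtain rfl : b = b' := add_right_cancel heq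
    rfl
  · intro x hx
    obtain ⟨hxΛ, hxC, hxt⟩ := (hfin t).mem_toFinset.1 hx
    obtain ⟨B, ⟨hB, hxB⟩, -⟩ := existsUnique_mem_halfOpenCone hv hspan hcell hwC hgen hxC
    have hex : ∀ i, ∃ n : ℕ, i ∈ B → InUnit (coord v B w i) (coord v B x i - n) := by
      intro i
      by_cases hi : i ∈ B
      · obtain ⟨n, hn⟩ := exists_inUnit_sub (hxB i hi)
        exact ⟨n, fun _ => hn⟩
      · exact ⟨0, fun h => absurd h hi⟩
    choose n hn using hex
    let n' : ι →₀ ℕ := Finsupp.onFinset B (fun i => if i ∈ B then n i else 0) (by simp +contextual)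
    have hn' : ∀ i ∈ B, n' i = n i := fun i hi => by simp [n', hi]
    set b := x - ∑ i ∈ B, (n' i : ℝ) • v i with hb
    have hbx : b + ∑ i ∈ B, (n' i : ℝ) • v i = x := sub_add_cancel _ _
    have hbox : (B, b) ∈ boxes v c w Λ := by
      refine ⟨hB, Λ.sub_mem hxΛ (Λ.sum_mem fun i _ => ?_), fun i hi => ?_⟩
      · rw [Nat.cast_smul_eq_nsmul]
        exact Λ.nsmul_mem (hvΛ i) _
      · have := hB.1.coord_add_sum b n' hi
        rw [hbx, hn' i hi] at this
        have h := hn i hi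
        rwa [this, add_sub_cancel_right] at h
    have hheight : ⌊ht b⌋₊ + ∑ i ∈ B, n' i = t := by
      have h := congrArg ht hbx
      rw [map_add, (height_box hv hD hint hw hbox).1, hxt] at h
      simp only [map_sum, map_smul, hv, smul_eq_mul, mul_one] at h
      exact_mod_cast h
    refine ⟨⟨(B, b), n'⟩, ?_, hbx⟩
    rw [mem_sigma]
    refine ⟨hfb.mem_toFinset.2 hbox, ?_⟩
    simp only [N]
    rw [if_pos (by omega), mem_finsuppAntidiag]
    refine ⟨?_, Finsupp.support_onFinset_subset⟩
    change ∑ i ∈ B, n' i = _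
    omega

end Counting

section Difference

lemma fwdDiff_iter_choose_nonneg (k D m : ℕ) :
    0 ≤ (fwdDiff 1)^[k] (fun x ↦ x.choose D : ℕ → ℤ) m := by
  induction k generalizing D with
  | zero => simp
  | succ k ih =>
    rw [Function.iterate_succ_apply]
    cases D with
    | zero => simp [fwdDiff_iter_eq_sum_shift]
    | succ D => rw [fwdDiff_choose]; exact ih D

lemma sum_powerset_choose_nonneg (k D m : ℕ) :
    0 ≤ ∑ J : Finset (Fin k), (-1 : ℤ) ^ (k - J.card) * ((J.card + m).choose D : ℤ) := by
  have h := fwdDiff_iter_choose_nonneg k D m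
  rw [fwdDiff_iter_eq_sum_shift] at h
  rw [← powerset_univ, sum_powerset_apply_card
    (fun j => (-1 : ℤ) ^ (k - j) * ((j + m).choose D : ℤ)), card_univ, Fintype.card_fin]
  refine h.trans_eq (sum_congr rfl fun j _ => ?_)
  simp only [smul_eq_mul, mul_one, nsmul_eq_mul, add_comm m]
  ring

end Difference

section Polytope

variable {d : ℕ}

/-- The inclusion of `ℤ^d` in `ℝ^d`. -/
def castVec (z : Fin d → ℤ) : Fin d → ℝ := fun i => (z i : ℝ)

lemma castVec_injective : Function.Injective (castVec (d := d)) := fun a b h => by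
  funext i
  exact Int.cast_injective (congrFun h i)

lemma Convex.sum_const_eq_smul {E κ : Type*} [AddCommGroup E] [Module ℝ E] {P : Set E}
    (hP : Convex ℝ P) (hne : P.Nonempty) (J : Finset κ) : ∑ _j ∈ J, P = (J.card : ℝ) • P := by
  induction J using Finset.induction_on with
  | empty => simp [Set.zero_smul_set hne]
  | insert j J hj ih =>
    rw [sum_insert hj, ih, card_insert_of_notMem hj, Nat.cast_succ, add_comm,
      hP.add_smul J.card.cast_nonneg zero_le_one, one_smul]

lemma mem_convexHull_range_iff_exists {E : Type*} [AddCommGroup E] [Module ℝ E] {κ : Type*}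
    [Fintype κ] {u : κ → E} {x : E} : x ∈ convexHull ℝ (Set.range u) ↔
      ∃ a : κ → ℝ, (∀ i, 0 ≤ a i) ∧ ∑ i, a i = 1 ∧ ∑ i, a i • u i = x := by
  have h : Set.range u = Fintype.linearCombination ℝ u '' Set.range fun i => Pi.single i 1 := by
    rw [← Set.range_comp]
    congr 1
    ext i
    simp
  rw [h, ← LinearMap.image_convexHull, convexHull_rangle_single_eq_stdSimplex]
  simp [stdSimplex, Fintype.linearCombination_apply, and_assoc]

lemma mem_natCast_smul_convexHull_iff {E : Type*} [AddCommGroup E] [Module ℝ E] {κ : Type*}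
    [Fintype κ] [Nonempty κ] (u : κ → E) (t : ℕ) (x : E) :
    x ∈ (t : ℝ) • convexHull ℝ (Set.range u) ↔
      ∃ a : κ → ℝ, (∀ i, 0 ≤ a i) ∧ ∑ i, a i = t ∧ ∑ i, a i • u i = x := by
  rw [Set.mem_smul_set]
  constructor
  · rintro ⟨y, hy, rfl⟩
    obtain ⟨a, ha, ha1, rfl⟩ := mem_convexHull_range_iff_exists.1 hy
    refine ⟨fun i => t * a i, fun i => mul_nonneg t.cast_nonneg (ha i), ?_, ?_⟩
    · rw [← mul_sum, ha1, mul_one]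
    · simp only [mul_smul, smul_sum]
  · rintro ⟨a, ha, hat, rfl⟩
    rcases eq_or_ne t 0 with rfl | ht
    · have h0 := (sum_eq_zero_iff_of_nonneg fun i _ => ha i).1 (hat.trans Nat.cast_zero)
      obtain ⟨k⟩ := ‹Nonempty κ›
      exact ⟨u k, subset_convexHull ℝ _ ⟨k, rfl⟩, by simp [fun i => h0 i (mem_univ i)]⟩
    · have ht' : (t : ℝ) ≠ 0 := Nat.cast_ne_zero.2 ht
      refine ⟨∑ i, (a i / t) • u i, mem_convexHull_range_iff_exists.2 ⟨fun i => a i / t,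
        fun i => div_nonneg (ha i) t.cast_nonneg, ?_, rfl⟩, ?_⟩
      · rw [← sum_div, hat, div_self ht']
      · simp only [smul_sum, smul_smul, mul_div_cancel₀ _ ht']

lemma finite_castVec_preimage {K : Set (Fin d → ℝ)} (hK : Bornology.IsBounded K) :
    (castVec ⁻¹' K).Finite := by
  obtain ⟨R, hR⟩ := hK.subset_closedBall 0
  refine (Set.finite_Icc (fun _ : Fin d => -⌈R⌉) (fun _ => ⌈R⌉)).subset fun z hz => ?_
  have hz := hR hz
  rw [mem_closedBall_zero_iff] at hz
  have h : ∀ i, |(z i : ℝ)| ≤ ⌈R⌉ := fun i =>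
    ((norm_le_pi_norm (castVec z) i).trans hz).trans (Int.le_ceil R)
  refine ⟨fun i => ?_, fun i => ?_⟩
  · exact_mod_cast (abs_le.1 (h i)).1
  · exact_mod_cast (abs_le.1 (h i)).2

/-- The Ehrhart function of a lattice polytope is a sum of binomial coefficients. -/
theorem exists_latticePointCount_eq_sum_choose {P : Set (Fin d → ℝ)} (hP : IsLatticePolytope P) :
    ∃ (κ : Type) (S : Finset κ) (m : κ → ℕ) (D : ℕ),
      ∀ t : ℕ, latticePointCount ((t : ℝ) • P) = ∑ p ∈ S, (t + m p).choose D := by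
  obtain ⟨V, hV, rfl⟩ := hP
  have : Nonempty V := hV.to_subtype
  let u : V → (Fin d → ℝ) × ℝ := fun z => (castVec z.1, 1)
  let W := Submodule.span ℝ (Set.range u)
  let v : V → W := fun z => ⟨u z, Submodule.subset_span ⟨z, rfl⟩⟩
  let ht : W →ₗ[ℝ] ℝ := (LinearMap.snd ℝ _ _).comp W.subtype
  have hv : ∀ z, ht (v z) = 1 := fun z => rfl
  let Λ : AddSubgroup W :=
    { carrier := {x | ∃ (z : Fin d → ℤ) (n : ℤ), (x : (Fin d → ℝ) × ℝ) = (castVec z, (n : ℝ))}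
      zero_mem' := ⟨0, 0, by ext <;> simp [castVec]⟩
      add_mem' := by
        rintro x y ⟨z, n, hx⟩ ⟨z', n', hy⟩
        exact ⟨z + z', n + n', by rw [Submodule.coe_add, hx, hy]; ext <;> simp [castVec]⟩
      neg_mem' := by
        rintro x ⟨z, n, hx⟩
        exact ⟨-z, -n, by rw [Submodule.coe_neg, hx]; ext <;> simp [castVec]⟩ }
  have hspan : Submodule.span ℝ (Set.range v) = ⊤ := by
    convert Submodule.span_span_coe_preimage (R := ℝ) (s := Set.range u) using 2
    ext x
    simp [v, Subtype.ext_iff]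
  have hD : finrank ℝ W = finrank ℝ W - 1 + 1 := by
    have : Nontrivial W := by
      obtain ⟨z⟩ := ‹Nonempty V›
      exact ⟨v z, 0, fun h => by simpa [hv] using congrArg ht h⟩
    have := finrank_pos (R := ℝ) (M := W)
    omega
  have hrange : (fun z : Fin d → ℤ => fun i => (z i : ℝ)) '' (V : Set (Fin d → ℤ)) =
      Set.range fun z : V => castVec z.1 := by
    rw [Set.image_eq_range]
    rfl
  rw [hrange]
  have himage : ∀ t : ℕ, Subtype.val '' {x : W | x ∈ Λ ∧ x ∈ cone v ∧ ht x = t} =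
      (fun z => (castVec z, (t : ℝ))) '' (castVec ⁻¹'
        ((t : ℝ) • convexHull ℝ (Set.range fun z : V => castVec z.1))) := by
    intro t
    have hfst : ∀ a : V → ℝ, ((∑ i, a i • v i : W) : (Fin d → ℝ) × ℝ) =
        (∑ i, a i • castVec i.1, ∑ i, a i) := by
      intro a
      ext <;> simp [v, u, Prod.fst_sum, Prod.snd_sum]
    ext y
    simp only [Set.mem_image, Set.mem_ofPred_eq, Set.mem_preimage, mem_natCast_smul_convexHull_iff]
    constructor
    · rintro ⟨x, ⟨⟨z, n, hz⟩, ⟨a, ha, rfl⟩, hxt⟩, rfl⟩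
      have hxt : (Subtype.val (∑ i, a i • v i : W)).2 = t := hxt
      rw [hfst] at hz hxt
      rw [hfst]
      exact ⟨z, ⟨a, ha, hxt, congrArg Prod.fst hz⟩, Prod.ext (congrArg Prod.fst hz).symm hxt.symm⟩
    · rintro ⟨z, ⟨a, ha, hat, haz⟩, rfl⟩
      have hx : ((∑ i, a i • v i : W) : (Fin d → ℝ) × ℝ) = (castVec z, (t : ℝ)) := by
        rw [hfst, hat, haz]
      exact ⟨_, ⟨⟨z, t, by rw [hx]; simp⟩, ⟨a, ha, rfl⟩, congrArg Prod.snd hx⟩, hx⟩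
  have hinj : ∀ t : ℕ, Function.Injective fun z : Fin d → ℤ => (castVec z, (t : ℝ)) :=
    fun t z z' h => castVec_injective (congrArg Prod.fst h)
  have hfin : ∀ t : ℕ, {x : W | x ∈ Λ ∧ x ∈ cone v ∧ ht x = t}.Finite := by
    intro t
    refine Set.Finite.of_finite_image ?_ Subtype.val_injective.injOn
    rw [himage]
    exact (finite_castVec_preimage
      (((Set.finite_range _).isCompact_convexHull ℝ).isBounded.smul₀ _)).image _
  obtain ⟨S, m, hS⟩ := exists_ncard_eq_sum_choose hv hspan hD (Λ := Λ)
    (fun z => ⟨z.1, 1, by simp [v, u]⟩) (fun x ⟨z, n, hx⟩ => ⟨n, congrArg Prod.snd hx⟩) hfin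
  refine ⟨_, S, m, finrank ℝ W - 1, fun t => ?_⟩
  rw [← hS, ← Set.ncard_image_of_injective _ Subtype.val_injective, himage,
    Set.ncard_image_of_injective _ (hinj t)]
  rfl

lemma IsLatticePolytope.natCast_smul {P : Set (Fin d → ℝ)} (hP : IsLatticePolytope P) (n : ℕ) :
    IsLatticePolytope ((n : ℝ) • P) := by
  obtain ⟨V, hV, rfl⟩ := hP
  refine ⟨V.image fun z => (n : ℤ) • z, hV.image _, ?_⟩
  rw [← convexHull_smul, coe_image, ← Set.image_smul, Set.image_image, Set.image_image]
  congr 1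
  refine Set.image_congr fun z _ => ?_
  ext i
  simp

theorem dmv_const_nonneg {P : Set (Fin d → ℝ)} (hP : IsLatticePolytope P) (k : ℕ) :
    0 ≤ DMV (fun _ : Fin k => P) := by
  obtain ⟨κ, S, m, D, hS⟩ := exists_latticePointCount_eq_sum_choose hP
  obtain ⟨V, hV, hPV⟩ := hP
  have hconv : Convex ℝ P := hPV ▸ convex_convexHull ℝ _
  have hne : P.Nonempty := by
    rw [hPV, convexHull_nonempty_iff]
    exact (coe_nonempty.2 hV).image _
  simp only [DMV, Convex.sum_const_eq_smul hconv hne, hS, Nat.cast_sum, mul_sum]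
  rw [sum_comm]
  exact sum_nonneg fun p _ => sum_powerset_choose_nonneg k D (m p)

end Polytope

end DiscreteMixedVolume

/-- **Non-negativity of the discrete mixed volume of `k` copies of a polytope.**
For a `d`-dimensional lattice polytope `P ⊆ ℝ^d` and `k ≥ 1`, the discrete mixed volume
of `k` copies of `P` is non-negative, and more generally the mixed Ehrhart polynomial
`ME_{(P,…,P)}(n) = DMV(nP, …, nP)` is non-negative for all integers `n ≥ 0`. -/
theorem dmv_of_copies_nonneg
    {d k : ℕ} (hk : 1 ≤ k) (P : Set (Fin d → ℝ))
    (hP : IsLatticePolytope P) (hPdim : polytopeDim P = d) :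
    0 ≤ DMV (fun _ : Fin k => P) ∧
    ∀ n : ℕ, 0 ≤ DMV (fun _ : Fin k => (n : ℝ) • P) := by
  exact ⟨DiscreteMixedVolume.dmv_const_nonneg hP k, fun n =>
    DiscreteMixedVolume.dmv_const_nonneg
      (DiscreteMixedVolume.IsLatticePolytope.natCast_smul hP n) k⟩
end

section
/- Let 𝐏 = (P_1,…,P_k) be a collection of d-dimensional lattice polytopes in ℝ^d, and for an integer r ≥ 1 let r𝐏 = (rP_1,…,rP_k). Then, as r → ∞, the polynomials h*_{r𝐏}(z)/r^d converge coefficientwise to ( Σ_{J⊆[k]} (−1)^{k−|J|} vol_d(P_J) ) · A_d(z), where vol_d denotes d-dimensional Lebesgue volume (with vol_d(P_∅) = 0) and A_d(z) is the d-th Eulerian polynomial. -/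
open Pointwise MeasureTheory Filter
open scoped Classical

/-- A lattice polytope is nonempty, compact and convex. -/
theorem IsLatticePolytope.nonempty_isCompact_convex {d : ℕ} {P : Set (Fin d → ℝ)}
    (hP : IsLatticePolytope P) : P.Nonempty ∧ IsCompact P ∧ Convex ℝ P := by
  obtain ⟨V, hV, rfl⟩ := hP
  refine ⟨?_, ?_, convex_convexHull ℝ _⟩
  · exact (Set.Nonempty.image _ hV).convexHull
  · exact (V.finite_toSet.image _).isCompact_convexHull ℝ

/-- A finite Minkowski sum of nonempty compact convex sets is nonempty, compact and convex. -/
theorem nonempty_isCompact_convex_finsetSum {ι E : Type*} [NormedAddCommGroup E] [NormedSpace ℝ E]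
    {P : ι → Set E} (J : Finset ι) (hP : ∀ i ∈ J, (P i).Nonempty ∧ IsCompact (P i) ∧
      Convex ℝ (P i)) :
    (∑ j ∈ J, P j).Nonempty ∧ IsCompact (∑ j ∈ J, P j) ∧ Convex ℝ (∑ j ∈ J, P j) :=
  Finset.sum_induction P (fun s => s.Nonempty ∧ IsCompact s ∧ Convex ℝ s)
    (fun _ _ hs ht => ⟨hs.1.add ht.1, hs.2.1.add ht.2.1, hs.2.2.add ht.2.2⟩)
    ⟨Set.zero_nonempty, isCompact_singleton, convex_singleton 0⟩ hP

/-- Counting lattice points of `m • Q` is counting the points of `m⁻¹ • ℤ^d` in `Q`. -/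
theorem latticePointCount_smul {d : ℕ} (Q : Set (Fin d → ℝ)) {m : ℝ} (hm : m ≠ 0) :
    latticePointCount (m • Q) = Nat.card ↑(Q ∩ m⁻¹ •
      (Submodule.span ℤ (Set.range (Pi.basisFun ℝ (Fin d))) : Set (Fin d → ℝ))) := by
  have hinj : Function.Injective (fun z : Fin d → ℤ => m⁻¹ • fun i => (z i : ℝ)) := by
    intro z w hzw
    have h' := smul_right_injective (Fin d → ℝ) (inv_ne_zero hm) hzw
    funext i
    exact_mod_cast congrFun h' i
  rw [latticePointCount, ← Set.ncard_image_of_injective _ hinj, ← Nat.card_coe_set_eq]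
  congr 2
  ext x
  simp only [Set.mem_image, Set.mem_ofPred_eq, Set.mem_inter_iff,
    Set.mem_smul_set_iff_inv_smul_mem₀ hm,
    Set.mem_inv_smul_set_iff₀ hm, SetLike.mem_coe, Module.Basis.mem_span_iff_repr_mem,
    Pi.basisFun_repr]
  constructor
  · rintro ⟨z, hz, rfl⟩
    exact ⟨hz, fun i => ⟨z i, by simp [hm]⟩⟩
  · rintro ⟨hx, hz⟩
    choose z hz using hz
    have hzx : m⁻¹ • (fun i => (z i : ℝ)) = x := by
      rw [inv_smul_eq_iff₀ hm]
      funext i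
      simpa using hz i
    exact ⟨z, hzx ▸ hx, hzx⟩

theorem latticePointCount_zero {d : ℕ} : latticePointCount (0 : Set (Fin d → ℝ)) = 1 := by
  rw [latticePointCount, Set.ncard_eq_one]
  refine ⟨0, ?_⟩
  ext z
  simp [funext_iff]

/-- The lattice points of the dilates of a compact convex set are asymptotically counted by its
volume. -/
theorem tendsto_latticePointCount_smul_div_pow {d : ℕ} {Q : Set (Fin d → ℝ)} (hne : Q.Nonempty)
    (hc : IsCompact Q) (hconv : Convex ℝ Q) (n : ℕ) :
    Tendsto (fun r : ℕ => (latticePointCount (((r * n : ℕ) : ℝ) • Q) : ℝ) / (r : ℝ) ^ d) atTop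
      (nhds ((n : ℝ) ^ d * (volume Q).toReal)) := by
  rcases Nat.eq_zero_or_pos n with rfl | hn
  · have hcount (r : ℕ) : latticePointCount (((r * 0 : ℕ) : ℝ) • Q) = 1 := by
      rw [mul_zero, Nat.cast_zero, Set.zero_smul_set hne, latticePointCount_zero]
    simp only [hcount, Nat.cast_one, Nat.cast_zero]
    rcases Nat.eq_zero_or_pos d with rfl | hd
    · have hQ : Q = Set.univ := hne.eq_univ
      simp [hQ, volume_pi]
    · rw [zero_pow hd.ne', zero_mul]
      exact tendsto_const_nhds.div_atTop
        ((tendsto_pow_atTop hd.ne').comp tendsto_natCast_atTop_atTop)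
  · have hlim := (tendsto_card_div_pow_atTop_volume Q hc.isBounded hc.measurableSet
      (hconv.addHaar_frontier volume)).comp
        (tendsto_id.atTop_mul_const' hn : Tendsto (fun r : ℕ => r * n) atTop atTop)
    refine (hlim.const_mul ((n : ℝ) ^ d)).congr' ?_
    filter_upwards [eventually_gt_atTop 0] with r hr
    have hn' : (n : ℝ) ≠ 0 := by positivity
    have hr' : (r : ℝ) ≠ 0 := by positivity
    rw [latticePointCount_smul Q (by positivity)]
    simp only [Function.comp_apply, Fintype.card_fin]
    rw [Nat.cast_mul, mul_pow]
    field_simp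

/-- The discrete mixed volume of dilates grows like the alternating sum of volumes. -/
theorem tendsto_DMV_smul_div_pow {d k : ℕ} {P : Fin k → Set (Fin d → ℝ)}
    (hP : ∀ i, (P i).Nonempty ∧ IsCompact (P i) ∧ Convex ℝ (P i)) (n : ℕ) :
    Tendsto (fun r : ℕ => (DMV (fun i => ((r * n : ℕ) : ℝ) • P i) : ℝ) / (r : ℝ) ^ d) atTop
      (nhds ((∑ J : Finset (Fin k),
        (-1 : ℝ) ^ (k - J.card) * (volume (∑ j ∈ J, P j)).toReal) * (n : ℝ) ^ d)) := by
  simp only [DMV, ← Finset.smul_sum, Int.cast_sum, Finset.sum_div, Finset.sum_mul]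
  refine tendsto_finsetSum _ fun J _ => ?_
  obtain ⟨hne, hc, hconv⟩ := nonempty_isCompact_convex_finsetSum J fun i _ => hP i
  convert! (tendsto_latticePointCount_smul_div_pow hne hc hconv n).const_mul
    ((-1 : ℝ) ^ (k - J.card)) using 1
  · funext r
    push_cast
    ring
  · ring_nf

/-- In the basis `binom(x + d - i, d)` of polynomials of degree at most `d`, the `n`-th coefficient
is the value at `n` minus the contribution of the earlier coefficients. -/
theorem eq_sub_sum_of_eq_sum_choose {d n : ℕ} (hn : n ≤ d) {a : ℕ → ℝ} {y : ℝ}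
    (hy : y = ∑ i ∈ Finset.range (d + 1), a i * ((n + d - i).choose d : ℕ)) :
    a n = y - ∑ i ∈ Finset.range n, a i * ((n + d - i).choose d : ℕ) := by
  have hsum : ∑ i ∈ Finset.range (d + 1), a i * ((n + d - i).choose d : ℕ)
      = ∑ i ∈ Finset.range (n + 1), a i * ((n + d - i).choose d : ℕ) := by
    symm
    refine Finset.sum_subset (Finset.range_mono (by omega)) fun i hi hin => ?_
    simp only [Finset.mem_range] at hi hin
    rw [Nat.choose_eq_zero_of_lt (by omega), Nat.cast_zero, mul_zero]
  rw [hy, hsum, Finset.sum_range_succ, Nat.add_sub_cancel_left, Nat.choose_self]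
  simp

/-- **Asymptotics of the mixed `h^*`-polynomial (mixed Diaconis–Fulman).**
Let `𝐏 = (P_1, …, P_k)` be a collection of `d`-dimensional lattice polytopes in `ℝ^d`.
For `r ≥ 1` let `h r` be the mixed `h^*`-vector of `r𝐏 = (rP_1, …, rP_k)`, so that
`ME_{r𝐏}(n) = DMV(rn P_1, …, rn P_k) = ∑_{i=0}^d h r i binom(n + d - i, d)`.
Let `A` be the `d`-th Eulerian polynomial, characterized (given `deg A ≤ d`) by
Worpitzky's identity `n^d = ∑_{i=0}^d (coeff i of A) binom(n + d - i, d)`, which is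
equivalent to `∑_{n ≥ 0} n^d z^n = A(z) / (1 - z)^{d+1}`. Then, coefficientwise,
`h*_{r𝐏}(z) / r^d → (∑_{J ⊆ [k]} (-1)^{k-|J|} vol_d(P_J)) ⬝ A(z)` as `r → ∞`
(note `vol_d(P_∅) = vol_d({0}) = 0`). -/
theorem mixed_hstar_tendsto_eulerian
    {d k : ℕ} (hk : 1 ≤ k) (P : Fin k → Set (Fin d → ℝ))
    (hP : ∀ i, IsLatticePolytope (P i))
    (hPdim : ∀ i, polytopeDim (P i) = d)
    (h : ℕ → ℕ → ℝ)
    (hh : ∀ r : ℕ, 1 ≤ r → ∀ n : ℕ,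
      (DMV (fun i => ((r * n : ℕ) : ℝ) • P i) : ℝ)
        = ∑ i ∈ Finset.range (d + 1), h r i * ((n + d - i).choose d : ℕ))
    (A : Polynomial ℝ) (hAdeg : A.natDegree ≤ d)
    (hA : ∀ n : ℕ, (n : ℝ) ^ d
      = ∑ i ∈ Finset.range (d + 1), A.coeff i * ((n + d - i).choose d : ℕ)) :
    ∀ i : ℕ, i ≤ d →
      Filter.Tendsto (fun r : ℕ => h r i / (r : ℝ) ^ d) Filter.atTop
        (nhds ((∑ J : Finset (Fin k),
            (-1 : ℝ) ^ (k - J.card) * (MeasureTheory.volume (∑ j ∈ J, P j)).toReal) *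
          A.coeff i)) := by
  intro i
  induction i using Nat.strong_induction_on with
  | _ n ih =>
    intro hn
    have hlim := (tendsto_DMV_smul_div_pow (fun i => (hP i).nonempty_isCompact_convex) n).sub
      (tendsto_finsetSum (Finset.range n) fun i hi =>
        (ih i (Finset.mem_range.mp hi) ((Finset.mem_range.mp hi).le.trans hn)).mul_const
          (((n + d - i).choose d : ℕ) : ℝ))
    rw [eq_sub_sum_of_eq_sum_choose hn (hA n), mul_sub, Finset.mul_sum]
    simp only [mul_assoc] at hlim ⊢
    refine hlim.congr' ?_
    filter_upwards [eventually_ge_atTop 1] with r hr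
    rw [eq_sub_sum_of_eq_sum_choose hn (hh r hr n), sub_div, Finset.sum_div]
    congr 1
    exact Finset.sum_congr rfl fun i _ => by ring
end
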